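/- arXiv:2407.17343 — 2 statements merged into one kernel-verified Lean document; each statement's English description precedes it below -/
import Mathlib

section
/- Let κ = 3^{2/3}/2^{1/3} and let M₊ be the Melnikov function. Then M₊'(0) ∈ [−5.15341, −4.56572]; in particular M₊'(0) < 0. -/
open Real Filter MeasureTheory intervalIntegral
open scoped Topology

/-- The constant `κ = 3^{2/3}/2^{1/3}`. -/
noncomputable def kap : ℝ := (3 : ℝ) ^ ((2 : ℝ) / 3) / (2 : ℝ) ^ ((1 : ℝ) / 3)

/-- The (absolutely convergent) integrand of the Melnikov function `M₊`. -/
noncomputable def melInt (α s : ℝ) : ℝ :=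
  s ^ ((2 : ℝ) / 3) * Real.sin (α - s) *
    (1 + kap ^ 2 * s ^ ((4 : ℝ) / 3)
      - 2 * kap * s ^ ((2 : ℝ) / 3) * Real.cos (α - s)) ^ (-(3 / 2) : ℝ)

/-- The Melnikov function
`M₊(α) = κ ∫₀^∞ melInt(α,s) ds + √(2/κ) · lim_{T→∞} ∫₀^T cos(α-s) s^{-1/3} ds`. -/
noncomputable def Mplus (α : ℝ) : ℝ :=
  kap * (∫ s in Set.Ioi (0 : ℝ), melInt α s) +
    Real.sqrt (2 / kap) *
      limUnder atTop (fun T => ∫ s in (0 : ℝ)..T, Real.cos (α - s) * s ^ (-(1 / 3) : ℝ))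

/-- The integrand `F(θ,s)` of the non-oscillatory part `I₁` of `M₊'`. -/
noncomputable def Fder (θ s : ℝ) : ℝ :=
  s ^ ((2 : ℝ) / 3) * Real.cos (θ - s) *
    (1 + kap ^ 2 * s ^ ((4 : ℝ) / 3)
      - 2 * kap * s ^ ((2 : ℝ) / 3) * Real.cos (θ - s)) ^ (-(3 / 2) : ℝ)
  - 3 * kap * s ^ ((4 : ℝ) / 3) * Real.sin (θ - s) ^ 2 *
    (1 + kap ^ 2 * s ^ ((4 : ℝ) / 3)
      - 2 * kap * s ^ ((2 : ℝ) / 3) * Real.cos (θ - s)) ^ (-(5 / 2) : ℝ)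

/-- Denominator of the fixed-point numbers used for the verified quadrature. -/
def fpScale : ℕ := 10 ^ 15

/-- An interval with fixed-point endpoints. -/
structure FpInterval where
  lo : ℕ
  hi : ℕ

namespace FpInterval

/-- `x` lies in the interval. -/
def Contains (I : FpInterval) (x : ℝ) : Prop :=
  (I.lo : ℝ) ≤ fpScale * x ∧ fpScale * x ≤ I.hi

/-- Interval addition. -/
def add (I J : FpInterval) : FpInterval := ⟨I.lo + J.lo, I.hi + J.hi⟩

/-- Interval subtraction, for nonnegative differences. -/
def sub (I J : FpInterval) : FpInterval := ⟨I.lo - J.hi, I.hi - J.lo⟩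

/-- Interval multiplication. -/
def mul (I J : FpInterval) : FpInterval :=
  ⟨I.lo * J.lo / fpScale, I.hi * J.hi / fpScale + 1⟩

/-- Multiplication by a natural number. -/
def smul (k : ℕ) (I : FpInterval) : FpInterval := ⟨k * I.lo, k * I.hi⟩

/-- Division by a natural number. -/
def sdiv (I : FpInterval) (k : ℕ) : FpInterval := ⟨I.lo / k, I.hi / k + 1⟩

/-- Enclosure of the inverse. -/
def inv (I : FpInterval) : FpInterval :=
  ⟨fpScale ^ 2 / I.hi, fpScale ^ 2 / I.lo + 1⟩

/-- Heron iteration for the integer square root of `n`. -/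
def heron (n : ℕ) : ℕ → ℕ → ℕ
  | 0, t => t + 1
  | k + 1, t => heron n k ((t + n / t) / 2)

/-- Enclosure of `1 / √x`. -/
def rsqrt (I : FpInterval) : FpInterval :=
  let m := fpScale ^ 3 / I.hi
  let n := fpScale ^ 3 / I.lo + 1
  let t := heron m 8 fpScale
  let u := heron n 8 fpScale
  ⟨min t (m / t), max u (n / u + 1)⟩

end FpInterval

/-- Evaluates its first argument before passing it on. -/
def forceNat {β : Type} (n : ℕ) (k : ℕ → β) : β :=
  match n with
  | 0 => k 0
  | m + 1 => k (m + 1)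

/-- Evaluates the endpoints of its first argument before passing it on. -/
def forceFp {β : Type} (I : FpInterval) (k : FpInterval → β) : β :=
  forceNat I.lo fun l => forceNat I.hi fun h => k ⟨l, h⟩

open FpInterval

/-- Enclosure of `(√2 / 3) (a / 4000) ^ 3`. -/
def timeFp (a : ℕ) : FpInterval :=
  ⟨141421356237 * a ^ 3 * fpScale / (192 * 10 ^ 20),
    141421356238 * a ^ 3 * fpScale / (192 * 10 ^ 20) + 1⟩

/-- Enclosure of `1 - cos (2 ^ k * y)` from one of `1 - cos y`. -/
def versDouble : ℕ → FpInterval → FpInterval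
  | 0, V => V
  | k + 1, V => forceFp (smul 2 (mul V (sub ⟨2 * fpScale, 2 * fpScale⟩ V))) (versDouble k)

/-- Enclosure of `1 - cos s`. -/
def versFp (s : FpInterval) : FpInterval :=
  forceFp (sdiv (mul s s) 65536) fun z =>
  forceFp (mul z z) fun zz =>
  forceFp (add (sub (sdiv z 2) (sdiv zz 24)) ⟨0, (mul z zz).hi / 720 + 1⟩)
  (versDouble 8)

/-- Enclosure of `1 - cos` on `[s, t]` from its values `V`, `W` at the endpoints, by monotonicity
up to `3` and by the Lipschitz bound afterwards. -/
def versCell (s t V W : FpInterval) : FpInterval :=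
  if t.hi ≤ 3 * fpScale then ⟨V.lo, W.hi⟩ else
    ⟨(V.lo + W.lo - (t.hi - s.lo)) / 2,
      min (2 * fpScale) ((V.hi + W.hi + (t.hi - s.lo)) / 2 + 1)⟩

/-- Enclosure of `[(a / 4000) ^ 2, (b / 4000) ^ 2]`. -/
def radiusFp (a b : ℕ) : FpInterval :=
  ⟨a ^ 2 * fpScale / (16 * 10 ^ 6), b ^ 2 * fpScale / (16 * 10 ^ 6) + 1⟩

/-- Enclosure of `|1 - r|`. -/
def distFp (r : FpInterval) : FpInterval :=
  ⟨(fpScale - r.hi) + (r.lo - fpScale), max (fpScale - r.lo) (r.hi - fpScale)⟩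

/-- Interval quadrature over `n` grid cells of width `h`: adds enclosures of the integrals of the
positive and of the negative part of the integrand to the accumulators `P` and `N`. Here `s` and
`V` enclose the left end of the first cell and the value of `1 - cos` there. The final flag tells
whether all the divisions were legitimate. -/
def quad (h : ℕ) : ℕ → ℕ → FpInterval → FpInterval → FpInterval → FpInterval →
    FpInterval × FpInterval × Bool
  | 0, _, _, _, P, N => (P, N, true)
  | n + 1, a, s, V, P, N =>
    forceNat (a + h) fun b =>
    forceFp (timeFp b) fun t =>
    forceFp (versFp t) fun W =>
    forceFp (versCell s t V W) fun v =>
    forceFp (radiusFp a b) fun r =>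
    forceFp (distFp r) fun e =>
    forceFp (add (mul e e) (smul 2 (mul r v))) fun D =>
    forceFp (rsqrt D) fun y =>
    forceFp (mul y y) fun yy =>
    forceFp (mul r (mul yy y)) fun c =>
    forceFp (mul r r) fun rr =>
    forceFp (mul v (inv rr)) fun p =>
    forceFp (sub t s) fun w =>
    forceFp (add P (mul w (add p c))) fun P' =>
    forceFp (add N (mul w (mul v (add c (smul 3
      (mul r (mul (sub ⟨2 * fpScale, 2 * fpScale⟩ v) (mul yy c)))))))) fun N' =>
    bif Nat.ble b 16000 && Nat.ble 1 D.lo && Nat.ble 1 rr.lo then quad h n b t W P' N'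
    else (P, N, false)

namespace FpInterval

lemma natCast_div_le_add_one (m n : ℕ) : (m : ℝ) / n ≤ ((m / n : ℕ) : ℝ) + 1 := by
  rw [← Nat.floor_div_eq_div (K := ℝ) m n]
  exact (Nat.lt_floor_add_one _).le

lemma fpScale_pos : (0 : ℝ) < fpScale := by norm_num [fpScale]

lemma Contains.nonneg {I : FpInterval} {x : ℝ} (h : I.Contains x) : 0 ≤ x := by
  have h1 : (0 : ℝ) ≤ fpScale * x := le_trans (Nat.cast_nonneg _) h.1
  exact nonneg_of_mul_nonneg_right h1 fpScale_pos

lemma Contains.add {I J : FpInterval} {x y : ℝ} (hx : I.Contains x) (hy : J.Contains y) :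
    (I.add J).Contains (x + y) := by
  obtain ⟨h1, h2⟩ := hx
  obtain ⟨h3, h4⟩ := hy
  constructor <;> simp only [FpInterval.add, Nat.cast_add] <;> linarith

lemma Contains.sub {I J : FpInterval} {x y : ℝ} (hx : I.Contains x) (hy : J.Contains y)
    (hyx : y ≤ x) : (I.sub J).Contains (x - y) := by
  obtain ⟨h1, h2⟩ := hx
  obtain ⟨h3, h4⟩ := hy
  have h0 : 0 ≤ (fpScale : ℝ) * (x - y) := mul_nonneg fpScale_pos.le (sub_nonneg.2 hyx)
  constructor <;> simp only [FpInterval.sub]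
  · rcases le_total I.lo J.hi with h | h
    · rw [Nat.sub_eq_zero_of_le h]; simpa using h0
    · rw [Nat.cast_sub h]; linarith
  · have : (I.hi : ℝ) ≤ ((I.hi - J.lo : ℕ) : ℝ) + J.lo := by
      exact_mod_cast Nat.sub_le_iff_le_add.1 le_rfl
    linarith

lemma Contains.mul {I J : FpInterval} {x y : ℝ} (hx : I.Contains x) (hy : J.Contains y) :
    (I.mul J).Contains (x * y) := by
  have hx0 := hx.nonneg
  have hy0 := hy.nonneg
  obtain ⟨h1, h2⟩ := hx
  obtain ⟨h3, h4⟩ := hy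
  have hS := fpScale_pos
  constructor <;> simp only [FpInterval.mul]
  · refine Nat.cast_div_le.trans ?_
    rw [div_le_iff₀ hS]
    push_cast
    calc (I.lo : ℝ) * J.lo ≤ (fpScale * x) * (fpScale * y) := by gcongr
      _ = _ := by ring
  · have := natCast_div_le_add_one (I.hi * J.hi) fpScale
    push_cast at this ⊢
    refine le_trans ?_ this
    rw [le_div_iff₀ hS]
    calc _ = (fpScale * x) * (fpScale * y) := by ring
      _ ≤ (I.hi : ℝ) * J.hi := by gcongr

lemma Contains.smul {I : FpInterval} {x : ℝ} (hx : I.Contains x) (k : ℕ) :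
    (I.smul k).Contains (k * x) := by
  obtain ⟨h1, h2⟩ := hx
  constructor <;> simp only [FpInterval.smul] <;> push_cast <;> rw [mul_left_comm] <;> gcongr

lemma Contains.sdiv {I : FpInterval} {x : ℝ} (hx : I.Contains x) (k : ℕ) :
    (I.sdiv k).Contains (x / k) := by
  obtain ⟨h1, h2⟩ := hx
  constructor <;> simp only [FpInterval.sdiv]
  · refine Nat.cast_div_le.trans ?_
    rw [← mul_div_assoc]
    gcongr
  · have := natCast_div_le_add_one I.hi k
    push_cast
    refine le_trans ?_ this
    rw [← mul_div_assoc]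
    gcongr

lemma Contains.inv {I : FpInterval} {x : ℝ} (hx : I.Contains x) (h0 : 1 ≤ I.lo) :
    I.inv.Contains x⁻¹ := by
  obtain ⟨h1, h2⟩ := hx
  have hS := fpScale_pos
  have hl : (1 : ℝ) ≤ I.lo := by exact_mod_cast h0
  have hx0 : 0 < x := pos_of_mul_pos_right (by linarith : (0 : ℝ) < fpScale * x) hS.le
  constructor <;> simp only [FpInterval.inv]
  · refine Nat.cast_div_le.trans ?_
    push_cast
    rw [div_le_iff₀ (by linarith)]
    calc (fpScale : ℝ) ^ 2 = fpScale * x⁻¹ * (fpScale * x) := by field_simp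
      _ ≤ _ := by gcongr
  · have := natCast_div_le_add_one (fpScale ^ 2) I.lo
    push_cast at this ⊢
    refine le_trans ?_ this
    rw [le_div_iff₀ (by linarith)]
    calc _ ≤ fpScale * x⁻¹ * (fpScale * x) := by gcongr
      _ = _ := by field_simp

lemma heron_pos (n k t : ℕ) : 0 < heron n k t := by
  induction k generalizing t with
  | zero => simp [heron]
  | succ k ih => exact ih _

lemma Contains.rsqrt {I : FpInterval} {x y : ℝ} (hx : I.Contains x) (h0 : 1 ≤ I.lo)
    (hy : 0 ≤ y) (hyx : y ^ 2 * x = 1) : I.rsqrt.Contains y := by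
  obtain ⟨h1, h2⟩ := hx
  have hS := fpScale_pos
  have hl : (1 : ℝ) ≤ I.lo := by exact_mod_cast h0
  have hx0 : 0 < x := pos_of_mul_pos_right (by linarith : (0 : ℝ) < fpScale * x) hS.le
  have key : (fpScale * y) ^ 2 * (fpScale * x) = (fpScale : ℝ) ^ 3 := by
    linear_combination (fpScale : ℝ) ^ 3 * hyx
  constructor <;> simp only [FpInterval.rsqrt]
  · set m := fpScale ^ 3 / I.hi with hm
    have hmy : (m : ℝ) ≤ (fpScale * y) ^ 2 := by
      refine Nat.cast_div_le.trans ?_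
      push_cast
      rw [div_le_iff₀ (by linarith), ← key]
      gcongr
    set t := heron m 8 fpScale
    have ht : (0 : ℝ) < t := by exact_mod_cast heron_pos _ _ _
    have htm : ((m / t : ℕ) : ℝ) * t ≤ m := by exact_mod_cast Nat.div_mul_le_self m t
    by_contra! hc
    rw [Nat.cast_min, lt_min_iff] at hc
    have : (fpScale * y) * (fpScale * y) < ((m / t : ℕ) : ℝ) * t := by
      apply mul_lt_mul'' hc.2 hc.1 <;> positivity
    nlinarith
  · set n := fpScale ^ 3 / I.lo + 1 with hn
    have hny : (fpScale * y) ^ 2 ≤ (n : ℝ) := by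
      have := natCast_div_le_add_one (fpScale ^ 3) I.lo
      push_cast [hn] at this ⊢
      refine le_trans ?_ this
      rw [le_div_iff₀ (by linarith), ← key]
      gcongr
    set t := heron n 8 fpScale
    have ht : (0 : ℝ) < t := by exact_mod_cast heron_pos _ _ _
    have htn : (n : ℝ) ≤ ((n / t + 1 : ℕ) : ℝ) * t := by
      have := natCast_div_le_add_one n t
      rw [div_le_iff₀ ht] at this
      exact_mod_cast this
    by_contra! hc
    rw [Nat.cast_max, max_lt_iff] at hc
    have : ((n / t + 1 : ℕ) : ℝ) * t < (fpScale * y) * (fpScale * y) := by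
      apply mul_lt_mul'' hc.2 hc.1 <;> positivity
    nlinarith

end FpInterval

lemma forceNat_eq {β : Type} (n : ℕ) (k : ℕ → β) : forceNat n k = k n := by
  cases n <;> rfl

lemma forceFp_eq {β : Type} (I : FpInterval) (k : FpInterval → β) : forceFp I k = k I := by
  simp [forceFp, forceNat_eq]

lemma contains_timeFp (a : ℕ) : (timeFp a).Contains (√2 / 3 * (a / 4000) ^ 3) := by
  have hS := fpScale_pos
  have h1 : (1.41421356237 : ℝ) ≤ √2 := Real.le_sqrt_of_sq_le (by norm_num)
  have h2 : √2 ≤ (1.41421356238 : ℝ) := Real.sqrt_le_iff.2 (by norm_num)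
  have h3 : 0 ≤ (fpScale : ℝ) * a ^ 3 := by positivity
  constructor <;> simp only [timeFp]
  · refine Nat.cast_div_le.trans ?_
    push_cast
    rw [div_le_iff₀ (by norm_num)]
    nlinarith
  · have := natCast_div_le_add_one (141421356238 * a ^ 3 * fpScale) (192 * 10 ^ 20)
    push_cast at this ⊢
    refine le_trans ?_ this
    rw [le_div_iff₀ (by norm_num)]
    nlinarith

lemma contains_versDouble (k : ℕ) {V : FpInterval} {y : ℝ} (h : V.Contains (1 - cos y)) :
    (versDouble k V).Contains (1 - cos (2 ^ k * y)) := by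
  induction k generalizing V y with
  | zero => simpa [versDouble] using h
  | succ k ih =>
    rw [versDouble, forceFp_eq]
    have h2 : FpInterval.Contains ⟨2 * fpScale, 2 * fpScale⟩ 2 := by
      constructor <;> push_cast <;> linarith
    have := (h.mul (h2.sub h (by linarith [neg_one_le_cos y]))).smul 2
    rw [show (2 : ℝ) ^ (k + 1) * y = 2 ^ k * (2 * y) by ring]
    apply ih
    convert this using 1
    rw [cos_two_mul]; push_cast; ring

lemma nonneg_of_hasDerivAt_nonneg {f g : ℝ → ℝ} (h0 : f 0 = 0) (hf : ∀ x, HasDerivAt f (g x) x)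
    (hg : ∀ x, 0 ≤ x → 0 ≤ g x) {x : ℝ} (hx : 0 ≤ x) : 0 ≤ f x := by
  have hm : MonotoneOn f (Set.Ici 0) := by
    apply monotoneOn_of_hasDerivWithinAt_nonneg (f' := g) (convex_Ici 0)
      (fun x _ => (hf x).continuousAt.continuousWithinAt)
    · exact fun x _ => (hf x).hasDerivWithinAt
    · intro x hx
      rw [interior_Ici] at hx
      exact hg x hx.le
  simpa [h0] using hm (Set.mem_Ici.2 le_rfl) hx hx

lemma one_sub_cos_bounds {y : ℝ} (hy : 0 ≤ y) :
    y ^ 2 / 2 - y ^ 4 / 24 ≤ 1 - cos y ∧ 1 - cos y ≤ y ^ 2 / 2 - y ^ 4 / 24 + y ^ 6 / 720 := by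
  have s1 : ∀ x, 0 ≤ x → 0 ≤ x - sin x := fun x hx => sub_nonneg.2 (sin_le hx)
  have c1 : ∀ x, 0 ≤ x → 0 ≤ cos x - 1 + x ^ 2 / 2 := fun x hx =>
    nonneg_of_hasDerivAt_nonneg (f := fun x => cos x - 1 + x ^ 2 / 2)
      (g := fun x => x - sin x) (by simp) (fun x => by
      have := ((hasDerivAt_cos x).sub_const 1).add ((hasDerivAt_pow 2 x).div_const 2)
      exact this.congr_deriv (by push_cast; ring)) s1 hx
  have s2 : ∀ x, 0 ≤ x → 0 ≤ sin x - x + x ^ 3 / 6 := fun x hx =>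
    nonneg_of_hasDerivAt_nonneg (f := fun x => sin x - x + x ^ 3 / 6)
      (g := fun x => cos x - 1 + x ^ 2 / 2) (by simp) (fun x => by
      have := ((hasDerivAt_sin x).sub (hasDerivAt_id x)).add ((hasDerivAt_pow 3 x).div_const 6)
      exact this.congr_deriv (by push_cast; ring)) c1 hx
  have c2 : ∀ x, 0 ≤ x → 0 ≤ 1 - cos x - x ^ 2 / 2 + x ^ 4 / 24 := fun x hx =>
    nonneg_of_hasDerivAt_nonneg (f := fun x => 1 - cos x - x ^ 2 / 2 + x ^ 4 / 24)
      (g := fun x => sin x - x + x ^ 3 / 6) (by simp) (fun x => by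
      have := (((hasDerivAt_cos x).const_sub 1).sub ((hasDerivAt_pow 2 x).div_const 2)).add
        ((hasDerivAt_pow 4 x).div_const 24)
      exact this.congr_deriv (by push_cast; ring)) s2 hx
  have s3 : ∀ x, 0 ≤ x → 0 ≤ x - sin x - x ^ 3 / 6 + x ^ 5 / 120 := fun x hx =>
    nonneg_of_hasDerivAt_nonneg (f := fun x => x - sin x - x ^ 3 / 6 + x ^ 5 / 120)
      (g := fun x => 1 - cos x - x ^ 2 / 2 + x ^ 4 / 24) (by simp) (fun x => by
      have := (((hasDerivAt_id x).sub (hasDerivAt_sin x)).sub (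
        (hasDerivAt_pow 3 x).div_const 6)).add ((hasDerivAt_pow 5 x).div_const 120)
      exact this.congr_deriv (by push_cast; ring)) c2 hx
  have c3 : ∀ x, 0 ≤ x → 0 ≤ cos x - 1 + x ^ 2 / 2 - x ^ 4 / 24 + x ^ 6 / 720 := fun x hx =>
    nonneg_of_hasDerivAt_nonneg (f := fun x => cos x - 1 + x ^ 2 / 2 - x ^ 4 / 24 + x ^ 6 / 720)
      (g := fun x => x - sin x - x ^ 3 / 6 + x ^ 5 / 120) (by simp) (fun x => by
      have := ((((hasDerivAt_cos x).sub_const 1).add ((hasDerivAt_pow 2 x).div_const 2)).sub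
        ((hasDerivAt_pow 4 x).div_const 24)).add ((hasDerivAt_pow 6 x).div_const 720)
      exact this.congr_deriv (by push_cast; ring)) s3 hx
  exact ⟨by linarith [c2 y hy], by linarith [c3 y hy]⟩

lemma contains_versFp {I : FpInterval} {s : ℝ} (h : I.Contains s) (hs : s ≤ 100) :
    (versFp I).Contains (1 - cos s) := by
  have h0 := h.nonneg
  simp only [versFp, forceFp_eq]
  have hz := (h.mul h).sdiv 65536
  set z := s * s / ((65536 : ℕ) : ℝ) with hzdef
  have hz' : z = (s / 256) ^ 2 := by rw [hzdef]; push_cast; ring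
  have hzz := hz.mul hz
  have h3 := hz.mul hzz
  have hz1 : z ≤ 1 := by rw [hz']; nlinarith
  have hz0 := hz.nonneg
  have hd := (hz.sdiv 2).sub (hzz.sdiv 24) (by push_cast; nlinarith)
  obtain ⟨b1, b2⟩ := one_sub_cos_bounds (y := s / 256) (by positivity)
  rw [show s = 2 ^ 8 * (s / 256) by ring]
  apply contains_versDouble
  rw [show 1 - cos (s / 256) = (z / ((2 : ℕ) : ℝ) - z * z / ((24 : ℕ) : ℝ)) +
    ((1 - cos (s / 256)) - (z / ((2 : ℕ) : ℝ) - z * z / ((24 : ℕ) : ℝ))) by ring]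
  apply hd.add
  have e1 : z / ((2 : ℕ) : ℝ) - z * z / ((24 : ℕ) : ℝ) =
      (s / 256) ^ 2 / 2 - (s / 256) ^ 4 / 24 := by
    rw [hz']; push_cast; ring
  rw [e1]
  constructor
  · simp only [Nat.cast_zero]
    exact mul_nonneg fpScale_pos.le (by linarith)
  · have := natCast_div_le_add_one
      (((I.mul I).sdiv 65536).mul (((I.mul I).sdiv 65536).mul ((I.mul I).sdiv 65536))).hi 720
    push_cast at this ⊢
    refine le_trans ?_ this
    rw [le_div_iff₀ (by norm_num)]
    refine le_trans ?_ h3.2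
    rw [mul_assoc]
    refine mul_le_mul_of_nonneg_left ?_ fpScale_pos.le
    have e3 : z * (z * z) = (s / 256) ^ 6 := by rw [hz']; ring
    linarith

lemma contains_versCell {I J V W : FpInterval} {s t u : ℝ} (hs : I.Contains s) (ht : J.Contains t)
    (hV : V.Contains (1 - cos s)) (hW : W.Contains (1 - cos t)) (hsu : s ≤ u) (hut : u ≤ t) :
    (versCell I J V W).Contains (1 - cos u) := by
  have hS := fpScale_pos
  have hs0 := hs.nonneg
  rw [versCell]
  split_ifs with hc
  · have ht3 : t ≤ 3 := by
      have : (J.hi : ℝ) ≤ 3 * fpScale := by exact_mod_cast hc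
      nlinarith [ht.2]
    have htpi : t ≤ π := by linarith [pi_gt_three]
    have c1 : cos u ≤ cos s := cos_le_cos_of_nonneg_of_le_pi hs0 (hut.trans htpi) hsu
    have c2 : cos t ≤ cos u := cos_le_cos_of_nonneg_of_le_pi (hs0.trans hsu) htpi hut
    exact ⟨hV.1.trans (by gcongr), le_trans (by gcongr) hW.2⟩
  · have lip : ∀ x y : ℝ, |cos x - cos y| ≤ |x - y| := abs_cos_sub_cos_le
    have l1 := abs_le.1 (lip u s)
    have l2 := abs_le.1 (lip u t)
    rw [abs_of_nonneg (by linarith)] at l1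
    rw [abs_of_nonpos (by linarith)] at l2
    have hd : fpScale * (t - s) ≤ ((J.hi - I.lo : ℕ) : ℝ) := (ht.sub hs (hsu.trans hut)).2
    constructor
    · refine Nat.cast_div_le.trans ?_
      rw [div_le_iff₀ (by norm_num)]
      rcases le_total (V.lo + W.lo) (J.hi - I.lo) with h | h
      · rw [Nat.sub_eq_zero_of_le h]
        have : 0 ≤ (1 - cos u) := by linarith [cos_le_one u]
        push_cast; positivity
      · rw [Nat.cast_sub h]
        push_cast
        nlinarith [hV.1, hW.1]
    · rw [Nat.cast_min, le_min_iff]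
      constructor
      · push_cast
        nlinarith [neg_one_le_cos u]
      · have := natCast_div_le_add_one (V.hi + W.hi + (J.hi - I.lo)) 2
        push_cast at this ⊢
        refine le_trans ?_ this
        rw [le_div_iff₀ (by norm_num)]
        nlinarith [hV.2, hW.2]

lemma contains_radiusFp {a b : ℕ} {r : ℝ} (ha : ((a : ℝ) / 4000) ^ 2 ≤ r)
    (hb : r ≤ ((b : ℝ) / 4000) ^ 2) : (radiusFp a b).Contains r := by
  have hS := fpScale_pos
  constructor <;> simp only [radiusFp]
  · refine Nat.cast_div_le.trans ?_
    push_cast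
    rw [div_le_iff₀ (by norm_num)]
    nlinarith
  · have := natCast_div_le_add_one (b ^ 2 * fpScale) (16 * 10 ^ 6)
    push_cast at this ⊢
    refine le_trans ?_ this
    rw [le_div_iff₀ (by norm_num)]
    nlinarith

lemma contains_distFp {I : FpInterval} {r : ℝ} (h : I.Contains r) :
    (distFp I).Contains |1 - r| := by
  obtain ⟨h1, h2⟩ := h
  have hS := fpScale_pos
  have hle : ∀ m n : ℕ, (m : ℝ) ≤ ((m - n : ℕ) : ℝ) + n := fun m n => by
    exact_mod_cast Nat.sub_le_iff_le_add.1 le_rfl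
  have hSS : (fpScale : ℝ) * |1 - r| = |fpScale - fpScale * r| := by
    rw [← abs_of_pos hS, ← abs_mul, abs_of_pos hS]; ring_nf
  unfold FpInterval.Contains
  rw [hSS]
  have hIJ : I.lo ≤ I.hi := by exact_mod_cast h1.trans h2
  constructor <;> simp only [distFp]
  · rcases le_total I.hi fpScale with h | h
    · rw [Nat.sub_eq_zero_of_le (hIJ.trans h), add_zero, Nat.cast_sub h]
      exact le_trans (by linarith) (le_abs_self _)
    · rw [Nat.sub_eq_zero_of_le h, zero_add]
      rcases le_total I.lo fpScale with h' | h'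
      · rw [Nat.sub_eq_zero_of_le h']
        simp
      · rw [Nat.cast_sub h']
        exact le_trans (by linarith) (neg_le_abs _)
  · rw [Nat.cast_max, abs_le']
    exact ⟨le_max_of_le_left (by linarith [hle fpScale I.lo]),
      le_max_of_le_right (by linarith [hle I.hi fpScale])⟩

/-- The parabolic radius `κ s ^ (2 / 3)`. -/
noncomputable def radius (s : ℝ) : ℝ := kap * s ^ ((2 : ℝ) / 3)

/-- The squared distance to the circling body. -/
noncomputable def distSq (α s : ℝ) : ℝ := 1 + radius s ^ 2 - 2 * radius s * cos (α - s)

lemma kap_pos : 0 < kap := by unfold kap; positivity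

lemma kap_cube : kap ^ 3 = 9 / 2 := by
  unfold kap
  rw [div_pow, ← Real.rpow_natCast, ← Real.rpow_natCast, ← Real.rpow_mul (by norm_num),
    ← Real.rpow_mul (by norm_num)]
  norm_num

lemma sqrt_two_div_kap : √(2 / kap) = 2 * kap / 3 := by
  have hk := kap_pos
  rw [Real.sqrt_eq_iff_mul_self_eq (by positivity) (by positivity)]
  field_simp
  linear_combination (-2) * kap_cube

lemma radius_pos {s : ℝ} (hs : 0 < s) : 0 < radius s :=
  mul_pos kap_pos (Real.rpow_pos_of_pos hs _)

lemma radius_cube {s : ℝ} (hs : 0 ≤ s) : radius s ^ 3 = 9 / 2 * s ^ 2 := by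
  rw [radius, mul_pow, kap_cube, ← Real.rpow_natCast (s ^ ((2 : ℝ) / 3)), ← Real.rpow_mul hs]
  norm_num

lemma radius_sq {s : ℝ} (hs : 0 ≤ s) : radius s ^ 2 = kap ^ 2 * s ^ ((4 : ℝ) / 3) := by
  rw [radius, mul_pow, ← Real.rpow_natCast (s ^ ((2 : ℝ) / 3)), ← Real.rpow_mul hs]
  norm_num

/-- Near `α = 0` the two bodies stay uniformly apart. -/
lemma distSq_lower_bound {α s : ℝ} (hα : |α| ≤ 1 / 10) (hs : 0 < s) :
    1 / 100 * (1 + radius s ^ 2) ≤ distSq α s := by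
  have hr := radius_pos hs
  have hr3 := radius_cube hs.le
  set r := radius s with hrdef
  have hα' := abs_le.1 hα
  unfold distSq
  rw [← hrdef]
  have hc1 := cos_le_one (α - s)
  by_cases h1 : r ≤ 4 / 5
  · nlinarith
  by_cases h2 : 5 / 4 ≤ r
  · nlinarith
  push Not at h1 h2
  have s1 : 3 / 10 ≤ s := by
    by_contra! h
    have : r ^ 3 > (4 / 5) ^ 3 := by gcongr
    nlinarith
  have s2 : s ≤ 7 / 10 := by
    by_contra! h
    have : r ^ 3 < (5 / 4) ^ 3 := by gcongr
    nlinarith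
  have hc : cos (α - s) ≤ 0.985 := by
    rw [← cos_neg, neg_sub]
    have := (one_sub_cos_bounds (y := s - α) (by linarith)).1
    nlinarith [mul_nonneg (by linarith : 0 ≤ s - α - 1 / 5) (by linarith : 0 ≤ 1 - (s - α)),
      sq_nonneg ((s - α)^2)]
  nlinarith [sq_nonneg (r - 1)]

lemma distSq_pos {α s : ℝ} (hα : |α| ≤ 1 / 10) (hs : 0 < s) : 0 < distSq α s :=
  lt_of_lt_of_le (by positivity) (distSq_lower_bound hα hs)

/-- The integrand of `M₊'(0)` after integrating the oscillatory part by parts. -/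
noncomputable def derivInt (s : ℝ) : ℝ :=
  kap * Fder 0 s + (1 - cos s) * (radius s * radius s)⁻¹

/-- The inverse distance at `α = 0`. -/
noncomputable def invDist (s : ℝ) : ℝ := (√(distSq 0 s))⁻¹

/-- The repelling part of `derivInt`. -/
noncomputable def repelPart (s : ℝ) : ℝ :=
  (1 - cos s) * (radius s * radius s)⁻¹ + radius s * (invDist s * invDist s * invDist s)

/-- The attracting part of `derivInt`. -/
noncomputable def attractPart (s : ℝ) : ℝ :=
  (1 - cos s) * (radius s * (invDist s * invDist s * invDist s) +
    3 * (radius s * ((2 - (1 - cos s)) *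
      (invDist s * invDist s * (radius s * (invDist s * invDist s * invDist s))))))

lemma invDist_pos {s : ℝ} (hs : 0 < s) : 0 < invDist s :=
  inv_pos.2 (Real.sqrt_pos.2 (distSq_pos (by norm_num) hs))

lemma invDist_sq_mul {s : ℝ} (hs : 0 < s) : invDist s ^ 2 * distSq 0 s = 1 := by
  have h := distSq_pos (α := 0) (by norm_num) hs
  rw [invDist, inv_pow, Real.sq_sqrt h.le, inv_mul_cancel₀ h.ne']

lemma distSq_zero (s : ℝ) :
    distSq 0 s = |1 - radius s| * |1 - radius s| + 2 * (radius s * (1 - cos s)) := by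
  rw [abs_mul_abs_self, distSq, zero_sub, cos_neg]; ring

lemma distSq_eq {α s : ℝ} (hs : 0 ≤ s) : distSq α s =
    1 + kap ^ 2 * s ^ ((4 : ℝ) / 3) - 2 * kap * s ^ ((2 : ℝ) / 3) * cos (α - s) := by
  rw [distSq, radius_sq hs, radius]; ring

lemma rpow_distSq {α s : ℝ} (h : 0 < distSq α s) (k : ℕ) :
    distSq α s ^ (-((k : ℝ) / 2)) = (√(distSq α s))⁻¹ ^ k := by
  rw [Real.sqrt_eq_rpow, ← Real.rpow_neg h.le, ← Real.rpow_natCast, ← Real.rpow_mul h.le]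
  congr 1; ring

lemma kap_mul_Fder {s : ℝ} (hs : 0 < s) : kap * Fder 0 s =
    radius s * cos s * invDist s ^ 3 - 3 * radius s ^ 2 * sin s ^ 2 * invDist s ^ 5 := by
  have h := distSq_pos (α := 0) (by norm_num) hs
  have e3 : distSq 0 s ^ (-(3 / 2) : ℝ) = invDist s ^ 3 := by
    exact_mod_cast rpow_distSq h 3
  have e5 : distSq 0 s ^ (-(5 / 2) : ℝ) = invDist s ^ 5 := by
    exact_mod_cast rpow_distSq h 5
  rw [Fder, ← distSq_eq hs.le, e3, e5, radius_sq hs.le, radius, zero_sub, cos_neg, sin_neg]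
  ring

lemma derivInt_eq {s : ℝ} (hs : 0 < s) : derivInt s = repelPart s - attractPart s := by
  rw [derivInt, kap_mul_Fder hs, repelPart, attractPart, sin_sq]
  ring

lemma continuousOn_radius : ContinuousOn radius (Set.Ioi 0) :=
  continuousOn_const.mul (continuousOn_id.rpow_const fun _ hx => Or.inl (ne_of_gt hx))

lemma continuousOn_distSq (α : ℝ) : ContinuousOn (distSq α) (Set.Ioi 0) := by
  have := continuousOn_radius
  unfold distSq
  fun_prop

lemma continuousOn_invDist : ContinuousOn invDist (Set.Ioi 0) :=
  (continuousOn_distSq 0).sqrt.inv₀ fun _ hx => (inv_pos.1 (invDist_pos hx)).ne'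

lemma continuousOn_repelPart : ContinuousOn repelPart (Set.Ioi 0) := by
  have h1 := continuousOn_radius
  have h2 := continuousOn_invDist
  have h3 : ContinuousOn (fun s => (radius s * radius s)⁻¹) (Set.Ioi 0) :=
    (h1.mul h1).inv₀ fun _ hx => (mul_pos (radius_pos hx) (radius_pos hx)).ne'
  unfold repelPart
  fun_prop

lemma continuousOn_attractPart : ContinuousOn attractPart (Set.Ioi 0) := by
  have h1 := continuousOn_radius
  have h2 := continuousOn_invDist
  unfold attractPart
  fun_prop

lemma FpInterval.Contains.integral {I W : FpInterval} {f : ℝ → ℝ} {a b : ℝ} (hab : a ≤ b)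
    (hf : ContinuousOn f (Set.Icc a b)) (hI : ∀ x ∈ Set.Icc a b, I.Contains (f x))
    (hW : W.Contains (b - a)) : (W.mul I).Contains (∫ x in a..b, f x) := by
  have hS := fpScale_pos
  rcases hab.eq_or_lt with rfl | hlt
  · have := hW.mul (hI a (by simp))
    simpa using this
  · have hfi := hf.intervalIntegrable_of_Icc (μ := volume) hab
    have l : ∫ x in a..b, (I.lo : ℝ) / fpScale ≤ ∫ x in a..b, f x := by
      apply intervalIntegral.integral_mono_on hab (by simp) hfi
      intro x hx
      rw [div_le_iff₀' hS]
      exact (hI x hx).1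
    have u : ∫ x in a..b, f x ≤ ∫ x in a..b, (I.hi : ℝ) / fpScale := by
      apply intervalIntegral.integral_mono_on hab hfi (by simp)
      intro x hx
      rw [le_div_iff₀' hS]
      exact (hI x hx).2
    rw [intervalIntegral.integral_const, smul_eq_mul] at l u
    have hba : 0 < b - a := sub_pos.2 hlt
    have hm : I.Contains ((∫ x in a..b, f x) / (b - a)) := by
      constructor
      · rw [mul_div_assoc', le_div_iff₀ hba]
        have := mul_le_mul_of_nonneg_left l hS.le
        calc _ = fpScale * ((b - a) * (I.lo / fpScale)) := by field_simp
          _ ≤ _ := this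
      · rw [mul_div_assoc', div_le_iff₀ hba]
        have := mul_le_mul_of_nonneg_left u hS.le
        calc _ ≤ fpScale * ((b - a) * (I.hi / fpScale)) := this
          _ = _ := by field_simp
    have := hW.mul hm
    rwa [mul_div_cancel₀ _ hba.ne'] at this

/-- The time at which the radius equals `(a / 4000) ^ 2`. -/
noncomputable def gridTime (a : ℕ) : ℝ := √2 / 3 * (a / 4000) ^ 3

lemma gridTime_mono {a b : ℕ} (h : a ≤ b) : gridTime a ≤ gridTime b := by
  unfold gridTime; gcongr

lemma gridTime_pos {a : ℕ} (h : 0 < a) : 0 < gridTime a := by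
  unfold gridTime; positivity

lemma gridTime_sq (a : ℕ) : 9 / 2 * gridTime a ^ 2 = (((a : ℝ) / 4000) ^ 2) ^ 3 := by
  unfold gridTime
  have : √2 ^ 2 = 2 := Real.sq_sqrt (by norm_num)
  linear_combination (1 / 2 * (((a : ℝ) / 4000) ^ 2) ^ 3) * this

lemma radius_mem_of_gridTime {a b : ℕ} {s : ℝ} (ha : gridTime a ≤ s) (hb : s ≤ gridTime b) :
    ((a : ℝ) / 4000) ^ 2 ≤ radius s ∧ radius s ≤ ((b : ℝ) / 4000) ^ 2 := by
  have ha0 : 0 ≤ gridTime a := by unfold gridTime; positivity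
  have hs0 : 0 ≤ s := ha0.trans ha
  have hr : 0 ≤ radius s := mul_nonneg kap_pos.le (Real.rpow_nonneg hs0 _)
  constructor
  · rw [← pow_le_pow_iff_left₀ (by positivity) hr three_ne_zero, ← gridTime_sq, radius_cube hs0]
    gcongr
  · rw [← pow_le_pow_iff_left₀ hr (by positivity) three_ne_zero, ← gridTime_sq, radius_cube hs0]
    gcongr

lemma gridTime_le {a : ℕ} (h : a ≤ 16000) : gridTime a ≤ 100 := by
  refine (gridTime_mono h).trans ?_
  unfold gridTime
  have h2 : √2 ≤ 2 := Real.sqrt_le_iff.2 (by norm_num)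
  norm_num
  linarith

lemma contains_quad (h n : ℕ) {a : ℕ} (ha : 0 < a) {I V P N : FpInterval} {p q : ℝ}
    (hI : I.Contains (gridTime a)) (hV : V.Contains (1 - cos (gridTime a)))
    (hP : P.Contains p) (hN : N.Contains q) (hq : (quad h n a I V P N).2.2 = true) :
    (quad h n a I V P N).1.Contains (p + ∫ s in gridTime a..gridTime (a + n * h), repelPart s) ∧
    (quad h n a I V P N).2.1.Contains
      (q + ∫ s in gridTime a..gridTime (a + n * h), attractPart s) := by
  induction n generalizing a I V P N p q with
  | zero => simpa [quad] using And.intro hP hN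
  | succ n ih =>
    simp only [quad, forceNat_eq, forceFp_eq] at hq ⊢
    set b := a + h with hb
    set J := timeFp b with hJdef
    set W := versFp J with hWdef
    set v := versCell I J V W with hvdef
    set r := radiusFp a b with hrdef
    set e := distFp r with hedef
    set D := (e.mul e).add (FpInterval.smul 2 (r.mul v)) with hDdef
    set y := D.rsqrt with hydef
    rw [cond_eq_ite] at hq ⊢
    split_ifs at hq ⊢ with hc
    simp only [Bool.and_eq_true, Nat.ble_eq] at hc
    obtain ⟨⟨hb16, hDlo⟩, hrlo⟩ := hc
    have hJ : J.Contains (gridTime b) := contains_timeFp b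
    have hW : W.Contains (1 - cos (gridTime b)) := contains_versFp hJ (gridTime_le hb16)
    have hab : gridTime a ≤ gridTime b := gridTime_mono (Nat.le_add_right _ _)
    have h2 : FpInterval.Contains ⟨2 * fpScale, 2 * fpScale⟩ 2 := by
      constructor <;> push_cast <;> linarith
    have cell : ∀ s ∈ Set.Icc (gridTime a) (gridTime b), v.Contains (1 - cos s) ∧
        r.Contains (radius s) ∧ y.Contains (invDist s) := by
      rintro s ⟨hs1, hs2⟩
      have hs0 : 0 < s := (gridTime_pos ha).trans_le hs1
      have hv : v.Contains (1 - cos s) := contains_versCell hI hJ hV hW hs1 hs2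
      obtain ⟨hr1, hr2⟩ := radius_mem_of_gridTime hs1 hs2
      have hr : r.Contains (radius s) := contains_radiusFp hr1 hr2
      have he := contains_distFp hr
      have hD : D.Contains (distSq 0 s) := by
        rw [distSq_zero]
        exact (he.mul he).add (by simpa using (hr.mul hv).smul 2)
      exact ⟨hv, hr, hD.rsqrt hDlo (invDist_pos hs0).le (invDist_sq_mul hs0)⟩
    have hsub : Set.Icc (gridTime a) (gridTime b) ⊆ Set.Ioi 0 :=
      fun s hs => (gridTime_pos ha).trans_le hs.1
    have hw := hJ.sub hI hab
    have hp := FpInterval.Contains.integral hab (continuousOn_repelPart.mono hsub) (fun s hs => by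
      obtain ⟨hv, hr, hy⟩ := cell s hs
      exact (hv.mul ((hr.mul hr).inv hrlo)).add (hr.mul ((hy.mul hy).mul hy))) hw
    have hn := FpInterval.Contains.integral hab (continuousOn_attractPart.mono hsub) (fun s hs => by
      obtain ⟨hv, hr, hy⟩ := cell s hs
      have hc := hr.mul ((hy.mul hy).mul hy)
      exact hv.mul (hc.add (by
        simpa using (hr.mul ((h2.sub hv (by linarith [neg_one_le_cos s])).mul
          ((hy.mul hy).mul hc))).smul 3))) hw
    have hb0 : 0 < b := Nat.add_pos_left ha h
    have hsum : a + (n + 1) * h = b + n * h := by rw [hb]; ring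
    have integ : ∀ f : ℝ → ℝ, ContinuousOn f (Set.Ioi 0) →
        (∫ s in gridTime a..gridTime b, f s) + ∫ s in gridTime b..gridTime (b + n * h), f s =
          ∫ s in gridTime a..gridTime (b + n * h), f s := by
      intro f hf
      have hbn : gridTime b ≤ gridTime (b + n * h) := gridTime_mono (Nat.le_add_right _ _)
      refine intervalIntegral.integral_add_adjacent_intervals ?_ ?_
      · exact (hf.mono hsub).intervalIntegrable_of_Icc hab
      · exact (hf.mono fun s hs => (gridTime_pos hb0).trans_le hs.1).intervalIntegrable_of_Icc hbn
    have := ih hb0 hJ hW (hP.add hp) (hN.add hn) hq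
    rw [add_assoc p, add_assoc q, integ _ continuousOn_repelPart,
      integ _ continuousOn_attractPart] at this
    rw [hsum]
    exact this

lemma measurable_radius : Measurable radius := by unfold radius; fun_prop

lemma melInt_eq {α s : ℝ} (hs : 0 ≤ s) :
    melInt α s = s ^ ((2 : ℝ) / 3) * sin (α - s) * distSq α s ^ (-(3 / 2) : ℝ) := by
  rw [melInt, distSq_eq hs]

lemma Fder_eq {α s : ℝ} (hs : 0 ≤ s) :
    Fder α s = s ^ ((2 : ℝ) / 3) * cos (α - s) * distSq α s ^ (-(3 / 2) : ℝ) -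
      3 * kap * s ^ ((4 : ℝ) / 3) * sin (α - s) ^ 2 * distSq α s ^ (-(5 / 2) : ℝ) := by
  rw [Fder, distSq_eq hs]

lemma hasDerivAt_melInt {α s : ℝ} (hα : |α| ≤ 1 / 10) (hs : 0 < s) :
    HasDerivAt (fun x => melInt x s) (Fder α s) α := by
  have hD := distSq_pos hα hs
  have hlin : HasDerivAt (fun x : ℝ => x - s) 1 α := (hasDerivAt_id α).sub_const s
  have hDd : HasDerivAt (fun x => distSq x s) (2 * radius s * sin (α - s)) α := by
    unfold distSq
    exact ((hlin.cos.const_mul (2 * radius s)).const_sub (1 + radius s ^ 2)).congr_deriv (by ring)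
  have h := (hlin.sin.const_mul (s ^ ((2 : ℝ) / 3))).mul
    (hDd.rpow_const (p := (-(3 / 2) : ℝ)) (Or.inl hD.ne'))
  have hs43 : s ^ ((4 : ℝ) / 3) = s ^ ((2 : ℝ) / 3) * s ^ ((2 : ℝ) / 3) := by
    rw [← Real.rpow_add hs]; norm_num
  simp only [melInt_eq hs.le]
  refine h.congr_deriv ?_
  rw [Fder_eq hs.le, hs43, radius, show (-(3 / 2) - 1 : ℝ) = -(5 / 2) by norm_num]
  ring

lemma kernel_bounds {α s : ℝ} (hα : |α| ≤ 1 / 10) (hs : 0 < s) :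
    radius s * distSq α s ^ (-(3 / 2) : ℝ) ≤ 10 ^ 3 * (1 + radius s ^ 2)⁻¹ ∧
    radius s ^ 2 * distSq α s ^ (-(5 / 2) : ℝ) ≤ 10 ^ 5 * (1 + radius s ^ 2)⁻¹ := by
  have hD := distSq_pos hα hs
  have hlow := distSq_lower_bound hα hs
  have hr := radius_pos hs
  have e3 := rpow_distSq hD 3
  have e5 := rpow_distSq hD 5
  push_cast at e3 e5
  rw [e3, e5]
  set y := (√(distSq α s))⁻¹ with hy
  have hy0 : 0 < y := inv_pos.2 (Real.sqrt_pos.2 hD)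
  have hy2 : y ^ 2 * distSq α s = 1 := by
    rw [hy, inv_pow, Real.sq_sqrt hD.le, inv_mul_cancel₀ hD.ne']
  set r := radius s
  have hE : 0 < 1 + r ^ 2 := by positivity
  have key : y ^ 2 ≤ 100 * (1 + r ^ 2)⁻¹ := by
    rw [← div_eq_mul_inv, le_div_iff₀ hE]
    nlinarith [sq_nonneg y]
  have key' : y ^ 2 * (1 + r ^ 2) ≤ 100 := by
    nlinarith [sq_nonneg y]
  have hy10 : y ≤ 10 := by nlinarith [sq_nonneg (y * r)]
  have hry : r * y ≤ 10 := by
    apply le_of_sq_le_sq _ (by norm_num)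
    nlinarith [sq_nonneg y]
  have hry0 : 0 < r * y := by positivity
  constructor
  · calc r * y ^ 3 = (r * y) * y ^ 2 := by ring
      _ ≤ 10 * (100 * (1 + r ^ 2)⁻¹) := by gcongr
      _ = _ := by ring
  · calc r ^ 2 * y ^ 5 = (r * y) * (r * y) * y * y ^ 2 := by ring
      _ ≤ 10 * 10 * 10 * (100 * (1 + r ^ 2)⁻¹) := by gcongr
      _ = _ := by ring

lemma abs_melInt_le {s : ℝ} (hs : 0 < s) :
    |melInt 0 s| ≤ 10 ^ 3 / kap * (1 + radius s ^ 2)⁻¹ := by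
  have hk := kap_pos
  have hα : |(0 : ℝ)| ≤ 1 / 10 := by norm_num
  have h := (kernel_bounds hα hs).1
  have hD := Real.rpow_nonneg (distSq_pos hα hs).le (-(3 / 2))
  have hsr : s ^ ((2 : ℝ) / 3) = radius s / kap := by rw [radius]; field_simp
  have hr := radius_pos hs
  rw [melInt_eq hs.le, abs_mul, abs_mul, abs_of_nonneg hD, hsr, abs_of_pos (by positivity)]
  calc radius s / kap * |sin (0 - s)| * distSq 0 s ^ (-(3 / 2) : ℝ)
      ≤ radius s / kap * 1 * distSq 0 s ^ (-(3 / 2) : ℝ) := by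
        gcongr; exact abs_sin_le_one _
    _ = (radius s * distSq 0 s ^ (-(3 / 2) : ℝ)) / kap := by ring
    _ ≤ (10 ^ 3 * (1 + radius s ^ 2)⁻¹) / kap := by gcongr
    _ = _ := by ring

lemma abs_Fder_le {α s : ℝ} (hα : |α| ≤ 1 / 10) (hs : 0 < s) :
    |Fder α s| ≤ 10 ^ 6 / kap * (1 + radius s ^ 2)⁻¹ := by
  have hk := kap_pos
  obtain ⟨h3, h5⟩ := kernel_bounds hα hs
  have hD3 := Real.rpow_nonneg (distSq_pos hα hs).le (-(3 / 2))
  have hD5 := Real.rpow_nonneg (distSq_pos hα hs).le (-(5 / 2))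
  have hr := radius_pos hs
  have hF : kap * Fder α s = radius s * distSq α s ^ (-(3 / 2) : ℝ) * cos (α - s) -
      3 * (radius s ^ 2 * distSq α s ^ (-(5 / 2) : ℝ)) * sin (α - s) ^ 2 := by
    rw [Fder_eq hs.le, radius_sq hs.le, radius]; ring
  have hE : 0 < (1 + radius s ^ 2)⁻¹ := by positivity
  set A := radius s * distSq α s ^ (-(3 / 2) : ℝ) with hA
  set B := radius s ^ 2 * distSq α s ^ (-(5 / 2) : ℝ) with hB
  have hA0 : 0 ≤ A := by positivity
  have hB0 : 0 ≤ B := by positivity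
  have h : |kap * Fder α s| ≤ 10 ^ 6 * (1 + radius s ^ 2)⁻¹ := by
    rw [hF, abs_le]
    have c1 := neg_one_le_cos (α - s)
    have c2 := cos_le_one (α - s)
    have d1 := sq_nonneg (sin (α - s))
    have d2 := sin_sq_le_one (α - s)
    constructor <;> nlinarith
  rw [abs_mul, abs_of_pos hk] at h
  rw [div_mul_eq_mul_div, le_div_iff₀ hk]
  linarith

lemma integrableOn_inv_one_add_radius_sq :
    IntegrableOn (fun s => (1 + radius s ^ 2)⁻¹) (Set.Ioi 0) := by
  have hm : Measurable fun s => (1 + radius s ^ 2)⁻¹ := by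
    have := measurable_radius
    fun_prop
  rw [← Set.Ioc_union_Ioi_eq_Ioi zero_le_one]
  refine IntegrableOn.union ?_ ?_
  · refine Integrable.mono' (g := fun _ => (1 : ℝ)) (by simp) hm.aestronglyMeasurable ?_
    refine ae_of_all _ fun s => ?_
    rw [Real.norm_of_nonneg (by positivity)]
    exact inv_le_one_of_one_le₀ (by nlinarith [sq_nonneg (radius s)])
  · have hg : IntegrableOn (fun s : ℝ => (kap ^ 2)⁻¹ * s ^ (-(4 / 3) : ℝ)) (Set.Ioi 1) :=
      (integrableOn_Ioi_rpow_of_lt (by norm_num) one_pos).const_mul _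
    refine Integrable.mono' hg hm.aestronglyMeasurable ?_
    refine (ae_restrict_mem measurableSet_Ioi).mono fun s hs => ?_
    have hs0 : (0 : ℝ) < s := one_pos.trans hs
    rw [Real.norm_of_nonneg (by positivity), Real.rpow_neg hs0.le, ← mul_inv, ← radius_sq hs0.le]
    have := radius_pos hs0
    gcongr
    linarith

lemma measurable_melInt (α : ℝ) : Measurable (melInt α) := by unfold melInt; fun_prop

lemma measurable_Fder (α : ℝ) : Measurable (Fder α) := by unfold Fder; fun_prop

lemma hasDerivAt_integral_melInt : IntegrableOn (Fder 0) (Set.Ioi 0) ∧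
    HasDerivAt (fun α => ∫ s in Set.Ioi (0 : ℝ), melInt α s)
      (∫ s in Set.Ioi (0 : ℝ), Fder 0 s) 0 := by
  have hball : ∀ α ∈ Metric.ball (0 : ℝ) (1 / 10), |α| ≤ 1 / 10 := fun α hα => by
    rw [Metric.mem_ball, dist_zero_right] at hα
    exact hα.le
  refine hasDerivAt_integral_of_dominated_loc_of_deriv_le
    (bound := fun s => 10 ^ 6 / kap * (1 + radius s ^ 2)⁻¹)
    (Metric.ball_mem_nhds (0 : ℝ) (by norm_num : (0 : ℝ) < 1 / 10))
    (Eventually.of_forall fun α => (measurable_melInt α).aestronglyMeasurable) ?_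
    (measurable_Fder 0).aestronglyMeasurable ?_
    (integrableOn_inv_one_add_radius_sq.const_mul _) ?_
  · refine Integrable.mono' (integrableOn_inv_one_add_radius_sq.const_mul (10 ^ 3 / kap))
      (measurable_melInt 0).aestronglyMeasurable ?_
    exact (ae_restrict_mem measurableSet_Ioi).mono fun s hs => abs_melInt_le hs
  · exact (ae_restrict_mem measurableSet_Ioi).mono fun s hs α hα => abs_Fder_le (hball α hα) hs
  · exact (ae_restrict_mem measurableSet_Ioi).mono fun s hs α hα =>
      hasDerivAt_melInt (hball α hα) hs

section Oscillatory

variable {φ ψ : ℝ → ℝ}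

lemma integrableOn_mul_rpow_of_bounded (hφ : Continuous φ) (hlin : ∀ s, 0 ≤ s → |φ s| ≤ s)
    (hbdd : ∀ s, |φ s| ≤ 2) : IntegrableOn (fun s => φ s * s ^ (-(4 / 3) : ℝ)) (Set.Ioi 0) := by
  have hm : Measurable fun s => φ s * s ^ (-(4 / 3) : ℝ) := by
    have := hφ.measurable
    fun_prop
  rw [← Set.Ioc_union_Ioi_eq_Ioi zero_le_one]
  refine IntegrableOn.union ?_ ?_
  · have hg : IntegrableOn (fun s : ℝ => s ^ (-(1 / 3) : ℝ)) (Set.Ioc 0 1) :=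
      (intervalIntegral.intervalIntegrable_rpow' (by norm_num)).1
    refine Integrable.mono' hg hm.aestronglyMeasurable ?_
    refine (ae_restrict_mem measurableSet_Ioc).mono fun s hs => ?_
    rw [Real.norm_eq_abs, abs_mul, abs_of_nonneg (Real.rpow_nonneg hs.1.le _)]
    calc |φ s| * s ^ (-(4 / 3) : ℝ) ≤ s * s ^ (-(4 / 3) : ℝ) :=
          mul_le_mul_of_nonneg_right (hlin s hs.1.le) (Real.rpow_nonneg hs.1.le _)
      _ = s ^ (1 + -(4 / 3) : ℝ) := by rw [Real.rpow_add hs.1, Real.rpow_one]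
      _ = _ := by norm_num
  · have hg : IntegrableOn (fun s : ℝ => 2 * s ^ (-(4 / 3) : ℝ)) (Set.Ioi 1) :=
      (integrableOn_Ioi_rpow_of_lt (by norm_num) one_pos).const_mul _
    refine Integrable.mono' hg hm.aestronglyMeasurable ?_
    refine (ae_restrict_mem measurableSet_Ioi).mono fun s hs => ?_
    have hs0 : (0 : ℝ) < s := one_pos.trans hs
    rw [Real.norm_eq_abs, abs_mul, abs_of_nonneg (Real.rpow_nonneg hs0.le _)]
    exact mul_le_mul_of_nonneg_right (hbdd s) (Real.rpow_nonneg hs0.le _)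

lemma intervalIntegrable_mul_rpow (hψ : Continuous ψ) (T : ℝ) :
    IntervalIntegrable (fun s => ψ s * s ^ (-(1 / 3) : ℝ)) volume 0 T :=
  (intervalIntegral.intervalIntegrable_rpow' (by norm_num)).continuousOn_mul hψ.continuousOn

/-- Integration by parts for the conditionally convergent integrals in `Mplus`. -/
lemma tendsto_integral_mul_rpow (hψ : Continuous ψ) (hd : ∀ s, HasDerivAt φ (ψ s) s)
    (hlin : ∀ s, 0 ≤ s → |φ s| ≤ s) (hbdd : ∀ s, |φ s| ≤ 2) :
    Tendsto (fun T => ∫ s in (0 : ℝ)..T, ψ s * s ^ (-(1 / 3) : ℝ)) atTop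
      (𝓝 (1 / 3 * ∫ s in Set.Ioi (0 : ℝ), φ s * s ^ (-(4 / 3) : ℝ))) := by
  have hφ : Continuous φ := continuous_iff_continuousAt.2 fun s => (hd s).continuousAt
  have hint := integrableOn_mul_rpow_of_bounded hφ hlin hbdd
  have hparts : ∀ T : ℝ, 0 ≤ T → ∫ s in (0 : ℝ)..T, ψ s * s ^ (-(1 / 3) : ℝ) =
      φ T * T ^ (-(1 / 3) : ℝ) + 1 / 3 * ∫ s in (0 : ℝ)..T, φ s * s ^ (-(4 / 3) : ℝ) := by
    intro T hT
    have hi : IntervalIntegrable (fun s => φ s * s ^ (-(4 / 3) : ℝ)) volume 0 T := by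
      rw [intervalIntegrable_iff_integrableOn_Ioc_of_le hT]
      exact hint.mono_set Set.Ioc_subset_Ioi_self
    have hi' := intervalIntegrable_mul_rpow hψ T
    have hcont : ContinuousOn (fun s => φ s * s ^ (-(1 / 3) : ℝ)) (Set.Icc 0 T) := by
      intro s hs
      rcases hs.1.eq_or_lt with rfl | hs0
      · have h0 : φ 0 = 0 := by simpa using hlin 0 le_rfl
        rw [ContinuousWithinAt, h0, zero_mul]
        have hlim : Tendsto (fun s : ℝ => s ^ ((2 : ℝ) / 3)) (𝓝[Set.Icc 0 T] 0) (𝓝 0) := by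
          have := (Real.continuous_rpow_const (q := (2 : ℝ) / 3) (by norm_num)).tendsto 0
          rw [Real.zero_rpow (by norm_num)] at this
          exact this.mono_left nhdsWithin_le_nhds
        refine squeeze_zero_norm' ?_ hlim
        filter_upwards [self_mem_nhdsWithin] with s hs
        rcases hs.1.eq_or_lt with rfl | hs0
        · simp [h0]
        · rw [Real.norm_eq_abs, abs_mul, abs_of_nonneg (Real.rpow_nonneg hs.1 _)]
          calc |φ s| * s ^ (-(1 / 3) : ℝ) ≤ s * s ^ (-(1 / 3) : ℝ) :=
                mul_le_mul_of_nonneg_right (hlin s hs.1) (Real.rpow_nonneg hs.1 _)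
            _ = s ^ (1 + -(1 / 3) : ℝ) := by rw [Real.rpow_add hs0, Real.rpow_one]
            _ = _ := by norm_num
      · exact (hφ.continuousAt.mul
          (Real.continuousAt_rpow_const _ _ (Or.inl hs0.ne'))).continuousWithinAt
    have hftc := intervalIntegral.integral_eq_sub_of_hasDerivAt_of_le hT hcont
      (f' := fun s => ψ s * s ^ (-(1 / 3) : ℝ) - 1 / 3 * (φ s * s ^ (-(4 / 3) : ℝ)))
      (fun s hs => ((hd s).mul (Real.hasDerivAt_rpow_const (p := (-(1 / 3) : ℝ))
        (Or.inl hs.1.ne'))).congr_deriv (by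
          rw [show (-(1 / 3) - 1 : ℝ) = -(4 / 3) by norm_num]; ring))
      (hi'.sub (hi.const_mul _))
    rw [intervalIntegral.integral_sub hi' (hi.const_mul _),
      intervalIntegral.integral_const_mul] at hftc
    simp only [Real.zero_rpow (show (-(1 / 3) : ℝ) ≠ 0 by norm_num), mul_zero, sub_zero] at hftc
    linarith
  have h1 : Tendsto (fun T : ℝ => φ T * T ^ (-(1 / 3) : ℝ)) atTop (𝓝 0) :=
    bdd_le_mul_tendsto_zero' 2 (Eventually.of_forall hbdd) (tendsto_rpow_neg_atTop (by norm_num))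
  have h2 := (intervalIntegral_tendsto_integral_Ioi 0 hint tendsto_id).const_mul (1 / 3)
  have h3 := h1.add h2
  rw [zero_add] at h3
  refine h3.congr' ?_
  filter_upwards [eventually_ge_atTop 0] with T hT
  exact (hparts T hT).symm

end Oscillatory

lemma abs_one_sub_cos_le (s : ℝ) (hs : 0 ≤ s) : |1 - cos s| ≤ s := by
  have := abs_cos_sub_cos_le 0 s
  simpa [abs_of_nonneg hs] using this

lemma abs_one_sub_cos_le_two (s : ℝ) : |1 - cos s| ≤ 2 :=
  abs_le.2 ⟨by linarith [cos_le_one s], by linarith [neg_one_le_cos s]⟩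

/-- The value of the conditionally convergent integral in `Mplus`. -/
lemma limUnder_eq (α : ℝ) :
    limUnder atTop (fun T => ∫ s in (0 : ℝ)..T, cos (α - s) * s ^ (-(1 / 3) : ℝ)) =
      cos α * (1 / 3 * ∫ s in Set.Ioi (0 : ℝ), sin s * s ^ (-(4 / 3) : ℝ)) +
      sin α * (1 / 3 * ∫ s in Set.Ioi (0 : ℝ), (1 - cos s) * s ^ (-(4 / 3) : ℝ)) := by
  apply Tendsto.limUnder_eq
  have hc := tendsto_integral_mul_rpow (φ := sin) (ψ := cos) continuous_cos hasDerivAt_sin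
    (fun s hs => by simpa [abs_of_nonneg hs] using abs_sin_le_abs (x := s))
    (fun s => (abs_sin_le_one s).trans one_le_two)
  have hs := tendsto_integral_mul_rpow (φ := fun s => 1 - cos s) (ψ := sin) continuous_sin
    (fun s => ((hasDerivAt_cos s).const_sub 1).congr_deriv (neg_neg _))
    abs_one_sub_cos_le abs_one_sub_cos_le_two
  refine ((hc.const_mul (cos α)).add (hs.const_mul (sin α))).congr fun T => ?_
  rw [← intervalIntegral.integral_const_mul, ← intervalIntegral.integral_const_mul,
    ← intervalIntegral.integral_add
      ((intervalIntegrable_mul_rpow continuous_cos T).const_mul _)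
      ((intervalIntegrable_mul_rpow continuous_sin T).const_mul _)]
  congr 1
  ext s
  rw [cos_sub]
  ring

lemma inv_radius_sq {s : ℝ} (hs : 0 < s) :
    (radius s * radius s)⁻¹ = 2 * kap / 9 * s ^ (-(4 / 3) : ℝ) := by
  have hk := kap_pos
  rw [← sq, radius_sq hs.le, mul_inv, Real.rpow_neg hs.le]
  congr 1
  refine inv_eq_of_mul_eq_one_right ?_
  linear_combination 2 / 9 * kap_cube

lemma integrableOn_derivInt : IntegrableOn derivInt (Set.Ioi 0) := by
  refine (hasDerivAt_integral_melInt.1.const_mul kap).add ?_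
  have h := (integrableOn_mul_rpow_of_bounded (φ := fun s => 1 - cos s) (by fun_prop)
    abs_one_sub_cos_le abs_one_sub_cos_le_two).const_mul (2 * kap / 9)
  refine IntegrableOn.congr_fun h (fun s hs => ?_) measurableSet_Ioi
  simp only [inv_radius_sq hs]
  ring

lemma hasDerivAt_Mplus : HasDerivAt Mplus (∫ s in Set.Ioi (0 : ℝ), derivInt s) 0 := by
  obtain ⟨hF, hd⟩ := hasDerivAt_integral_melInt
  have hv := integrableOn_mul_rpow_of_bounded (φ := fun s => 1 - cos s) (by fun_prop)
    abs_one_sub_cos_le abs_one_sub_cos_le_two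
  have h := (hd.const_mul kap).add
    ((((hasDerivAt_cos 0).mul_const
        (1 / 3 * ∫ s in Set.Ioi (0 : ℝ), sin s * s ^ (-(4 / 3) : ℝ))).add
      ((hasDerivAt_sin 0).mul_const
        (1 / 3 * ∫ s in Set.Ioi (0 : ℝ), (1 - cos s) * s ^ (-(4 / 3) : ℝ)))).const_mul √(2 / kap))
  have hM : Mplus = fun α => kap * (∫ s in Set.Ioi (0 : ℝ), melInt α s) + √(2 / kap) *
      (cos α * (1 / 3 * ∫ s in Set.Ioi (0 : ℝ), sin s * s ^ (-(4 / 3) : ℝ)) +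
      sin α * (1 / 3 * ∫ s in Set.Ioi (0 : ℝ), (1 - cos s) * s ^ (-(4 / 3) : ℝ))) := by
    ext α
    rw [Mplus, limUnder_eq]
  rw [hM]
  refine h.congr_deriv ?_
  have hsum : ∫ s in Set.Ioi (0 : ℝ), derivInt s = ∫ s in Set.Ioi (0 : ℝ),
      (kap * Fder 0 s + 2 * kap / 9 * ((1 - cos s) * s ^ (-(4 / 3) : ℝ))) := by
    refine setIntegral_congr_fun measurableSet_Ioi fun s hs => ?_
    simp only [derivInt, inv_radius_sq hs]
    ring
  rw [hsum, MeasureTheory.integral_add (hF.const_mul kap) (hv.const_mul _),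
    MeasureTheory.integral_const_mul, MeasureTheory.integral_const_mul, sqrt_two_div_kap,
    sin_zero, cos_zero]
  ring

/-- Certificate that the integral of `derivInt` over `n` grid cells of width `h` starting at
`a` lies between `L` and `U`, in units of `10 ^ (-6)`. -/
def quadCheck (h n a : ℕ) (L U : ℤ) : Bool :=
  match quad h n a (timeFp a) (versFp (timeFp a)) ⟨0, 0⟩ ⟨0, 0⟩ with
  | (P, N, ok) => ok && decide (L * 10 ^ 9 ≤ (P.lo : ℤ) - N.hi) &&
      decide ((P.hi : ℤ) - N.lo ≤ U * 10 ^ 9)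

lemma integral_derivInt_of_quadCheck {h n a b : ℕ} {L U : ℤ} (ha : 0 < a) (ha' : a ≤ 16000)
    (hb : a + n * h = b) (hq : quadCheck h n a L U = true) :
    L / 10 ^ 6 ≤ ∫ s in gridTime a..gridTime b, derivInt s ∧
    ∫ s in gridTime a..gridTime b, derivInt s ≤ U / 10 ^ 6 := by
  have hI : (timeFp a).Contains (gridTime a) := contains_timeFp a
  have h0 : FpInterval.Contains ⟨0, 0⟩ 0 := by constructor <;> simp
  have hc := contains_quad h n ha hI (contains_versFp hI (gridTime_le ha')) h0 h0
  unfold quadCheck at hq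
  set r := quad h n a (timeFp a) (versFp (timeFp a)) ⟨0, 0⟩ ⟨0, 0⟩ with hr
  obtain ⟨P, N, ok⟩ := r
  simp only [Bool.and_eq_true, decide_eq_true_eq] at hq
  obtain ⟨⟨hok, h1⟩, h2⟩ := hq
  obtain ⟨⟨hp1, hp2⟩, ⟨hn1, hn2⟩⟩ := hc hok
  have hab : gridTime a ≤ gridTime b := gridTime_mono (by omega)
  have hsub : Set.Icc (gridTime a) (gridTime b) ⊆ Set.Ioi 0 :=
    fun s hs => (gridTime_pos ha).trans_le hs.1
  have hint : ∫ s in gridTime a..gridTime b, derivInt s =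
      (∫ s in gridTime a..gridTime b, repelPart s) -
        ∫ s in gridTime a..gridTime b, attractPart s := by
    rw [← intervalIntegral.integral_sub
      ((continuousOn_repelPart.mono hsub).intervalIntegrable_of_Icc hab)
      ((continuousOn_attractPart.mono hsub).intervalIntegrable_of_Icc hab)]
    apply intervalIntegral.integral_congr
    intro s hs
    rw [Set.uIcc_of_le hab] at hs
    exact derivInt_eq (hsub hs)
  rw [hb, zero_add] at hp1 hp2 hn1 hn2
  have hS : (fpScale : ℝ) = 10 ^ 15 := by norm_num [fpScale]
  rw [hS] at hp1 hp2 hn1 hn2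
  have h1' : (L : ℝ) * 10 ^ 9 ≤ (P.lo : ℝ) - N.hi := by exact_mod_cast h1
  have h2' : (P.hi : ℝ) - N.lo ≤ U * 10 ^ 9 := by exact_mod_cast h2
  rw [hint]
  constructor
  · rw [div_le_iff₀ (by norm_num)]; linarith
  · rw [le_div_iff₀ (by norm_num)]; linarith

lemma distSq_zero_mem (s : ℝ) (hr : 0 ≤ radius s) :
    (radius s - 1) ^ 2 ≤ distSq 0 s ∧ distSq 0 s ≤ (radius s + 1) ^ 2 := by
  have h1 := cos_le_one (0 - s)
  have h2 := neg_one_le_cos (0 - s)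
  unfold distSq
  constructor <;> nlinarith

/-- On the part of the orbit inside radius `1 / 25` the integrand is negligible. -/
lemma abs_derivInt_le_one {s : ℝ} (hs : 0 < s) (hs' : s ≤ gridTime 800) : |derivInt s| ≤ 1 := by
  have hr := radius_pos hs
  have hr' : radius s ≤ 1 / 25 := by
    have h0 : gridTime 0 ≤ s := by simpa [gridTime] using hs.le
    refine (radius_mem_of_gridTime h0 hs').2.trans ?_
    norm_num
  have hD := (distSq_zero_mem s hr.le).1
  have hy := invDist_pos hs
  have hyD := invDist_sq_mul hs
  have hr3 := radius_cube hs.le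
  have hv : (1 - cos s) * (radius s * radius s)⁻¹ ≤ radius s / 9 := by
    rw [← div_eq_mul_inv, div_le_iff₀ (by positivity)]
    have := one_sub_sq_div_two_le_cos (x := s)
    linarith
  have hv' : 0 ≤ (1 - cos s) * (radius s * radius s)⁻¹ :=
    mul_nonneg (by linarith [cos_le_one s]) (by positivity)
  rw [derivInt, kap_mul_Fder hs]
  set r := radius s
  set y := invDist s
  have hy' : y ≤ 25 / 24 := by
    by_contra! h
    have h1 : (24 / 25 : ℝ) ^ 2 ≤ distSq 0 s := by nlinarith
    have h2 : (25 / 24 : ℝ) ^ 2 < y ^ 2 := by gcongr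
    nlinarith
  have h3 : r * y ^ 3 ≤ 1 / 4 := by
    calc r * y ^ 3 ≤ 1 / 25 * (25 / 24) ^ 3 := by gcongr
      _ ≤ _ := by norm_num
  have h5 : r ^ 2 * y ^ 5 ≤ 1 / 12 := by
    calc r ^ 2 * y ^ 5 ≤ (1 / 25) ^ 2 * (25 / 24) ^ 5 := by gcongr
      _ ≤ _ := by norm_num
  have h3' : 0 ≤ r * y ^ 3 := by positivity
  have h5' : 0 ≤ r ^ 2 * y ^ 5 := by positivity
  have c1 := cos_le_one s
  have c2 := neg_one_le_cos s
  have d1 := sq_nonneg (sin s)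
  have d2 := sin_sq_le_one s
  have k1 : |r * y ^ 3 * cos s| ≤ 1 / 4 := by
    rw [abs_le]; constructor <;> nlinarith
  have k2 : |r ^ 2 * y ^ 5 * sin s ^ 2| ≤ 1 / 12 := by
    rw [abs_le]; constructor <;> nlinarith
  rw [abs_le] at k1 k2 ⊢
  constructor <;> linarith [k1.1, k1.2, k2.1, k2.2]

/-- Far out, the integrand is `1 / radius ^ 2` up to a cubic error. -/
lemma derivInt_mem_of_large_radius {s : ℝ} (hs : 0 < s) (hr : 16 ≤ radius s) :
    (radius s * radius s)⁻¹ - 8 * (radius s ^ 3)⁻¹ ≤ derivInt s ∧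
    derivInt s ≤ (radius s * radius s)⁻¹ + 4 * (radius s ^ 3)⁻¹ := by
  have hr0 := radius_pos hs
  obtain ⟨hD1, hD2⟩ := distSq_zero_mem s hr0.le
  have hy := invDist_pos hs
  have hyD := invDist_sq_mul hs
  rw [derivInt, kap_mul_Fder hs]
  set r := radius s
  set y := invDist s
  set w := r⁻¹ with hw
  have hrw : r * w = 1 := mul_inv_cancel₀ hr0.ne'
  have hw0 : 0 < w := inv_pos.2 hr0
  have hw16 : w ≤ 1 / 16 := by
    rw [hw, one_div]; gcongr
  set z := r * y with hz
  have hz0 : 0 < z := by positivity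
  have hyz : y = w * z := by rw [hz]; linear_combination (-y) * hrw
  have up : y * (r - 1) ≤ 1 := by
    apply le_of_sq_le_sq _ zero_le_one
    nlinarith [sq_nonneg y]
  have low : 1 ≤ y * (r + 1) := by
    apply le_of_sq_le_sq _ (by positivity)
    nlinarith [sq_nonneg y]
  have up' : z * (1 - w) ≤ 1 := by
    have : z * (1 - w) = y * (r - 1) := by rw [hz]; linear_combination (-y) * hrw
    linarith
  have low' : 1 ≤ z * (1 + w) := by
    have : z * (1 + w) = y * (r + 1) := by rw [hz]; linear_combination y * hrw
    linarith
  have z1 : z ≤ 1 + 16 / 15 * w := by nlinarith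
  have z2 : 1 - w ≤ z := by nlinarith
  have z3 : z ^ 3 ≤ 1 + 7 / 2 * w := by
    calc z ^ 3 ≤ (1 + 16 / 15 * w) ^ 3 := by gcongr
      _ ≤ _ := by nlinarith [mul_nonneg hw0.le (sub_nonneg.2 hw16), pow_pos hw0 2]
  have z3' : 1 - 7 / 2 * w ≤ z ^ 3 := by
    calc 1 - 7 / 2 * w ≤ (1 - w) ^ 3 := by nlinarith [pow_pos hw0 2]
      _ ≤ z ^ 3 := by gcongr; linarith
  have z5 : z ^ 5 ≤ 7 / 5 := by
    calc z ^ 5 ≤ (1 + 16 / 15 * (1 / 16)) ^ 5 := by gcongr; linarith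
      _ ≤ _ := by norm_num
  have z5' : 0 ≤ z ^ 5 := by positivity
  have e : r * cos s * y ^ 3 - 3 * r ^ 2 * sin s ^ 2 * y ^ 5 + (1 - cos s) * (r * r)⁻¹ =
      w ^ 2 + w ^ 2 * (cos s * (z ^ 3 - 1)) - 3 * (w ^ 3 * (z ^ 5 * sin s ^ 2)) := by
    rw [mul_inv, ← hw, hyz]
    linear_combination (cos s * w ^ 2 * z ^ 3 -
      3 * w ^ 3 * z ^ 5 * sin s ^ 2 * (r * w + 1)) * hrw
  have e2 : (r * r)⁻¹ = w ^ 2 := by rw [mul_inv, ← hw, sq]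
  have e3 : (r ^ 3)⁻¹ = w ^ 3 := by rw [hw, inv_pow]
  rw [e, e2, e3]
  have c1 := cos_le_one s
  have c2 := neg_one_le_cos s
  have k1 : |cos s * (z ^ 3 - 1)| ≤ 7 / 2 * w := by
    rw [abs_mul]
    have a1 : |cos s| ≤ 1 := abs_cos_le_one s
    have a2 : |z ^ 3 - 1| ≤ 7 / 2 * w := abs_le.2 ⟨by linarith, by linarith⟩
    calc |cos s| * |z ^ 3 - 1| ≤ 1 * (7 / 2 * w) := by gcongr
      _ = _ := one_mul _
  have k2 : z ^ 5 * sin s ^ 2 ≤ 7 / 5 := by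
    calc z ^ 5 * sin s ^ 2 ≤ 7 / 5 * 1 := by gcongr; exact sin_sq_le_one s
      _ = _ := mul_one _
  have k2' : 0 ≤ z ^ 5 * sin s ^ 2 := by positivity
  obtain ⟨k3, k4⟩ := abs_le.1 k1
  have w2 : 0 < w ^ 2 := by positivity
  have w3 : 0 < w ^ 3 := by positivity
  have m1 := mul_le_mul_of_nonneg_left k3 w2.le
  have m2 := mul_le_mul_of_nonneg_left k4 w2.le
  have m3 := mul_le_mul_of_nonneg_left k2 w3.le
  have m4 := mul_nonneg w3.le k2'
  constructor <;> nlinarith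

lemma integral_inv_radius_sq {S : ℝ} (hS : 0 < S) :
    IntegrableOn (fun s => (radius s * radius s)⁻¹) (Set.Ioi S) ∧
    ∫ s in Set.Ioi S, (radius s * radius s)⁻¹ = 3 * S * (radius S * radius S)⁻¹ := by
  have heq : Set.EqOn (fun s => (radius s * radius s)⁻¹)
      (fun s => 2 * kap / 9 * s ^ (-(4 / 3) : ℝ)) (Set.Ioi S) :=
    fun s hs => inv_radius_sq (hS.trans hs)
  constructor
  · exact (integrableOn_congr_fun heq measurableSet_Ioi).2
      ((integrableOn_Ioi_rpow_of_lt (by norm_num) hS).const_mul _)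
  · rw [setIntegral_congr_fun measurableSet_Ioi heq, MeasureTheory.integral_const_mul,
      integral_Ioi_rpow_of_lt (by norm_num) hS, inv_radius_sq hS, Real.rpow_add hS, Real.rpow_one]
    ring

lemma integral_inv_radius_cube {S : ℝ} (hS : 0 < S) :
    IntegrableOn (fun s => (radius s ^ 3)⁻¹) (Set.Ioi S) ∧
    ∫ s in Set.Ioi S, (radius s ^ 3)⁻¹ = 2 / 9 * S⁻¹ := by
  have heq : Set.EqOn (fun s => (radius s ^ 3)⁻¹)
      (fun s => 2 / 9 * s ^ (-2 : ℝ)) (Set.Ioi S) := fun s hs => by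
    have hs0 : (0 : ℝ) < s := hS.trans hs
    simp only [radius_cube hs0.le, Real.rpow_neg hs0.le, Real.rpow_two, mul_inv, inv_div]
  constructor
  · exact (integrableOn_congr_fun heq measurableSet_Ioi).2
      ((integrableOn_Ioi_rpow_of_lt (by norm_num) hS).const_mul _)
  · rw [setIntegral_congr_fun measurableSet_Ioi heq, MeasureTheory.integral_const_mul,
      integral_Ioi_rpow_of_lt (by norm_num) hS, show (-2 + 1 : ℝ) = -1 by norm_num,
      Real.rpow_neg_one]
    ring

lemma radius_gridTime (a : ℕ) : radius (gridTime a) = ((a : ℝ) / 4000) ^ 2 :=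
  le_antisymm (radius_mem_of_gridTime le_rfl le_rfl).2 (radius_mem_of_gridTime le_rfl le_rfl).1

lemma sqrt_two_mem : 1.41421 ≤ √2 ∧ √2 ≤ 1.41422 :=
  ⟨Real.le_sqrt_of_sq_le (by norm_num), Real.sqrt_le_iff.2 (by norm_num)⟩

lemma abs_integral_derivInt_near :
    |∫ s in (0 : ℝ)..gridTime 800, derivInt s| ≤ 0.0038 := by
  have h0 : 0 ≤ gridTime 800 := (gridTime_pos (by norm_num)).le
  have h := intervalIntegral.norm_integral_le_of_norm_le_const (a := 0) (b := gridTime 800)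
    (f := derivInt) (C := 1) fun s hs => by
      rw [Set.uIoc_of_le h0] at hs
      exact abs_derivInt_le_one hs.1 hs.2
  rw [sub_zero, one_mul, abs_of_nonneg h0, Real.norm_eq_abs] at h
  refine h.trans ?_
  have := sqrt_two_mem.2
  unfold gridTime
  norm_num
  linarith

lemma integral_derivInt_tail : 0.294 ≤ ∫ s in Set.Ioi (gridTime 16000), derivInt s ∧
    ∫ s in Set.Ioi (gridTime 16000), derivInt s ≤ 0.384 := by
  have hS : 0 < gridTime 16000 := gridTime_pos (by norm_num)
  have hsub : Set.Ioi (gridTime 16000) ⊆ Set.Ioi 0 := Set.Ioi_subset_Ioi hS.le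
  have hi := integrableOn_derivInt.mono_set hsub
  obtain ⟨i2, v2⟩ := integral_inv_radius_sq hS
  obtain ⟨i3, v3⟩ := integral_inv_radius_cube hS
  have hr : ∀ s ∈ Set.Ioi (gridTime 16000), 16 ≤ radius s := fun s hs => by
    have hs' : gridTime 16000 < s := hs
    have hs0 : 0 < s := hS.trans hs'
    rw [← pow_le_pow_iff_left₀ (by norm_num) (radius_pos hs0).le three_ne_zero,
      radius_cube hs0.le]
    have := gridTime_sq 16000
    norm_num at this ⊢
    nlinarith
  have hrS : radius (gridTime 16000) = 16 := by rw [radius_gridTime]; norm_num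
  rw [hrS] at v2
  have l := setIntegral_mono_on (i2.sub (i3.const_mul 8)) hi measurableSet_Ioi fun s hs =>
    (derivInt_mem_of_large_radius (hsub hs) (hr s hs)).1
  have u := setIntegral_mono_on hi (i2.add (i3.const_mul 4)) measurableSet_Ioi fun s hs =>
    (derivInt_mem_of_large_radius (hsub hs) (hr s hs)).2
  simp only [Pi.add_apply, Pi.sub_apply] at l u
  rw [MeasureTheory.integral_sub i2 (i3.const_mul 8), MeasureTheory.integral_const_mul, v2, v3] at l
  rw [MeasureTheory.integral_add i2 (i3.const_mul 4), MeasureTheory.integral_const_mul, v2, v3] at u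
  obtain ⟨q1, q2⟩ := sqrt_two_mem
  have g1 : 30 ≤ gridTime 16000 := by unfold gridTime; norm_num; linarith
  have g2 : 3 * gridTime 16000 * (16 * 16)⁻¹ = √2 / 4 := by unfold gridTime; norm_num; ring
  have g3 : (gridTime 16000)⁻¹ ≤ 30⁻¹ := by gcongr
  rw [g2] at l u
  norm_num at g3
  constructor <;> linarith

section Certificates

set_option maxRecDepth 100000

lemma quadCheck_800 : quadCheck 40 30 800 16376 17926 = true := by decide +kernel

lemma quadCheck_2000 : quadCheck 10 80 2000 164622 170053 = true := by decide +kernel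

lemma quadCheck_2800 : quadCheck 4 100 2800 281881 295314 = true := by decide +kernel

lemma quadCheck_3200 : quadCheck 2 200 3200 (-693325) (-638325) = true := by decide +kernel

lemma quadCheck_3600 : quadCheck 2 200 3600 (-3097214) (-2994644) = true := by decide +kernel

lemma quadCheck_4000 : quadCheck 2 200 4000 (-1727070) (-1680084) = true := by decide +kernel

lemma quadCheck_4400 : quadCheck 4 100 4400 (-590224) (-557142) = true := by decide +kernel

lemma quadCheck_4800 : quadCheck 4 100 4800 (-213223) (-200588) = true := by decide +kernel

lemma quadCheck_5200 : quadCheck 10 80 5200 (-93083) (-70852) = true := by decide +kernel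

lemma quadCheck_6000 : quadCheck 25 160 6000 346317 422770 = true := by decide +kernel

lemma quadCheck_10000 : quadCheck 25 160 10000 131638 179640 = true := by decide +kernel

lemma quadCheck_14000 : quadCheck 25 80 14000 40450 58884 = true := by decide +kernel

end Certificates

lemma integral_derivInt_middle :
    -5.433 ≤ ∫ s in gridTime 800..gridTime 16000, derivInt s ∧
    ∫ s in gridTime 800..gridTime 16000, derivInt s ≤ -4.997 := by
  have hi : ∀ a b : ℕ, IntervalIntegrable derivInt volume (gridTime a) (gridTime b) := by
    have h : ∀ a : ℕ, IntervalIntegrable derivInt volume 0 (gridTime a) := fun a => by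
      have h0 : 0 ≤ gridTime a := by unfold gridTime; positivity
      rw [intervalIntegrable_iff_integrableOn_Ioc_of_le h0]
      exact integrableOn_derivInt.mono_set Set.Ioc_subset_Ioi_self
    exact fun a b => (h a).symm.trans (h b)
  have join : ∀ {a b c : ℕ} {l u l' u' : ℝ},
      l ≤ ∫ s in gridTime a..gridTime b, derivInt s ∧
        ∫ s in gridTime a..gridTime b, derivInt s ≤ u →
      l' ≤ ∫ s in gridTime b..gridTime c, derivInt s ∧
        ∫ s in gridTime b..gridTime c, derivInt s ≤ u' →
      l + l' ≤ ∫ s in gridTime a..gridTime c, derivInt s ∧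
        ∫ s in gridTime a..gridTime c, derivInt s ≤ u + u' := by
    intro a b c l u l' u' h h'
    rw [← intervalIntegral.integral_add_adjacent_intervals (hi a b) (hi b c)]
    exact ⟨add_le_add h.1 h'.1, add_le_add h.2 h'.2⟩
  have piece : ∀ {h n a : ℕ} (b : ℕ) {L U : ℤ}, quadCheck h n a L U = true → 0 < a →
      a ≤ 16000 → a + n * h = b → L / 10 ^ 6 ≤ ∫ s in gridTime a..gridTime b, derivInt s ∧
        ∫ s in gridTime a..gridTime b, derivInt s ≤ U / 10 ^ 6 :=
    fun _ _ _ hq ha ha' hb => integral_derivInt_of_quadCheck ha ha' hb hq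
  have h := piece 2000 quadCheck_800 (by norm_num) (by norm_num) (by norm_num)
  replace h := join h (piece 2800 quadCheck_2000 (by norm_num) (by norm_num) (by norm_num))
  replace h := join h (piece 3200 quadCheck_2800 (by norm_num) (by norm_num) (by norm_num))
  replace h := join h (piece 3600 quadCheck_3200 (by norm_num) (by norm_num) (by norm_num))
  replace h := join h (piece 4000 quadCheck_3600 (by norm_num) (by norm_num) (by norm_num))
  replace h := join h (piece 4400 quadCheck_4000 (by norm_num) (by norm_num) (by norm_num))
  replace h := join h (piece 4800 quadCheck_4400 (by norm_num) (by norm_num) (by norm_num))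
  replace h := join h (piece 5200 quadCheck_4800 (by norm_num) (by norm_num) (by norm_num))
  replace h := join h (piece 6000 quadCheck_5200 (by norm_num) (by norm_num) (by norm_num))
  replace h := join h (piece 10000 quadCheck_6000 (by norm_num) (by norm_num) (by norm_num))
  replace h := join h (piece 14000 quadCheck_10000 (by norm_num) (by norm_num) (by norm_num))
  replace h := join h (piece 16000 quadCheck_14000 (by norm_num) (by norm_num) (by norm_num))
  obtain ⟨l, u⟩ := h
  norm_num at l u
  constructor <;> linarith

/-- Computer-assisted bound: `M₊'(0) ∈ [-5.15341, -4.56572]`; in particular `M₊'(0) < 0`. -/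
theorem Mplus_deriv_at_zero :
    deriv Mplus 0 ∈ Set.Icc (-5.15341 : ℝ) (-4.56572) ∧ deriv Mplus 0 < 0 := by
  have h1 : 0 ≤ gridTime 800 := (gridTime_pos (by norm_num)).le
  have h2 : 0 ≤ gridTime 16000 := (gridTime_pos (by norm_num)).le
  have hi : ∀ {x y : ℝ}, 0 ≤ x → x ≤ y → IntervalIntegrable derivInt volume x y :=
    fun hx hxy => (intervalIntegrable_iff_integrableOn_Ioc_of_le hxy).2
      (integrableOn_derivInt.mono_set fun s hs => hx.trans_lt hs.1)
  have hsplit := intervalIntegral.integral_interval_add_Ioi integrableOn_derivInt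
    (integrableOn_derivInt.mono_set (Set.Ioi_subset_Ioi h2))
  rw [← intervalIntegral.integral_add_adjacent_intervals (hi le_rfl h1)
    (hi h1 (gridTime_mono (by norm_num : 800 ≤ 16000)))] at hsplit
  rw [hasDerivAt_Mplus.deriv, ← hsplit]
  obtain ⟨n1, n2⟩ := abs_le.1 abs_integral_derivInt_near
  obtain ⟨m1, m2⟩ := integral_derivInt_middle
  obtain ⟨t1, t2⟩ := integral_derivInt_tail
  refine ⟨⟨?_, ?_⟩, ?_⟩ <;> linarith
end

section
/- Let κ = 3^{2/3}/2^{1/3} and let M₊ be the Melnikov function. Then M₊'(θ) ≠ 0 for every θ in the set B₊ = [−1.72851, −0.583065] ∪ [−0.407155, 0.0578054] ∪ [0.921743, 4.15633]. -/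
open Real Filter MeasureTheory intervalIntegral
open scoped Topology

/-- The set `B₊` of angles on which the derivative of the Melnikov function is
(computer-assistedly) shown not to vanish. -/
def Bplus : Set ℝ :=
  Set.Icc (-1.72851 : ℝ) (-0.583065) ∪ Set.Icc (-0.407155 : ℝ) 0.0578054 ∪
    Set.Icc (0.921743 : ℝ) 4.15633

namespace Melnikov

/-- The radial parabolic orbit `r(s) = κ s^{2/3}`. -/
noncomputable def rad (s : ℝ) : ℝ := kap * s ^ ((2 : ℝ) / 3)

/-- The derivative of `rad`. -/
noncomputable def radDeriv (s : ℝ) : ℝ := kap * ((2 / 3) * s ^ (-(1 / 3) : ℝ))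

/-- The distance from the point `r` of the real axis to `e^{iφ}`. -/
noncomputable def dst (r φ : ℝ) : ℝ := √(1 + r ^ 2 - 2 * r * cos φ)

/-- Minus the angular derivative of `1 / dst`. -/
noncomputable def angForce (r φ : ℝ) : ℝ := r * sin φ / dst r φ ^ 3

/-- Minus the radial derivative of `1 / dst`. -/
noncomputable def radForce (r φ : ℝ) : ℝ := (r - cos φ) / dst r φ ^ 3

/-- The mixed second derivative of `1 / dst`, up to sign. -/
noncomputable def mixed (r φ : ℝ) : ℝ :=
  sin φ * (1 + r * cos φ - 2 * r ^ 2) / dst r φ ^ 5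

lemma kap_pos : 0 < kap := by unfold kap; positivity

lemma kap_cube : kap ^ 3 = 9 / 2 := by
  unfold kap
  rw [div_pow, ← rpow_natCast, ← rpow_natCast, ← rpow_mul (by norm_num), ← rpow_mul (by norm_num)]
  norm_num

lemma rad_zero : rad 0 = 0 := by
  unfold rad
  rw [zero_rpow (by norm_num), mul_zero]

lemma rad_nonneg {s : ℝ} (hs : 0 ≤ s) : 0 ≤ rad s :=
  mul_nonneg kap_pos.le (rpow_nonneg hs _)

lemma rad_pos {s : ℝ} (hs : 0 < s) : 0 < rad s :=
  mul_pos kap_pos (rpow_pos_of_pos hs _)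

lemma rad_cube {s : ℝ} (hs : 0 ≤ s) : rad s ^ 3 = 9 / 2 * s ^ 2 := by
  unfold rad
  rw [mul_pow, kap_cube, ← rpow_natCast (s ^ _), ← rpow_mul hs]
  norm_num

lemma rad_mono {s t : ℝ} (hs : 0 ≤ s) (hst : s ≤ t) : rad s ≤ rad t :=
  mul_le_mul_of_nonneg_left (rpow_le_rpow hs hst (by norm_num)) kap_pos.le

lemma continuous_rad : Continuous rad :=
  continuous_const.mul (continuous_id.rpow_const fun _ => Or.inr (by norm_num))

lemma tendsto_rad : Tendsto rad atTop atTop :=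
  (tendsto_rpow_atTop (by norm_num)).const_mul_atTop kap_pos

lemma radDeriv_nonneg {s : ℝ} (hs : 0 ≤ s) : 0 ≤ radDeriv s :=
  mul_nonneg kap_pos.le (mul_nonneg (by norm_num) (rpow_nonneg hs _))

lemma hasDerivAt_rad {s : ℝ} (hs : 0 < s) : HasDerivAt rad (radDeriv s) s := by
  refine ((hasDerivAt_rpow_const (x := s) (p := (2 : ℝ) / 3) (Or.inl hs.ne')).const_mul
    kap).congr_deriv ?_
  unfold radDeriv
  norm_num

lemma continuousOn_radDeriv : ContinuousOn radDeriv (Set.Ioi 0) := by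
  intro s hs
  have hs : s ≠ 0 := ne_of_gt hs
  unfold radDeriv
  exact (continuousAt_const.mul (continuousAt_const.mul
    (continuousAt_id.rpow_const (Or.inl hs)))).continuousWithinAt

lemma sq_add_sin_sq (r φ : ℝ) :
    1 + r ^ 2 - 2 * r * cos φ = (r - cos φ) ^ 2 + sin φ ^ 2 := by
  have := sin_sq_add_cos_sq φ
  linear_combination -this

lemma dst_sq (r φ : ℝ) : dst r φ ^ 2 = 1 + r ^ 2 - 2 * r * cos φ := by
  unfold dst
  rw [sq_sqrt]
  rw [sq_add_sin_sq]
  positivity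

lemma dst_nonneg (r φ : ℝ) : 0 ≤ dst r φ := sqrt_nonneg _

lemma abs_sub_cos_le_dst (r φ : ℝ) : |r - cos φ| ≤ dst r φ := by
  refine abs_le_of_sq_le_sq ?_ (dst_nonneg _ _)
  rw [dst_sq, sq_add_sin_sq]
  nlinarith [sq_nonneg (sin φ)]

lemma abs_sin_le_dst (r φ : ℝ) : |sin φ| ≤ dst r φ := by
  refine abs_le_of_sq_le_sq ?_ (dst_nonneg _ _)
  rw [dst_sq, sq_add_sin_sq]
  nlinarith [sq_nonneg (r - cos φ)]

lemma abs_mul_sin_le_dst (r φ : ℝ) : |r * sin φ| ≤ dst r φ := by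
  refine abs_le_of_sq_le_sq ?_ (dst_nonneg _ _)
  rw [dst_sq]
  have := sin_sq_add_cos_sq φ
  nlinarith [sq_nonneg (r * cos φ - 1)]

lemma abs_sub_one_le_dst {r : ℝ} (hr : 0 ≤ r) (φ : ℝ) : |r - 1| ≤ dst r φ := by
  refine abs_le_of_sq_le_sq ?_ (dst_nonneg _ _)
  rw [dst_sq]
  nlinarith [cos_le_one φ]

lemma dst_eq_norm (r φ : ℝ) : dst r φ = ‖(r : ℂ) - Complex.exp (Complex.I * φ)‖ := by
  rw [Complex.norm_def, dst]
  congr 1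
  rw [mul_comm Complex.I, Complex.normSq_apply, Complex.sub_re, Complex.sub_im,
    Complex.exp_ofReal_mul_I_re, Complex.exp_ofReal_mul_I_im, Complex.ofReal_re, Complex.ofReal_im]
  have := sin_sq_add_cos_sq φ
  linear_combination -this

lemma norm_exp_sub_exp_le (φ ψ : ℝ) :
    ‖Complex.exp (Complex.I * φ) - Complex.exp (Complex.I * ψ)‖ ≤ |φ - ψ| := by
  have h : Complex.exp (Complex.I * φ) - Complex.exp (Complex.I * ψ) =
      Complex.exp (Complex.I * ψ) * (Complex.exp (Complex.I * ((φ - ψ : ℝ) : ℂ)) - 1) := by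
    rw [mul_sub, ← Complex.exp_add]
    push_cast
    ring_nf
  rw [h, norm_mul, mul_comm Complex.I (ψ : ℂ), Complex.norm_exp_ofReal_mul_I, one_mul]
  exact Real.norm_exp_I_mul_ofReal_sub_one_le

lemma abs_dst_sub_dst_le (r r' φ φ' : ℝ) :
    |dst r φ - dst r' φ'| ≤ |r - r'| + |φ - φ'| := by
  rw [dst_eq_norm, dst_eq_norm]
  refine (abs_norm_sub_norm_le _ _).trans ?_
  have h : (r : ℂ) - Complex.exp (Complex.I * φ) - ((r' : ℂ) - Complex.exp (Complex.I * φ')) =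
    ((r - r' : ℝ) : ℂ) - (Complex.exp (Complex.I * φ) - Complex.exp (Complex.I * φ')) := by
    push_cast; ring
  rw [h]
  refine (norm_sub_le _ _).trans (add_le_add ?_ (norm_exp_sub_exp_le _ _))
  rw [Complex.norm_real, Real.norm_eq_abs]

lemma continuous_dst : Continuous fun p : ℝ × ℝ => dst p.1 p.2 := by
  unfold dst
  fun_prop

lemma hasDerivAt_dst {r φ : ℝ → ℝ} {r' φ' x : ℝ} (hr : HasDerivAt r r' x)
    (hφ : HasDerivAt φ φ' x) (hd : 0 < dst (r x) (φ x)) :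
    HasDerivAt (fun y => dst (r y) (φ y))
      (((r x - cos (φ x)) * r' + r x * sin (φ x) * φ') / dst (r x) (φ x)) x := by
  have hne : 1 + r x ^ 2 - 2 * r x * cos (φ x) ≠ 0 := by
    rw [← dst_sq]; positivity
  have h : HasDerivAt (fun y => 1 + r y ^ 2 - 2 * r y * cos (φ y)) _ x :=
    ((hr.pow 2).const_add 1).sub ((hr.const_mul 2).mul hφ.cos)
  refine (h.sqrt hne).congr_deriv ?_
  unfold dst at hd ⊢
  field_simp
  simp only [Nat.cast_ofNat]
  ring

/-- The set of angles whose orbit stays away from the collision. -/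
def Regular (θ : ℝ) : Prop := ∃ δ > 0, ∀ s, 0 ≤ s → δ ≤ dst (rad s) (θ - s)

lemma Regular.eventually {θ : ℝ} (h : Regular θ) :
    ∃ δ > 0, ∀ θ' ∈ Metric.ball θ δ, ∀ s, 0 ≤ s → δ ≤ dst (rad s) (θ' - s) := by
  obtain ⟨δ, hδ, h⟩ := h
  refine ⟨δ / 2, by positivity, fun θ' hθ' s hs => ?_⟩
  have h1 := abs_dst_sub_dst_le (rad s) (rad s) (θ - s) (θ' - s)
  rw [Metric.mem_ball, Real.dist_eq, abs_sub_comm] at hθ'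
  have h2 := (abs_le.mp h1).2
  simp only [sub_self, abs_zero, sub_sub_sub_cancel_right, zero_add] at h2
  linarith [h s hs]

lemma regular_of_ne {θ : ℝ} (h : cos (θ - √2 / 3) ≠ 1) : Regular θ := by
  have hpos : ∀ s, 0 ≤ s → 0 < dst (rad s) (θ - s) := by
    intro s hs
    refine lt_of_le_of_ne (dst_nonneg _ _) fun h0 => h ?_
    have h1 := dst_sq (rad s) (θ - s)
    have h2 := abs_sub_one_le_dst (rad_nonneg hs) (θ - s)
    rw [← h0] at h1 h2
    have hr : rad s = 1 := by
      have := abs_nonpos_iff.mp h2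
      linarith
    have hs2 := rad_cube hs
    rw [hr] at hs2 h1
    have : s = √2 / 3 := by
      have h2' : √2 ^ 2 = 2 := sq_sqrt (by norm_num)
      have : s ^ 2 = (√2 / 3) ^ 2 := by rw [div_pow, h2']; linarith
      exact (pow_left_inj₀ hs (by positivity) two_ne_zero).mp this
    rw [← this]
    linarith
  obtain ⟨S, hS⟩ := (tendsto_rad.eventually_ge_atTop 2).exists_forall_of_atTop
  have hc : Continuous fun s => dst (rad s) (θ - s) :=
    continuous_dst.comp (continuous_rad.prodMk (continuous_const.sub continuous_id))
  obtain ⟨s₀, hs₀, hmin⟩ := (isCompact_Icc (a := (0 : ℝ)) (b := max S 0)).exists_isMinOn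
    ⟨0, by simp⟩ hc.continuousOn
  refine ⟨min 1 (dst (rad s₀) (θ - s₀)), lt_min one_pos (hpos _ hs₀.1), fun s hs => ?_⟩
  rcases le_total s (max S 0) with h' | h'
  · exact (min_le_right _ _).trans (hmin ⟨hs, h'⟩)
  · refine (min_le_left _ _).trans ?_
    have h3 := abs_sub_one_le_dst (rad_nonneg hs) (θ - s)
    have h4 := hS s ((le_max_left _ _).trans h')
    linarith [le_abs_self (rad s - 1)]

lemma dst_le {r : ℝ} (hr : 0 ≤ r) (φ : ℝ) : dst r φ ≤ 1 + r := by
  refine abs_le_of_sq_le_sq' ?_ (by positivity) |>.2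
  rw [dst_sq]
  nlinarith [neg_one_le_cos φ]

lemma hasDerivAt_inv_dst {θ s : ℝ} (hs : 0 < s) (hd : 0 < dst (rad s) (θ - s)) :
    HasDerivAt (fun s => (dst (rad s) (θ - s))⁻¹)
      (angForce (rad s) (θ - s) - radForce (rad s) (θ - s) * radDeriv s) s := by
  refine ((hasDerivAt_dst (hasDerivAt_rad hs) ((hasDerivAt_id s).const_sub θ) hd).fun_inv
    hd.ne').congr_deriv ?_
  simp only [angForce, radForce, id]
  field_simp
  ring

lemma mixed_identity (r φ : ℝ) : dst r φ ^ 2 - 3 * r * (r - cos φ) = 1 + r * cos φ - 2 * r ^ 2 := by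
  rw [dst_sq]; ring

lemma hasDerivAt_radForce {r φ : ℝ} (hd : 0 < dst r φ) :
    HasDerivAt (fun φ => radForce r φ) (mixed r φ) φ := by
  have h1 := (hasDerivAt_dst (hasDerivAt_const φ r) (hasDerivAt_id φ) hd).fun_pow 3
  have h2 := ((hasDerivAt_cos φ).const_sub r).fun_div h1 (pow_pos hd 3).ne'
  refine h2.congr_deriv ?_
  simp only [mixed, id, ← mixed_identity]
  field_simp
  simp only [Nat.cast_ofNat]
  ring

lemma hasDerivAt_angForce {r φ : ℝ} (hd : 0 < dst r φ) :
    HasDerivAt (fun r => angForce r φ) (mixed r φ) r := by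
  have h1 := (hasDerivAt_dst (hasDerivAt_id r) (hasDerivAt_const r φ) hd).fun_pow 3
  have h2 := ((hasDerivAt_id r).mul_const (sin φ)).fun_div h1 (pow_pos hd 3).ne'
  refine h2.congr_deriv ?_
  simp only [mixed, id, ← mixed_identity]
  field_simp
  simp only [Nat.cast_ofNat]
  ring

lemma abs_angForce_le {r φ : ℝ} (hd : 0 < dst r φ) : |angForce r φ| ≤ 1 / dst r φ ^ 2 := by
  rw [angForce, abs_div, abs_of_pos (pow_pos hd 3), div_le_div_iff₀ (pow_pos hd 3) (pow_pos hd 2)]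
  nlinarith [abs_mul_sin_le_dst r φ, pow_pos hd 2]

lemma abs_radForce_le {r φ : ℝ} (hd : 0 < dst r φ) : |radForce r φ| ≤ 1 / dst r φ ^ 2 := by
  rw [radForce, abs_div, abs_of_pos (pow_pos hd 3), div_le_div_iff₀ (pow_pos hd 3) (pow_pos hd 2)]
  nlinarith [abs_sub_cos_le_dst r φ, pow_pos hd 2]

lemma abs_mixed_factor_le {r : ℝ} (hr : 0 ≤ r) (φ : ℝ) :
    |1 + r * cos φ - 2 * r ^ 2| ≤ (3 * (1 + r) * dst r φ + dst r φ ^ 2) / 2 := by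
  have h : 1 + r * cos φ - 2 * r ^ 2 = (3 * (1 + r) * (1 - r) - dst r φ ^ 2) / 2 := by
    rw [dst_sq]; ring
  rw [h, abs_div, abs_two]
  gcongr
  refine (abs_sub _ _).trans ?_
  rw [abs_mul, abs_of_nonneg (by positivity : 0 ≤ 3 * (1 + r)), abs_of_nonneg (sq_nonneg (dst r φ)),
    abs_sub_comm]
  gcongr
  exact abs_sub_one_le_dst hr φ

lemma abs_mixed_le {r φ : ℝ} (hr : 0 ≤ r) (hd : 0 < dst r φ) :
    |mixed r φ| ≤ 2 * (1 + r) / dst r φ ^ 3 := by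
  have h1 := abs_mixed_factor_le hr φ
  have h2 := abs_sin_le_dst r φ
  have h3 := dst_le hr φ
  have h4 : |1 + r * cos φ - 2 * r ^ 2| ≤ 2 * (1 + r) * dst r φ := by nlinarith
  rw [mixed, abs_div, abs_of_pos (pow_pos hd 5), div_le_div_iff₀ (pow_pos hd 5) (pow_pos hd 3),
    abs_mul]
  have h5 := mul_le_mul h2 h4 (abs_nonneg _) hd.le
  calc _ ≤ dst r φ * (2 * (1 + r) * dst r φ) * dst r φ ^ 3 := by gcongr
    _ = _ := by ring

lemma mul_one_add_le_dst {δ r φ : ℝ} (hδ : 0 < δ) (hr : 0 ≤ r) (h : δ ≤ dst r φ) :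
    δ / (δ + 2) * (1 + r) ≤ dst r φ := by
  have h1 := abs_sub_one_le_dst hr φ
  have h2 := le_abs_self (r - 1)
  rw [div_mul_eq_mul_div, div_le_iff₀ (by positivity)]
  nlinarith

lemma one_div_dst_sq_le {δ r φ : ℝ} (hδ : 0 < δ) (hr : 0 ≤ r) (h : δ ≤ dst r φ) :
    1 / dst r φ ^ 2 ≤ ((δ + 2) / δ) ^ 2 * ((1 + r) ^ 2)⁻¹ := by
  have h1 := mul_one_add_le_dst hδ hr h
  have h2 : 0 < δ / (δ + 2) * (1 + r) := by positivity
  calc 1 / dst r φ ^ 2 ≤ 1 / (δ / (δ + 2) * (1 + r)) ^ 2 := by gcongr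
    _ = _ := by field_simp

lemma mixed_bound {δ r φ : ℝ} (hδ : 0 < δ) (hr : 0 ≤ r) (h : δ ≤ dst r φ) :
    |mixed r φ| ≤ 2 * ((δ + 2) / δ) ^ 3 * ((1 + r) ^ 2)⁻¹ := by
  have h1 := mul_one_add_le_dst hδ hr h
  have h2 : 0 < δ / (δ + 2) * (1 + r) := by positivity
  calc |mixed r φ| ≤ 2 * (1 + r) / dst r φ ^ 3 := abs_mixed_le hr (hδ.trans_le h)
    _ ≤ 2 * (1 + r) / (δ / (δ + 2) * (1 + r)) ^ 3 := by gcongr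
    _ = _ := by field_simp

lemma integrableOn_radDeriv_div :
    IntegrableOn (fun s => ((1 + rad s) ^ 2)⁻¹ * radDeriv s) (Set.Ioi 0) := by
  have hp : ∀ s, 0 ≤ s → 0 < 1 + rad s := fun s hs => by linarith [rad_nonneg hs]
  have hd : ∀ s ∈ Set.Ioi (0 : ℝ), HasDerivAt (fun s => -(1 + rad s)⁻¹)
      (((1 + rad s) ^ 2)⁻¹ * radDeriv s) s := fun s hs => by
    refine (((hasDerivAt_rad hs).const_add 1).fun_inv
      (hp s (le_of_lt hs)).ne').fun_neg.congr_deriv ?_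
    ring
  refine integrableOn_Ioi_deriv_of_nonneg (l := 0) ?_ hd (fun s hs => ?_) ?_
  · exact ((continuousAt_const.add continuous_rad.continuousAt).inv₀
      (hp 0 le_rfl).ne').neg.continuousWithinAt
  · exact mul_nonneg (by positivity) (radDeriv_nonneg (le_of_lt hs))
  · rw [← neg_zero]
    exact (tendsto_inv_atTop_zero.comp (tendsto_atTop_add_const_left _ 1 tendsto_rad)).neg

lemma integrableOn_inv_one_add_rad_sq :
    IntegrableOn (fun s => ((1 + rad s) ^ 2)⁻¹) (Set.Ioi 0) := by
  have hc : ContinuousOn (fun s => ((1 + rad s) ^ 2)⁻¹) (Set.Ici 0) := by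
    refine ((continuous_const.add continuous_rad).pow 2).continuousOn.inv₀ fun s hs => ?_
    have := rad_nonneg hs
    have h : 0 < 1 + rad s := by linarith
    exact (pow_pos h 2).ne'
  rw [← Set.Ioc_union_Ioi_eq_Ioi zero_le_one]
  refine IntegrableOn.union ?_ ?_
  · exact ((hc.mono Set.Icc_subset_Ici_self).integrableOn_Icc).mono_set Set.Ioc_subset_Icc_self
  · have h := (integrableOn_Ioi_rpow_of_lt (a := -(4 / 3 : ℝ)) (by norm_num)
      one_pos).const_mul (kap ^ 2)⁻¹
    refine Integrable.mono' h ((hc.mono ?_).aestronglyMeasurable measurableSet_Ioi) ?_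
    · exact fun s hs => (zero_le_one.trans (le_of_lt hs) : (0 : ℝ) ≤ s)
    · filter_upwards [ae_restrict_mem measurableSet_Ioi] with s hs
      have hs0 : (0 : ℝ) < s := one_pos.trans hs
      have h1 := rad_pos hs0
      have h2 : rad s ^ 2 = kap ^ 2 * s ^ (4 / 3 : ℝ) := by
        rw [rad, mul_pow, ← rpow_natCast (s ^ _), ← rpow_mul hs0.le]
        norm_num
      rw [Real.norm_of_nonneg (by positivity), rpow_neg hs0.le, ← mul_inv, ← h2]
      gcongr
      linarith

lemma kap_mul_melInt {θ s : ℝ} (hs : 0 ≤ s) :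
    kap * melInt θ s = angForce (rad s) (θ - s) := by
  have h2 : rad s ^ 2 = kap ^ 2 * s ^ (4 / 3 : ℝ) := by
    rw [rad, mul_pow, ← rpow_natCast (s ^ _), ← rpow_mul hs]
    norm_num
  have h3 : 1 + kap ^ 2 * s ^ ((4 : ℝ) / 3) - 2 * kap * s ^ ((2 : ℝ) / 3) * cos (θ - s) =
      dst (rad s) (θ - s) ^ 2 := by
    rw [dst_sq, h2, rad]; ring
  have h4 : (dst (rad s) (θ - s) ^ 2) ^ (-(3 / 2) : ℝ) = (dst (rad s) (θ - s) ^ 3)⁻¹ := by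
    rw [← rpow_natCast _ 2, ← rpow_natCast _ 3, ← rpow_mul (dst_nonneg _ _),
      ← rpow_neg (dst_nonneg _ _)]
    norm_num
  rw [melInt, h3, h4, angForce]
  have h5 : rad s = kap * s ^ ((2 : ℝ) / 3) := rfl
  generalize s ^ ((2 : ℝ) / 3) = y at h5 ⊢
  linear_combination -(sin (θ - s) * (dst (rad s) (θ - s) ^ 3)⁻¹) * h5

lemma continuousOn_dst_comp (θ : ℝ) : Continuous fun s => dst (rad s) (θ - s) :=
  continuous_dst.comp (continuous_rad.prodMk (continuous_const.sub continuous_id))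

lemma continuousOn_div_dst_pow {θ δ : ℝ} (hδ : 0 < δ)
    (h : ∀ s, 0 ≤ s → δ ≤ dst (rad s) (θ - s)) {f : ℝ → ℝ} (hf : Continuous f) (n : ℕ) :
    ContinuousOn (fun s => f s / dst (rad s) (θ - s) ^ n) (Set.Ici 0) :=
  hf.continuousOn.div ((continuousOn_dst_comp θ).pow n).continuousOn fun s hs =>
    (pow_pos (hδ.trans_le (h s hs)) n).ne'

lemma integrableOn_angForce {θ δ : ℝ} (hδ : 0 < δ)
    (h : ∀ s, 0 ≤ s → δ ≤ dst (rad s) (θ - s)) :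
    IntegrableOn (fun s => angForce (rad s) (θ - s)) (Set.Ioi 0) := by
  have hr := continuous_rad
  refine Integrable.mono' (integrableOn_inv_one_add_rad_sq.const_mul (((δ + 2) / δ) ^ 2))
    (((continuousOn_div_dst_pow hδ h (f := fun s => rad s * sin (θ - s)) (by fun_prop) 3).mono
      Set.Ioi_subset_Ici_self).aestronglyMeasurable measurableSet_Ioi) ?_
  filter_upwards [ae_restrict_mem measurableSet_Ioi] with s hs
  have hs' := h s (le_of_lt hs)
  exact (abs_angForce_le (hδ.trans_le hs')).trans
    (one_div_dst_sq_le hδ (rad_nonneg (le_of_lt hs)) hs')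

lemma aestronglyMeasurable_radForce {θ δ : ℝ} (hδ : 0 < δ)
    (h : ∀ s, 0 ≤ s → δ ≤ dst (rad s) (θ - s)) :
    AEStronglyMeasurable (fun s => radForce (rad s) (θ - s) * radDeriv s)
      (volume.restrict (Set.Ioi 0)) := by
  have hr := continuous_rad
  exact (((continuousOn_div_dst_pow hδ h (f := fun s => rad s - cos (θ - s)) (by fun_prop) 3).mono
      Set.Ioi_subset_Ici_self).mul continuousOn_radDeriv).aestronglyMeasurable measurableSet_Ioi

lemma continuousOn_mixed {θ δ : ℝ} (hδ : 0 < δ)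
    (h : ∀ s, 0 ≤ s → δ ≤ dst (rad s) (θ - s)) :
    ContinuousOn (fun s => mixed (rad s) (θ - s)) (Set.Ici 0) := by
  have hr := continuous_rad
  exact continuousOn_div_dst_pow hδ h
    (f := fun s => sin (θ - s) * (1 + rad s * cos (θ - s) - 2 * rad s ^ 2)) (by fun_prop) 5

lemma aestronglyMeasurable_mixed {θ δ : ℝ} (hδ : 0 < δ)
    (h : ∀ s, 0 ≤ s → δ ≤ dst (rad s) (θ - s)) :
    AEStronglyMeasurable (fun s => mixed (rad s) (θ - s) * radDeriv s)
      (volume.restrict (Set.Ioi 0)) :=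
  (((continuousOn_mixed hδ h).mono Set.Ioi_subset_Ici_self).mul
    continuousOn_radDeriv).aestronglyMeasurable measurableSet_Ioi

lemma integrableOn_radForce {θ δ : ℝ} (hδ : 0 < δ)
    (h : ∀ s, 0 ≤ s → δ ≤ dst (rad s) (θ - s)) :
    IntegrableOn (fun s => radForce (rad s) (θ - s) * radDeriv s) (Set.Ioi 0) := by
  refine Integrable.mono' (integrableOn_radDeriv_div.const_mul (((δ + 2) / δ) ^ 2))
    (aestronglyMeasurable_radForce hδ h) ?_
  filter_upwards [ae_restrict_mem measurableSet_Ioi] with s hs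
  have hs' := h s (le_of_lt hs)
  rw [norm_mul, Real.norm_of_nonneg (radDeriv_nonneg (le_of_lt hs)), ← mul_assoc]
  exact mul_le_mul_of_nonneg_right ((abs_radForce_le (hδ.trans_le hs')).trans
    (one_div_dst_sq_le hδ (rad_nonneg (le_of_lt hs)) hs')) (radDeriv_nonneg (le_of_lt hs))

lemma norm_mixed_mul_le {θ δ : ℝ} (hδ : 0 < δ)
    (h : ∀ s, 0 ≤ s → δ ≤ dst (rad s) (θ - s)) {s : ℝ} (hs : 0 ≤ s) :
    ‖mixed (rad s) (θ - s) * radDeriv s‖ ≤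
      2 * ((δ + 2) / δ) ^ 3 * (((1 + rad s) ^ 2)⁻¹ * radDeriv s) := by
  rw [norm_mul, Real.norm_of_nonneg (radDeriv_nonneg hs), ← mul_assoc]
  exact mul_le_mul_of_nonneg_right (mixed_bound hδ (rad_nonneg hs) (h s hs)) (radDeriv_nonneg hs)

lemma integrableOn_mixed {θ δ : ℝ} (hδ : 0 < δ)
    (h : ∀ s, 0 ≤ s → δ ≤ dst (rad s) (θ - s)) :
    IntegrableOn (fun s => mixed (rad s) (θ - s) * radDeriv s) (Set.Ioi 0) := by
  refine Integrable.mono' (integrableOn_radDeriv_div.const_mul (2 * ((δ + 2) / δ) ^ 3))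
    (aestronglyMeasurable_mixed hδ h) ?_
  filter_upwards [ae_restrict_mem measurableSet_Ioi] with s hs
  exact norm_mixed_mul_le hδ h (le_of_lt hs)

lemma kap_mul_integral_melInt {θ δ : ℝ} (hδ : 0 < δ)
    (h : ∀ s, 0 ≤ s → δ ≤ dst (rad s) (θ - s)) :
    kap * ∫ s in Set.Ioi 0, melInt θ s =
      -1 + ∫ s in Set.Ioi 0, radForce (rad s) (θ - s) * radDeriv s := by
  have h1 : ∫ s in Set.Ioi 0,
      (angForce (rad s) (θ - s) - radForce (rad s) (θ - s) * radDeriv s) = 0 - 1 := by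
    have h0 : (dst (rad 0) (θ - 0))⁻¹ = 1 := by simp [dst, rad_zero]
    rw [← h0]
    refine integral_Ioi_of_hasDerivAt_of_tendsto (f := fun s => (dst (rad s) (θ - s))⁻¹) ?_
      (fun s hs => hasDerivAt_inv_dst hs (hδ.trans_le (h s (le_of_lt hs))))
      ((integrableOn_angForce hδ h).sub (integrableOn_radForce hδ h)) ?_
    · exact ((continuousOn_dst_comp θ).continuousAt.inv₀
        (hδ.trans_le (h 0 le_rfl)).ne').continuousWithinAt
    · refine tendsto_inv_atTop_zero.comp (tendsto_atTop_mono' _ ?_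
        (tendsto_atTop_add_const_right _ (-1) tendsto_rad))
      filter_upwards [eventually_ge_atTop 0] with s hs
      exact (le_abs_self _).trans (abs_sub_one_le_dst (rad_nonneg hs) _)
  rw [integral_sub (integrableOn_angForce hδ h) (integrableOn_radForce hδ h)] at h1
  rw [← MeasureTheory.integral_const_mul,
    setIntegral_congr_fun measurableSet_Ioi fun s hs => kap_mul_melInt (le_of_lt hs)]
  linarith

lemma hasDerivAt_kap_mul_integral_melInt {θ : ℝ} (hθ : Regular θ) :
    HasDerivAt (fun θ => kap * ∫ s in Set.Ioi 0, melInt θ s)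
      (∫ s in Set.Ioi 0, mixed (rad s) (θ - s) * radDeriv s) θ := by
  obtain ⟨δ, hδ, h⟩ := hθ.eventually
  have hball := Metric.ball_mem_nhds θ hδ
  have h0 := h θ (Metric.mem_ball_self hδ)
  have hD := (hasDerivAt_integral_of_dominated_loc_of_deriv_le (𝕜 := ℝ) (x₀ := θ)
    (μ := volume.restrict (Set.Ioi 0))
    (F := fun θ s => radForce (rad s) (θ - s) * radDeriv s)
    (F' := fun θ s => mixed (rad s) (θ - s) * radDeriv s)
    (bound := fun s => 2 * ((δ + 2) / δ) ^ 3 * (((1 + rad s) ^ 2)⁻¹ * radDeriv s))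
    hball (by filter_upwards [hball] with x hx using aestronglyMeasurable_radForce hδ (h x hx))
    (integrableOn_radForce hδ h0) (aestronglyMeasurable_mixed hδ h0)
    (by
      filter_upwards [ae_restrict_mem measurableSet_Ioi] with s hs x hx
      exact norm_mixed_mul_le hδ (h x hx) (le_of_lt hs))
    (integrableOn_radDeriv_div.const_mul _)
    (by
      filter_upwards [ae_restrict_mem measurableSet_Ioi] with s hs x hx
      have := (hasDerivAt_radForce (hδ.trans_le (h x hx s (le_of_lt hs)))).comp_sub_const x s
      exact this.mul_const _)).2
  refine (hD.const_add (-1)).congr_of_eventuallyEq ?_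
  filter_upwards [hball] with x hx using kap_mul_integral_melInt hδ (h x hx)

noncomputable def oscInt (z : ℂ) (s : ℝ) : ℂ := (s : ℂ) ^ (-(1 / 3) : ℂ) * Complex.exp (-(z * s))

lemma norm_oscInt {z : ℂ} {s : ℝ} (hs : 0 < s) :
    ‖oscInt z s‖ = s ^ (-(1 / 3) : ℝ) * exp (-(z.re * s)) := by
  rw [oscInt, norm_mul, Complex.norm_cpow_eq_rpow_re_of_pos hs, Complex.norm_exp]
  simp

lemma norm_oscInt_le {z : ℂ} (hz : 0 ≤ z.re) {s : ℝ} (hs : 0 < s) :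
    ‖oscInt z s‖ ≤ s ^ (-(1 / 3) : ℝ) := by
  rw [norm_oscInt hs]
  exact mul_le_of_le_one_right (rpow_nonneg hs.le _)
    (exp_le_one_iff.2 (neg_nonpos.2 (mul_nonneg hz hs.le)))

lemma continuousOn_oscInt (z : ℂ) : ContinuousOn (oscInt z) (Set.Ioi 0) := by
  refine ContinuousOn.mul (fun s hs => ?_) (by fun_prop)
  exact (Complex.continuous_ofReal.continuousAt.cpow continuousAt_const
    (Complex.ofReal_mem_slitPlane.2 hs)).continuousWithinAt

lemma integrableOn_oscInt {z : ℂ} (hz : 0 < z.re) : IntegrableOn (oscInt z) (Set.Ioi 0) := by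
  have h := integrableOn_rpow_mul_exp_neg_mul_rpow (p := 1) (s := -(1 / 3)) (by norm_num) one_pos hz
  refine Integrable.mono' h ((continuousOn_oscInt z).aestronglyMeasurable measurableSet_Ioi) ?_
  filter_upwards [ae_restrict_mem measurableSet_Ioi] with s hs
  rw [norm_oscInt hs, rpow_one, neg_mul]

lemma differentiableAt_integral_oscInt {z : ℂ} (hz : 0 < z.re) :
    DifferentiableAt ℂ (fun z => ∫ s in Set.Ioi (0 : ℝ), oscInt z s) z := by
  have hre : ∀ w ∈ Metric.ball z (z.re / 2), z.re / 2 ≤ w.re := by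
    intro w hw
    have := (Complex.abs_re_le_norm (w - z)).trans (mem_ball_iff_norm.1 hw).le
    rw [Complex.sub_re, abs_le] at this
    linarith
  have hb := integrableOn_rpow_mul_exp_neg_mul_rpow (p := 1) (s := 2 / 3) (by norm_num) one_pos
    (half_pos hz)
  refine (hasDerivAt_integral_of_dominated_loc_of_deriv_le (μ := volume.restrict (Set.Ioi (0 : ℝ)))
    (F' := fun w (s : ℝ) => -(s : ℂ) * oscInt w s)
    (Metric.ball_mem_nhds z (half_pos hz))
    (Eventually.of_forall fun w =>
      (continuousOn_oscInt w).aestronglyMeasurable measurableSet_Ioi)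
    (integrableOn_oscInt hz)
    ((Complex.continuous_ofReal.neg.continuousOn.mul
      (continuousOn_oscInt z)).aestronglyMeasurable measurableSet_Ioi) ?_ hb ?_).2.differentiableAt
  · filter_upwards [ae_restrict_mem measurableSet_Ioi] with s hs w hw
    have hs : 0 < s := hs
    have h1 : s ^ (2 / 3 : ℝ) = s * s ^ (-(1 / 3) : ℝ) := by
      rw [← rpow_one_add' hs.le (by norm_num)]; norm_num
    rw [norm_mul, norm_neg, Complex.norm_of_nonneg hs.le, norm_oscInt hs, h1, rpow_one, mul_assoc]
    gcongr
    nlinarith [hre w hw]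
  · refine Eventually.of_forall fun s w _ => ?_
    have h1 : HasDerivAt (fun w : ℂ => Complex.exp (-(w * s)))
        (Complex.exp (-(w * s)) * -(1 * s)) w := (((hasDerivAt_id w).mul_const _).neg).cexp
    refine (h1.const_mul ((s : ℂ) ^ (-(1 / 3) : ℂ))).congr_deriv ?_
    rw [oscInt]
    ring

lemma integral_oscInt {z : ℂ} (hz : 0 < z.re) :
    ∫ s in Set.Ioi (0 : ℝ), oscInt z s = (1 / z) ^ (2 / 3 : ℂ) * Complex.Gamma (2 / 3) := by
  have hopen : IsOpen {z : ℂ | 0 < z.re} := isOpen_lt continuous_const Complex.continuous_re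
  have hf : AnalyticOnNhd ℂ (fun z => ∫ s in Set.Ioi (0 : ℝ), oscInt z s) {z | 0 < z.re} :=
    DifferentiableOn.analyticOnNhd
      (fun w hw => (differentiableAt_integral_oscInt hw).differentiableWithinAt) hopen
  have hg : AnalyticOnNhd ℂ (fun z : ℂ => (1 / z) ^ (2 / 3 : ℂ) * Complex.Gamma (2 / 3))
      {z | 0 < z.re} := by
    refine DifferentiableOn.analyticOnNhd (fun w hw => ?_) hopen
    have hw : 0 < w.re := hw
    have hw0 : w ≠ 0 := by rintro rfl; simp at hw
    refine DifferentiableAt.differentiableWithinAt ?_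
    refine (DifferentiableAt.cpow_const (by fun_prop (disch := exact hw0)) ?_).mul_const _
    rw [one_div]
    refine Or.inl ?_
    rw [Complex.inv_re]
    exact div_pos hw (Complex.normSq_pos.2 hw0)
  refine hf.eqOn_of_preconnected_of_frequently_eq hg
    (convex_halfSpace_re_gt 0).isPreconnected (z₀ := 1) (by simp) ?_ hz
  have ht : Tendsto (fun x : ℝ => (x : ℂ)) (𝓝[>] 1) (𝓝[≠] 1) := by
    refine tendsto_nhdsWithin_of_tendsto_nhds_of_eventually_within _ ?_ ?_
    · exact (Complex.continuous_ofReal.tendsto' 1 1 (by simp)).mono_left nhdsWithin_le_nhds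
    · filter_upwards [self_mem_nhdsWithin] with x hx
      have hx : 1 < x := hx
      simpa using hx.ne'
  refine ht.frequently (Eventually.frequently ?_)
  filter_upwards [self_mem_nhdsWithin] with x hx
  have hx : 1 < x := hx
  rw [← Complex.integral_cpow_mul_exp_neg_mul_Ioi (by norm_num) (one_pos.trans hx)]
  norm_num [oscInt]

lemma intervalIntegrable_oscInt {z : ℂ} (hz : 0 ≤ z.re) {T : ℝ} (hT : 0 ≤ T) :
    IntervalIntegrable (oscInt z) volume 0 T := by
  have h : IntervalIntegrable (fun s : ℝ => s ^ (-(1 / 3) : ℝ)) volume 0 T :=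
    intervalIntegrable_rpow' (by norm_num)
  rw [intervalIntegrable_iff_integrableOn_Ioc_of_le hT] at h ⊢
  refine Integrable.mono' h (((continuousOn_oscInt z).mono
    Set.Ioc_subset_Ioi_self).aestronglyMeasurable measurableSet_Ioc) ?_
  filter_upwards [ae_restrict_mem measurableSet_Ioc] with s hs using norm_oscInt_le hz hs.1

lemma norm_integral_oscInt_tail_le {z : ℂ} (hz : 0 < z.re) {T : ℝ} (hT : 0 < T) :
    ‖∫ s in Set.Ioi T, oscInt z s‖ ≤ 2 * T ^ (-(1 / 3) : ℝ) / ‖z‖ := by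
  have hz0 : z ≠ 0 := by rintro rfl; simp at hz
  have hzn : 0 < ‖z‖ := norm_pos_iff.2 hz0
  set g : ℝ → ℂ := fun s => -(oscInt z s / z) with hg
  set e : ℝ → ℂ := fun s => (1 / 3 / z) * ((s : ℂ) ^ (-(4 / 3) : ℂ) * Complex.exp (-(z * s)))
    with he
  have hder : ∀ s ∈ Set.Ioi T, HasDerivAt g (oscInt z s + e s) s := by
    intro s hs
    have hs0 : 0 < s := hT.trans hs
    have h1 := ((hasDerivAt_id (s : ℂ)).cpow_const (c := (-(1 / 3) : ℂ))
      (Complex.ofReal_mem_slitPlane.2 hs0)).comp_ofReal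
    have h2 : HasDerivAt (fun s : ℝ => Complex.exp (-(z * s)))
        (Complex.exp (-(z * s)) * -(z * 1)) s :=
      ((((hasDerivAt_id (s : ℂ)).const_mul z).neg).cexp).comp_ofReal
    refine (((h1.mul h2).div_const z).neg).congr_deriv ?_
    simp only [oscInt, he, id]
    have h4 : (-(1 / 3) - 1 : ℂ) = -(4 / 3) := by norm_num
    rw [h4]
    field_simp
    ring
  have hne : ∀ᵐ s ∂volume.restrict (Set.Ioi T),
      ‖e s‖ ≤ 1 / 3 / ‖z‖ * s ^ (-(4 / 3) : ℝ) := by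
    filter_upwards [ae_restrict_mem measurableSet_Ioi] with s hs
    have hs0 : 0 < s := hT.trans hs
    rw [he, norm_mul, norm_mul, Complex.norm_cpow_eq_rpow_re_of_pos hs0, Complex.norm_exp]
    simp only [norm_div, norm_one]
    refine mul_le_mul (by simp) ?_ (by positivity) (by positivity)
    simp only [Complex.neg_re, Complex.mul_re, Complex.ofReal_re, Complex.ofReal_im]
    refine (mul_le_of_le_one_right (by positivity) (exp_le_one_iff.2 ?_)).trans_eq (by norm_num)
    nlinarith
  have hib : IntegrableOn (fun s : ℝ => 1 / 3 / ‖z‖ * s ^ (-(4 / 3) : ℝ)) (Set.Ioi T) :=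
    (integrableOn_Ioi_rpow_of_lt (by norm_num) hT).const_mul _
  have hie : IntegrableOn e (Set.Ioi T) := by
    refine Integrable.mono' hib (ContinuousOn.aestronglyMeasurable (fun s hs => ?_)
      measurableSet_Ioi) hne
    have : ContinuousAt (fun s : ℝ => (s : ℂ) ^ (-(4 / 3) : ℂ)) s :=
      Complex.continuous_ofReal.continuousAt.cpow continuousAt_const
        (Complex.ofReal_mem_slitPlane.2 (hT.trans hs))
    exact (continuousAt_const.mul (this.mul (by fun_prop))).continuousWithinAt
  have hio : IntegrableOn (oscInt z) (Set.Ioi T) :=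
    (integrableOn_oscInt hz).mono_set (Set.Ioi_subset_Ioi hT.le)
  have hlim : Tendsto g atTop (𝓝 0) := by
    have h0 : Tendsto (fun s : ℝ => s ^ (-(1 / 3) : ℝ)) atTop (𝓝 0) :=
      tendsto_rpow_neg_atTop (by norm_num)
    have : Tendsto (oscInt z) atTop (𝓝 0) := by
      refine squeeze_zero_norm' ?_ h0
      filter_upwards [eventually_gt_atTop 0] with s hs using norm_oscInt_le hz.le hs
    simpa [hg] using (this.div_const z).neg
  have key := integral_Ioi_of_hasDerivAt_of_tendsto (a := T)
    ((((continuousOn_oscInt z).continuousAt (Ioi_mem_nhds hT)).div_const z).neg.continuousWithinAt)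
    hder (hio.add hie) hlim
  rw [integral_add hio hie] at key
  have h1 : ∫ s in Set.Ioi T, oscInt z s = oscInt z T / z - ∫ s in Set.Ioi T, e s := by
    rw [eq_sub_iff_add_eq, key]; simp
  have h2 : ‖∫ s in Set.Ioi T, e s‖ ≤ T ^ (-(1 / 3) : ℝ) / ‖z‖ := by
    refine (norm_integral_le_of_norm_le hib hne).trans_eq ?_
    rw [MeasureTheory.integral_const_mul, integral_Ioi_rpow_of_lt (by norm_num) hT]
    norm_num
  rw [h1]
  refine (norm_sub_le _ _).trans ?_
  have h3 : ‖oscInt z T / z‖ ≤ T ^ (-(1 / 3) : ℝ) / ‖z‖ := by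
    rw [norm_div]; gcongr; exact norm_oscInt_le hz.le hT
  calc _ ≤ _ := add_le_add h3 h2
    _ = _ := by ring

lemma norm_integral_oscInt_sub_le {z : ℂ} (hz : 0 < z.re) {T : ℝ} (hT : 0 < T) :
    ‖(∫ s in (0 : ℝ)..T, oscInt z s) - (1 / z) ^ (2 / 3 : ℂ) * Complex.Gamma (2 / 3)‖ ≤
      2 * T ^ (-(1 / 3) : ℝ) / ‖z‖ := by
  rw [← integral_oscInt hz, norm_sub_rev, ← integral_interval_add_Ioi (b := T)
    (integrableOn_oscInt hz) ((integrableOn_oscInt hz).mono_set (Set.Ioi_subset_Ioi hT.le)),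
    add_sub_cancel_left]
  exact norm_integral_oscInt_tail_le hz hT

lemma norm_integral_oscInt_I_sub_le {T : ℝ} (hT : 0 < T) :
    ‖(∫ s in (0 : ℝ)..T, oscInt Complex.I s) -
      (1 / Complex.I) ^ (2 / 3 : ℂ) * Complex.Gamma (2 / 3)‖ ≤ 2 * T ^ (-(1 / 3) : ℝ) := by
  have hz : Tendsto (fun ε : ℝ => (ε : ℂ) + Complex.I) (𝓝[>] 0) (𝓝 Complex.I) := by
    have : ContinuousAt (fun ε : ℝ => (ε : ℂ) + Complex.I) 0 := by fun_prop
    simpa [ContinuousAt] using this.tendsto.mono_left nhdsWithin_le_nhds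
  have hl : Tendsto (fun ε : ℝ => (1 / ((ε : ℂ) + Complex.I)) ^ (2 / 3 : ℂ) *
      Complex.Gamma (2 / 3)) (𝓝[>] 0)
      (𝓝 ((1 / Complex.I) ^ (2 / 3 : ℂ) * Complex.Gamma (2 / 3))) := by
    refine Tendsto.mul_const _ (Tendsto.cpow (tendsto_const_nhds.div hz Complex.I_ne_zero)
      tendsto_const_nhds ?_)
    simp [Complex.slitPlane]
  have hi : Tendsto (fun ε : ℝ => ∫ s in (0 : ℝ)..T, oscInt (ε + Complex.I) s) (𝓝[>] 0)
      (𝓝 (∫ s in (0 : ℝ)..T, oscInt Complex.I s)) := by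
    refine intervalIntegral.tendsto_integral_filter_of_dominated_convergence
      (fun s => s ^ (-(1 / 3) : ℝ)) ?_ ?_ (intervalIntegrable_rpow' (by norm_num)) ?_
    · filter_upwards [self_mem_nhdsWithin] with ε hε
      exact ((intervalIntegrable_oscInt (z := ε + Complex.I)
        (by simpa using (le_of_lt hε)) hT.le).def'.aestronglyMeasurable)
    · filter_upwards [self_mem_nhdsWithin] with ε hε
      refine Eventually.of_forall fun s hs => norm_oscInt_le (by simpa using (le_of_lt hε)) ?_
      rw [Set.uIoc_of_le hT.le] at hs
      exact hs.1
    · refine Eventually.of_forall fun s _ => ?_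
      exact tendsto_const_nhds.mul ((Complex.continuous_exp.tendsto _).comp
        ((hz.mul_const _).neg))
  refine le_of_tendsto (hi.sub hl).norm ?_
  filter_upwards [self_mem_nhdsWithin] with ε hε
  have hε : 0 < ε := hε
  refine (norm_integral_oscInt_sub_le (by simpa using hε) hT).trans
    (div_le_self (by positivity) ?_)
  refine le_trans ?_ (Complex.abs_im_le_norm _)
  simp

lemma tendsto_integral_oscInt_I :
    Tendsto (fun T => ∫ s in (0 : ℝ)..T, oscInt Complex.I s) atTop
      (𝓝 ((1 / Complex.I) ^ (2 / 3 : ℂ) * Complex.Gamma (2 / 3))) := by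
  rw [tendsto_iff_norm_sub_tendsto_zero]
  have h0 : Tendsto (fun s : ℝ => 2 * s ^ (-(1 / 3) : ℝ)) atTop (𝓝 0) := by
    simpa using (tendsto_rpow_neg_atTop (y := 1 / 3) (by norm_num)).const_mul 2
  refine squeeze_zero' (Eventually.of_forall fun _ => norm_nonneg _) ?_ h0
  filter_upwards [eventually_gt_atTop 0] with T hT using norm_integral_oscInt_I_sub_le hT

lemma one_div_I_cpow : (1 / Complex.I) ^ (2 / 3 : ℂ) = Complex.exp (-(π / 3) * Complex.I) := by
  rw [one_div, Complex.inv_I, Complex.cpow_def_of_ne_zero (by simp), Complex.log_neg_I]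
  congr 1
  ring

lemma tendsto_integral_cos_mul (α : ℝ) :
    Tendsto (fun T => ∫ s in (0 : ℝ)..T, cos (α - s) * s ^ (-(1 / 3) : ℝ)) atTop
      (𝓝 (cos (α - π / 3) * Gamma (2 / 3))) := by
  have h := (Complex.continuous_re.tendsto _).comp
    (tendsto_integral_oscInt_I.const_mul (Complex.exp (α * Complex.I)))
  have hlim : (Complex.exp (α * Complex.I) * ((1 / Complex.I) ^ (2 / 3 : ℂ) *
      Complex.Gamma (2 / 3))).re = cos (α - π / 3) * Gamma (2 / 3) := by
    rw [one_div_I_cpow, ← mul_assoc, ← Complex.exp_add]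
    have h1 : (α * Complex.I + -(π / 3) * Complex.I : ℂ) = ((α - π / 3 : ℝ) : ℂ) * Complex.I := by
      push_cast; ring
    have h2 : Complex.Gamma (2 / 3) = ((Gamma (2 / 3) : ℝ) : ℂ) := by
      rw [← Complex.Gamma_ofReal]; norm_num
    rw [h1, h2, Complex.re_mul_ofReal, Complex.exp_ofReal_mul_I_re]
  rw [hlim] at h
  refine h.congr' ?_
  filter_upwards [eventually_ge_atTop 0] with T hT
  simp only [Function.comp]
  rw [← intervalIntegral.integral_const_mul]
  have h2 : IntervalIntegrable (fun s => Complex.exp (α * Complex.I) * oscInt Complex.I s)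
      volume 0 T := (intervalIntegrable_oscInt (by simp) hT).const_mul _
  have h3 := Complex.reCLM.intervalIntegral_comp_comm h2
  simp only [Complex.reCLM_apply] at h3
  rw [← h3]
  refine intervalIntegral.integral_congr fun s hs => ?_
  rw [Set.uIcc_of_le hT] at hs
  have h4 : ((s : ℂ) ^ (-(1 / 3) : ℂ)) = ((s ^ (-(1 / 3) : ℝ) : ℝ) : ℂ) := by
    rw [Complex.ofReal_cpow hs.1]; norm_num
  have h5 : Complex.exp (α * Complex.I) * oscInt Complex.I s =
      Complex.exp (((α - s : ℝ) : ℂ) * Complex.I) * ((s ^ (-(1 / 3) : ℝ) : ℝ) : ℂ) := by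
    rw [oscInt, h4, mul_left_comm, ← Complex.exp_add, mul_comm]
    congr 2
    push_cast; ring
  simp only [h5]
  rw [Complex.re_mul_ofReal, Complex.exp_ofReal_mul_I_re]

lemma deriv_Mplus {θ : ℝ} (hθ : Regular θ) :
    deriv Mplus θ = (∫ s in Set.Ioi 0, mixed (rad s) (θ - s) * radDeriv s) -
      √(2 / kap) * Gamma (2 / 3) * sin (θ - π / 3) := by
  have h : Mplus = fun α => kap * (∫ s in Set.Ioi (0 : ℝ), melInt α s) +
      √(2 / kap) * (cos (α - π / 3) * Gamma (2 / 3)) := by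
    funext α
    rw [Mplus, (tendsto_integral_cos_mul α).limUnder_eq]
  have h2 := ((((hasDerivAt_id θ).sub_const (π / 3)).cos).mul_const (Gamma (2 / 3))).const_mul
    √(2 / kap)
  rw [h]
  refine ((hasDerivAt_kap_mul_integral_melInt hθ).add h2).deriv.trans ?_
  simp only [id]
  ring

lemma hasDerivAt_mixed {r φ : ℝ} (hd : 0 < dst r φ) :
    HasDerivAt (fun φ => mixed r φ)
      (cos φ * (1 + r * cos φ - 2 * r ^ 2) / dst r φ ^ 5 - r * sin φ ^ 2 / dst r φ ^ 5 -
        5 * (r * sin φ ^ 2) * (1 + r * cos φ - 2 * r ^ 2) / dst r φ ^ 7) φ := by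
  have h1 := (hasDerivAt_dst (hasDerivAt_const φ r) (hasDerivAt_id φ) hd).fun_pow 5
  have h2 := ((hasDerivAt_sin φ).fun_mul
    ((((hasDerivAt_cos φ).const_mul r).const_add 1).sub_const (2 * r ^ 2))).fun_div h1
      (pow_pos hd 5).ne'
  refine h2.congr_deriv ?_
  simp only [id]
  field_simp
  simp only [Nat.cast_ofNat]
  ring

/-- A bound for the angular derivative of `mixed` in terms of bounds for `|cos φ|`, `|sin φ|`,
`|1 + r * cos φ - 2 * r ^ 2|` and `dst`. -/
noncomputable def slopeBound (r cb sb q d : ℝ) : ℝ :=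
  (cb * q * d ^ 2 + r * sb ^ 2 * (d ^ 2 + 5 * q)) / d ^ 7

lemma abs_deriv_mixed_le {r r₁ φ cb sb q d : ℝ} (hr : 0 ≤ r) (hr₁ : r ≤ r₁) (hd : 0 < d)
    (hdst : d ≤ dst r φ) (hc : |cos φ| ≤ cb) (hs : |sin φ| ≤ sb)
    (hq : |1 + r * cos φ - 2 * r ^ 2| ≤ q) :
    |cos φ * (1 + r * cos φ - 2 * r ^ 2) / dst r φ ^ 5 - r * sin φ ^ 2 / dst r φ ^ 5 -
        5 * (r * sin φ ^ 2) * (1 + r * cos φ - 2 * r ^ 2) / dst r φ ^ 7| ≤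
      slopeBound r₁ cb sb q d := by
  have hd' := hd.trans_le hdst
  have hcb := (abs_nonneg _).trans hc
  have hq0 := (abs_nonneg _).trans hq
  have hs2 : sin φ ^ 2 ≤ sb ^ 2 := sq_le_sq.2 (hs.trans (le_abs_self _))
  have hrs : r * sin φ ^ 2 ≤ r₁ * sb ^ 2 := by gcongr; exact hr.trans hr₁
  have hrs0 : 0 ≤ r * sin φ ^ 2 := by positivity
  have h1 : |cos φ * (1 + r * cos φ - 2 * r ^ 2) / dst r φ ^ 5| ≤ cb * q / d ^ 5 := by
    rw [abs_div, abs_mul, abs_of_pos (pow_pos hd' 5)]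
    gcongr
  have h2 : |r * sin φ ^ 2 / dst r φ ^ 5| ≤ r₁ * sb ^ 2 / d ^ 5 := by
    rw [abs_div, abs_of_nonneg hrs0, abs_of_pos (pow_pos hd' 5)]
    gcongr
    exact hrs0.trans hrs
  have h3 : |5 * (r * sin φ ^ 2) * (1 + r * cos φ - 2 * r ^ 2) / dst r φ ^ 7| ≤
      5 * (r₁ * sb ^ 2) * q / d ^ 7 := by
    rw [abs_div, abs_mul, abs_mul, abs_of_nonneg hrs0, abs_of_pos (pow_pos hd' 7),
      abs_of_pos (by norm_num : (0 : ℝ) < 5)]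
    have := hrs0.trans hrs
    gcongr
  refine (abs_sub _ _).trans ((add_le_add ((abs_sub _ _).trans (add_le_add h1 h2)) h3).trans_eq ?_)
  rw [slopeBound]
  field_simp
  ring

lemma abs_mixed_sub_mixed_le {r r₁ φ ψ w cb sb q d : ℝ} (hr : 0 ≤ r) (hr₁ : r ≤ r₁) (hd : 0 < d)
    (hφ : |φ - ψ| ≤ w)
    (h : ∀ x, |x - ψ| ≤ w → d ≤ dst r x ∧ |cos x| ≤ cb ∧ |sin x| ≤ sb ∧
      |1 + r * cos x - 2 * r ^ 2| ≤ q) :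
    |mixed r φ - mixed r ψ| ≤ slopeBound r₁ cb sb q d * w := by
  have hw := (abs_nonneg _).trans hφ
  have hB := abs_deriv_mixed_le hr hr₁ hd (h ψ (by simpa)).1 (h ψ (by simpa)).2.1
    (h ψ (by simpa)).2.2.1 (h ψ (by simpa)).2.2.2
  have := (convex_Icc (ψ - w) (ψ + w)).norm_image_sub_le_of_norm_hasDerivWithin_le
    (f := fun φ => mixed r φ) (C := slopeBound r₁ cb sb q d) (x := ψ) (y := φ)
    (fun x hx => (hasDerivAt_mixed (hd.trans_le (h x (by
      rw [abs_le]; constructor <;> linarith [hx.1, hx.2])).1)).hasDerivWithinAt)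
    (fun x hx => by
      obtain ⟨h1, h2, h3, h4⟩ := h x (by rw [abs_le]; constructor <;> linarith [hx.1, hx.2])
      exact abs_deriv_mixed_le hr hr₁ hd h1 h2 h3 h4)
    ⟨by linarith, by linarith⟩
    (by rw [abs_le] at hφ; constructor <;> linarith [hφ.1, hφ.2])
  refine this.trans ?_
  gcongr
  · exact (abs_nonneg _).trans hB
  · exact hφ

lemma intervalIntegrable_radDeriv {a b : ℝ} :
    IntervalIntegrable radDeriv volume a b := by
  have h : ∀ c, IntervalIntegrable (fun s : ℝ => s ^ (-(1 / 3) : ℝ)) volume 0 c :=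
    fun c => intervalIntegrable_rpow' (by norm_num)
  exact ((((h a).symm.trans (h b)).const_mul _).const_mul _)

lemma integral_radDeriv {a b : ℝ} (ha : 0 ≤ a) (hab : a ≤ b) :
    ∫ s in a..b, radDeriv s = rad b - rad a :=
  integral_eq_sub_of_hasDerivAt_of_le hab continuous_rad.continuousOn
    (fun _ hs => hasDerivAt_rad (ha.trans_lt hs.1)) intervalIntegrable_radDeriv

lemma intervalIntegrable_mul_radDeriv {a b : ℝ} (hab : a ≤ b) {f : ℝ → ℝ}
    (hf : ContinuousOn f (Set.Icc a b)) :
    IntervalIntegrable (fun s => f s * radDeriv s) volume a b := by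
  rw [← Set.uIcc_of_le hab] at hf
  exact (intervalIntegrable_radDeriv (a := a) (b := b)).continuousOn_mul hf

lemma abs_integral_cell_le {θ ψ a b w cb sb q d : ℝ} (ha : 0 ≤ a) (hab : a ≤ b) (hd : 0 < d)
    (hw : ∀ s ∈ Set.Icc a b, |θ - s - ψ| ≤ w)
    (h : ∀ r ∈ Set.Icc (rad a) (rad b), ∀ x, |x - ψ| ≤ w → d ≤ dst r x ∧ |cos x| ≤ cb ∧
      |sin x| ≤ sb ∧ |1 + r * cos x - 2 * r ^ 2| ≤ q) :
    |(∫ s in a..b, mixed (rad s) (θ - s) * radDeriv s) -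
      (angForce (rad b) ψ - angForce (rad a) ψ)| ≤
      slopeBound (rad b) cb sb q d * w * (rad b - rad a) := by
  have hmem : ∀ s ∈ Set.Icc a b, rad s ∈ Set.Icc (rad a) (rad b) := fun s hs =>
    ⟨rad_mono ha hs.1, rad_mono (ha.trans hs.1) hs.2⟩
  have hw0 : 0 ≤ w := (abs_nonneg _).trans (hw a ⟨le_rfl, hab⟩)
  have hdψ : ∀ s ∈ Set.Icc a b, d ≤ dst (rad s) ψ := fun s hs => (h _ (hmem s hs) ψ (by simpa)).1
  have hdθ : ∀ s ∈ Set.Icc a b, d ≤ dst (rad s) (θ - s) := fun s hs =>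
    (h _ (hmem s hs) _ (hw s hs)).1
  have hc := continuous_rad
  have hcont : ∀ f : ℝ → ℝ, Continuous f → (∀ s ∈ Set.Icc a b, d ≤ dst (rad s) (f s)) →
      IntervalIntegrable (fun s => mixed (rad s) (f s) * radDeriv s) volume a b := by
    intro f hf hdf
    refine intervalIntegrable_mul_radDeriv hab (f := fun s => mixed (rad s) (f s))
      (ContinuousOn.div (by fun_prop) ?_ fun s hs => (pow_pos (hd.trans_le (hdf s hs)) 5).ne')
    exact ((continuous_dst.comp (hc.prodMk hf)).pow 5).continuousOn
  have hi1 := hcont (fun s => θ - s) (by fun_prop) hdθ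
  have hi2 := hcont (fun _ => ψ) (by fun_prop) hdψ
  have hF : ∫ s in a..b, mixed (rad s) ψ * radDeriv s =
      angForce (rad b) ψ - angForce (rad a) ψ := by
    refine integral_eq_sub_of_hasDerivAt_of_le (f := fun s => angForce (rad s) ψ) hab ?_ ?_ hi2
    · refine ContinuousOn.div (by fun_prop) ?_ fun s hs => (pow_pos (hd.trans_le (hdψ s hs)) 3).ne'
      exact ((continuous_dst.comp (hc.prodMk continuous_const)).pow 3).continuousOn
    · intro s hs
      have := hasDerivAt_angForce (hd.trans_le (hdψ s (Set.Ioo_subset_Icc_self hs)))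
      exact this.comp s (hasDerivAt_rad (ha.trans_lt hs.1))
  rw [← hF, ← intervalIntegral.integral_sub hi1 hi2, ← integral_radDeriv ha hab,
    ← intervalIntegral.integral_const_mul, ← Real.norm_eq_abs]
  refine intervalIntegral.norm_integral_le_of_norm_le hab ?_
    (intervalIntegrable_radDeriv.const_mul _)
  refine Eventually.of_forall fun s hs => ?_
  have hs := Set.Ioc_subset_Icc_self hs
  have hs0 := ha.trans hs.1
  rw [← sub_mul, norm_mul, Real.norm_of_nonneg (radDeriv_nonneg hs0)]
  refine mul_le_mul_of_nonneg_right ?_ (radDeriv_nonneg hs0)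
  exact abs_mixed_sub_mixed_le (rad_nonneg hs0) (hmem s hs).2 hd (hw s hs) (h _ (hmem s hs))

lemma abs_mixed_le_of_one_lt {r : ℝ} (hr : 1 < r) (φ : ℝ) :
    |mixed r φ| ≤ (2 + 1 / r) / (r - 1) ^ 3 := by
  have hr0 : 0 < r := one_pos.trans hr
  have hr1 : 0 < r - 1 := sub_pos.2 hr
  have hle : r - 1 ≤ dst r φ := (le_abs_self _).trans (abs_sub_one_le_dst hr0.le φ)
  have hd : 0 < dst r φ := hr1.trans_le hle
  have h1 := abs_mixed_factor_le hr0.le φ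
  have h2 := abs_mul_sin_le_dst r φ
  rw [abs_mul, abs_of_pos hr0] at h2
  calc |mixed r φ| = (r * |sin φ|) * |1 + r * cos φ - 2 * r ^ 2| / (r * dst r φ ^ 5) := by
        rw [mixed, abs_div, abs_mul, abs_of_pos (pow_pos hd 5)]
        field_simp
    _ ≤ dst r φ * ((3 * (1 + r) * dst r φ + dst r φ ^ 2) / 2) / (r * dst r φ ^ 5) := by gcongr
    _ = (3 * (1 + r)) / (2 * r * dst r φ ^ 3) + 1 / (2 * r * dst r φ ^ 2) := by field_simp
    _ ≤ (3 * (1 + r)) / (2 * r * (r - 1) ^ 3) + 1 / (2 * r * (r - 1) ^ 2) := by gcongr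
    _ = _ := by field_simp; ring

lemma abs_integral_tail_le {θ a : ℝ} (ha : 0 ≤ a) (hr : 1 < rad a) :
    |∫ s in Set.Ioi a, mixed (rad s) (θ - s) * radDeriv s| ≤
      (2 + 1 / rad a) / (2 * (rad a - 1) ^ 2) := by
  have hmono : ∀ s, a ≤ s → rad a ≤ rad s := fun s hs => rad_mono ha hs
  have hd : ∀ s ∈ Set.Ioi a, HasDerivAt (fun s => -(2 + 1 / rad a) / 2 * ((rad s - 1) ^ 2)⁻¹)
      ((2 + 1 / rad a) / (rad s - 1) ^ 3 * radDeriv s) s := fun s hs => by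
    have h0 : 0 < rad s - 1 := by linarith [hmono s (le_of_lt hs)]
    refine (((((hasDerivAt_rad (ha.trans_lt hs)).sub_const 1).fun_pow 2).fun_inv
      (pow_pos h0 2).ne').const_mul (-(2 + 1 / rad a) / 2)).congr_deriv ?_
    field_simp
    norm_num
  have hnn : ∀ s ∈ Set.Ioi a, 0 ≤ (2 + 1 / rad a) / (rad s - 1) ^ 3 * radDeriv s := fun s hs => by
    have h0 : 0 < rad s - 1 := by linarith [hmono s (le_of_lt hs)]
    have := radDeriv_nonneg (ha.trans (le_of_lt hs))
    positivity
  have hc : ContinuousWithinAt (fun s => -(2 + 1 / rad a) / 2 * ((rad s - 1) ^ 2)⁻¹)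
      (Set.Ici a) a := by
    refine (continuousAt_const.mul (((continuous_rad.continuousAt.sub
      continuousAt_const).pow 2).inv₀ ?_)).continuousWithinAt
    exact (pow_pos (sub_pos.2 hr) 2).ne'
  have ht : Tendsto (fun s => -(2 + 1 / rad a) / 2 * ((rad s - 1) ^ 2)⁻¹) atTop (𝓝 0) := by
    have : Tendsto (fun s => ((rad s - 1) ^ 2)⁻¹) atTop (𝓝 0) :=
      tendsto_inv_atTop_zero.comp ((tendsto_pow_atTop two_ne_zero).comp
        (tendsto_atTop_add_const_right _ (-1) tendsto_rad))
    simpa using this.const_mul (-(2 + 1 / rad a) / 2)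
  have hint := integrableOn_Ioi_deriv_of_nonneg hc hd hnn ht
  have hval := integral_Ioi_of_hasDerivAt_of_tendsto hc hd hint ht
  rw [← Real.norm_eq_abs]
  refine (MeasureTheory.norm_integral_le_of_norm_le hint ?_).trans_eq ?_
  · filter_upwards [ae_restrict_mem measurableSet_Ioi] with s hs
    have h0 := hmono s (le_of_lt hs)
    have h1 : 0 < rad s - 1 := by linarith
    have h2 := radDeriv_nonneg (ha.trans (le_of_lt hs))
    rw [norm_mul, Real.norm_of_nonneg h2]
    refine mul_le_mul_of_nonneg_right ((abs_mixed_le_of_one_lt (by linarith) _).trans ?_) h2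
    gcongr
  · rw [hval]
    field_simp
    ring

lemma Gamma_cube_le {x y z a b : ℝ} (hx : 0 < x) (hy : 0 < y) (ha : 0 < a) (hb : 0 < b)
    (hab : a + b = 1) (hz : a * x + b * y = z) :
    Gamma z ^ 3 ≤ Gamma x ^ (3 * a) * Gamma y ^ (3 * b) := by
  have h := Real.Gamma_mul_add_mul_le_rpow_Gamma_mul_rpow_Gamma hx hy ha hb hab
  rw [hz] at h
  have hz0 : 0 < z := hz ▸ by positivity
  have hx' := (Gamma_pos_of_pos hx).le
  have hy' := (Gamma_pos_of_pos hy).le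
  refine (pow_le_pow_left₀ (Gamma_pos_of_pos hz0).le h 3).trans_eq ?_
  rw [mul_pow, ← rpow_natCast, ← rpow_natCast, ← rpow_mul hx', ← rpow_mul hy']
  norm_num [mul_comm]

lemma Gamma_add_two_thirds_cube_le {x : ℝ} (hx : 0 < x) :
    Gamma (x + 2 / 3) ^ 3 ≤ Gamma x ^ 3 * x ^ 2 := by
  have h := Gamma_cube_le (a := 1 / 3) (b := 2 / 3) (z := x + 2 / 3) hx (by positivity : 0 < x + 1)
    (by norm_num) (by norm_num) (by norm_num) (by ring)
  norm_num at h
  rw [Gamma_add_one hx.ne'] at h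
  exact h.trans_eq (by ring)

lemma le_Gamma_add_two_thirds_cube {x : ℝ} (hx : 0 < x) :
    Gamma x ^ 3 * x ^ 3 ≤ Gamma (x + 2 / 3) ^ 3 * (x + 2 / 3) := by
  have hx' : 0 < x + 2 / 3 := by positivity
  have h := Gamma_cube_le (a := 2 / 3) (b := 1 / 3) (z := x + 1) hx'
    (by positivity : 0 < x + 2 / 3 + 1) (by norm_num) (by norm_num) (by norm_num) (by ring)
  norm_num at h
  rw [Gamma_add_one hx.ne', Gamma_add_one hx'.ne'] at h
  calc _ = (x * Gamma x) ^ 3 := by ring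
    _ ≤ _ := h
    _ = _ := by ring

lemma Gamma_nat_add_two_thirds (n : ℕ) :
    Gamma (n + 2 / 3) = (∏ i ∈ Finset.range n, (i + 2 / 3 : ℝ)) * Gamma (2 / 3) := by
  induction n with
  | zero => simp
  | succ n ih =>
    rw [Finset.prod_range_succ, mul_right_comm, ← ih, Nat.cast_add_one,
      add_right_comm, Gamma_add_one (by positivity), mul_comm]

lemma sqrt_cube : √(2 / kap) ^ 3 = 4 / 3 := by
  have h := kap_pos
  have h1 : (√(2 / kap) ^ 3) ^ 2 = (4 / 3) ^ 2 := by
    rw [← pow_mul, mul_comm, pow_mul, sq_sqrt (by positivity), div_pow, kap_cube]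
    norm_num
  exact (pow_left_inj₀ (by positivity) (by norm_num) two_ne_zero).1 h1

/-- The amplitude of the derivative of the oscillatory part of `Mplus`. -/
noncomputable def amplitude : ℝ := √(2 / kap) * Gamma (2 / 3)

lemma amplitude_cube : amplitude ^ 3 = 4 / 3 * Gamma (2 / 3) ^ 3 := by
  rw [amplitude, mul_pow, sqrt_cube]

lemma amplitude_nonneg : 0 ≤ amplitude :=
  mul_nonneg (sqrt_nonneg _) (Gamma_pos_of_pos (by norm_num)).le

lemma amplitude_le : amplitude ≤ 1.496 := by
  have h := Gamma_add_two_thirds_cube_le (x := (30 : ℕ)) (by norm_num)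
  rw [Gamma_nat_add_two_thirds, show ((30 : ℕ) : ℝ) = (29 : ℕ) + 1 by norm_num,
    Gamma_nat_eq_factorial] at h
  norm_num [Finset.prod_range_succ, Nat.factorial, mul_pow] at h
  refine le_of_pow_le_pow_left₀ three_ne_zero (by norm_num) ?_
  rw [amplitude_cube]
  norm_num
  linarith

lemma le_amplitude : 1.484 ≤ amplitude := by
  have h := le_Gamma_add_two_thirds_cube (x := (30 : ℕ)) (by norm_num)
  rw [Gamma_nat_add_two_thirds, show ((30 : ℕ) : ℝ) = (29 : ℕ) + 1 by norm_num,
    Gamma_nat_eq_factorial] at h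
  norm_num [Finset.prod_range_succ, Nat.factorial, mul_pow] at h
  refine le_of_pow_le_pow_left₀ three_ne_zero amplitude_nonneg ?_
  rw [amplitude_cube]
  norm_num
  linarith

/-- The denominator of the fixed-point numbers used below. -/
def unit : ℤ := 1099511627776

/-- Fixed-point approximations `x` and `y` to the cosine and the sine of an angle, with an error
bound `e`. -/
structure Ang where
  x : ℤ
  y : ℤ
  e : ℤ

namespace Ang

def mul (a b : Ang) : Ang :=
  ⟨(a.x * b.x - a.y * b.y) / unit, (a.x * b.y + a.y * b.x) / unit,
    a.e + b.e + a.e * b.e / unit + 3⟩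

/-- `a.pow k n` represents `n` times the angle of `a`, provided that `n < 2 ^ k`. -/
def pow (a : Ang) : ℕ → ℕ → Ang
  | 0, _ => ⟨0, 0, unit⟩
  | k + 1, n =>
    if n = 0 then ⟨unit, 0, 0⟩
    else if n % 2 = 1 then ((a.pow k (n / 2)).mul (a.pow k (n / 2))).mul a
    else (a.pow k (n / 2)).mul (a.pow k (n / 2))

/-- The angle `t / 4096`. -/
def ofInt (t : ℤ) : Ang :=
  let a := pow ⟨1099511595008, 268435453, 2⟩ 16 t.natAbs
  if 0 ≤ t then a else ⟨a.x, -a.y, a.e⟩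

end Ang

/-- Equal to `k n`, but the kernel evaluates `n` before passing it on. -/
def forceNat {α : Type} (n : ℕ) (k : ℕ → α) : α :=
  match n with
  | 0 => k 0
  | m + 1 => k m.succ

/-- Equal to `k n`, but the kernel evaluates `n` before passing it on. -/
def forceInt {α : Type} (n : ℤ) (k : ℤ → α) : α :=
  match n with
  | .ofNat a => forceNat a fun a => k (.ofNat a)
  | .negSucc a => forceNat a fun a => k (.negSucc a)

/-- An approximation to the square root of `D`, obtained by Newton iteration from `g`. -/
def newton (D : ℕ) : ℕ → ℕ → ℕ
  | 0, g => g
  | k + 1, g => forceNat ((g + D / g) / 2 + 1) fun g => newton D k g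

/-- Upper bound for `r * t / d ^ 3` with `lo ≤ d ≤ hi`. -/
def forceUpper (r t lo hi : ℤ) : ℤ :=
  if 0 ≤ t then r * t * (unit * unit) / (lo * lo * lo) + 1
  else r * t * (unit * unit) / (hi * hi * hi) + 1

/-- Bounds for the distance from `r` to the point of the unit circle at angle `z`. -/
def withDist {α : Type} (r : ℤ) (z : Ang) (k : Bool → ℤ → ℤ → α) : α :=
  forceNat (((r - z.x) * (r - z.x) + z.y * z.y).toNat) fun D =>
  forceNat (newton D 3 ((r - z.x).natAbs + z.y.natAbs + 1)) fun y =>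
  forceInt ((D / y : ℕ) - z.e) fun lo =>
  k (Nat.ble D (y * y) && decide (0 < lo)) lo (y + z.e)

/-- A piece of the range of integration: the right end point in the radial variable, the distance
from the midpoint of the previous piece in the time variable with the corresponding rotation,
and a bound for the half-length in the time variable. -/
structure Cell where
  r : ℤ
  n : ℕ
  u : Ang
  w : ℤ

/-- Pieces of equal length with the given end points. -/
def cells (n : ℕ) (u : Ang) (w : ℤ) (rs : List ℤ) : List Cell :=
  rs.map fun r => ⟨r, n, u, w⟩

/-- Upper bound for `1 + r * c - 2 * r ^ 2` and its negative, for `r₀ ≤ r ≤ r₁` and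
`x - w ≤ c ≤ x + w`. -/
def factorUpper (r₀ r₁ x w : ℤ) : ℤ :=
  max (unit * unit + max (r₀ * (x + w)) (r₁ * (x + w)) - 2 * (r₀ * r₀))
    (2 * (r₁ * r₁) - unit * unit - min (r₀ * (x - w)) (r₁ * (x - w)))

/-- Upper bound for the error term of a piece. -/
def slopeUpper (r h w cb sb q d : ℤ) : ℤ :=
  forceInt (d * d) fun d₂ =>
  w * h * (cb * q * d₂ + r * (sb * sb) * (d₂ + 5 * q)) * unit / (d₂ * d₂ * d₂ * d) + 1

/-- Checks that `acc` plus the integral over the remaining pieces and the tail is negative. -/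
def check (sg hw : ℤ) : List Cell → Ang → ℤ → ℤ → Bool
  | [], _, r, acc =>
    decide (unit < r) &&
    decide (acc * (2 * r * ((r - unit) * (r - unit))) +
      (2 * r + unit) * (unit * unit * unit) < 0)
  | c :: L, z, r, acc =>
    forceInt (z.mul c.u).x fun x =>
    forceInt (z.mul c.u).y fun y =>
    forceInt (z.mul c.u).e fun e =>
    withDist r ⟨x, y, e⟩ fun b₀ lo₀ hi₀ =>
    withDist c.r ⟨x, y, e⟩ fun b₁ lo₁ hi₁ =>
    forceInt (hw * 268435456 + c.w) fun w =>
    forceInt ((lo₀ + lo₁ - (c.r - r)) / 2 - w) fun d =>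
    forceInt (factorUpper r c.r x (w + e)) fun q =>
    forceInt (acc + forceUpper c.r (sg * y + e) lo₁ hi₁ + forceUpper r (-(sg * y) + e) lo₀ hi₀ +
      slopeUpper c.r (c.r - r) w (|x| + (w + e)) (|y| + (w + e)) q d) fun acc =>
    b₀ && b₁ && decide (0 < d) && check sg hw L ⟨x, y, e⟩ c.r acc

def boxCheck (sg t hw : ℤ) (L : List Cell) : Bool :=
  forceInt (sg * ((Ang.ofInt t).mul ⟨952205001410, 549755813888, 2⟩).x +
    ((Ang.ofInt t).mul ⟨952205001410, 549755813888, 2⟩).e + hw * 268435456) fun v =>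
  check sg hw L (Ang.ofInt t) 0 (max (1484 * v / 1000 + 1) (1496 * v / 1000 + 1))

/-- Checks the consecutive intervals with the given half-widths, starting at `t`. -/
def coverCheck (sg : ℤ) (L : List Cell) (last : ℤ) : ℤ → List ℤ → Bool
  | t, [] => decide (last ≤ t)
  | t, hw :: H => boxCheck sg (t + hw) hw L && coverCheck sg L last (t + 2 * hw) H

/-- Checks that a list of pieces is consistent. -/
def schedCheck : List Cell → ℤ → ℤ → Bool
  | [], _, _ => true
  | c :: L, m, r =>
    forceInt (m + c.n) fun m =>
    forceInt (m * 268435456) fun M =>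
    decide (c.u.x = (Ang.ofInt (-c.n)).x) && decide (c.u.y = (Ang.ofInt (-c.n)).y) &&
    decide (c.u.e = (Ang.ofInt (-c.n)).e) && decide (r ≤ c.r) && decide (0 ≤ c.w) &&
    (decide (M ≤ c.w) || decide (9 * ((M - c.w) * (M - c.w)) * unit ≤ 2 * (r * r * r))) &&
    decide (2 * (c.r * c.r * c.r) ≤ 9 * ((M + c.w) * (M + c.w)) * unit) &&
    schedCheck L m c.r

lemma unit_pos : 0 < unit := by decide

lemma unit_pos' : (0 : ℝ) < unit := by exact_mod_cast unit_pos

lemma cast_ediv_le {a b : ℤ} (hb : 0 < b) : ((a / b : ℤ) : ℝ) ≤ a / b := by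
  have : (0 : ℝ) < b := by exact_mod_cast hb
  rw [le_div_iff₀ this]
  exact_mod_cast Int.ediv_mul_le a hb.ne'

lemma lt_cast_ediv_add_one {a b : ℤ} (hb : 0 < b) : (a : ℝ) / b < (a / b : ℤ) + 1 := by
  have : (0 : ℝ) < b := by exact_mod_cast hb
  rw [div_lt_iff₀ this]
  exact_mod_cast Int.lt_ediv_add_one_mul_self a hb

/-- `z` represents the angle `φ` within its error bound. -/
def Ang.Enc (z : Ang) (φ : ℝ) : Prop :=
  ‖(⟨z.x, z.y⟩ : ℂ) - (unit : ℝ) * Complex.exp (Complex.I * φ)‖ ≤ z.e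

lemma exp_I_mul_re (φ : ℝ) : (Complex.exp (Complex.I * φ)).re = cos φ := by
  rw [mul_comm, Complex.exp_ofReal_mul_I_re]

lemma exp_I_mul_im (φ : ℝ) : (Complex.exp (Complex.I * φ)).im = sin φ := by
  rw [mul_comm, Complex.exp_ofReal_mul_I_im]

lemma norm_exp_I_mul (φ : ℝ) : ‖Complex.exp (Complex.I * φ)‖ = 1 := by
  rw [mul_comm, Complex.norm_exp_ofReal_mul_I]

namespace Ang.Enc

variable {z w : Ang} {φ ψ : ℝ}

lemma of_abs_add_abs_le (h : |(z.x : ℝ) - unit * cos φ| + |(z.y : ℝ) - unit * sin φ| ≤ z.e) :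
    z.Enc φ := by
  refine (Complex.norm_le_abs_re_add_abs_im _).trans ?_
  simpa [exp_I_mul_re, exp_I_mul_im] using h

lemma abs_cos_le (h : z.Enc φ) : |(z.x : ℝ) - unit * cos φ| ≤ z.e := by
  refine le_trans ?_ ((Complex.abs_re_le_norm _).trans h)
  simp [exp_I_mul_re]

lemma abs_sin_le (h : z.Enc φ) : |(z.y : ℝ) - unit * sin φ| ≤ z.e := by
  refine le_trans ?_ ((Complex.abs_im_le_norm _).trans h)
  simp [exp_I_mul_im]

lemma nonneg (h : z.Enc φ) : (0 : ℝ) ≤ z.e := (norm_nonneg _).trans h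

lemma mul (hz : z.Enc φ) (hw : w.Enc ψ) : (z.mul w).Enc (φ + ψ) := by
  have hN := unit_pos'
  have h1 : Complex.exp (Complex.I * ((φ + ψ : ℝ) : ℂ)) =
      Complex.exp (Complex.I * φ) * Complex.exp (Complex.I * ψ) := by
    rw [← Complex.exp_add]; push_cast; ring_nf
  have hw' : ‖(⟨w.x, w.y⟩ : ℂ)‖ ≤ unit + w.e := by
    have := norm_le_norm_add_norm_sub ((unit : ℝ) * Complex.exp (Complex.I * ψ)) (⟨w.x, w.y⟩ : ℂ)
    rw [norm_mul, norm_exp_I_mul, Complex.norm_real, mul_one, norm_eq_abs, abs_of_pos hN] at this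
    rw [norm_sub_rev] at this
    exact this.trans (by gcongr; exact hw)
  have h2 : ‖(⟨z.x, z.y⟩ : ℂ) * ⟨w.x, w.y⟩ / (unit : ℝ) -
      (unit : ℝ) * Complex.exp (Complex.I * ((φ + ψ : ℝ) : ℂ))‖ ≤
      z.e + w.e + z.e * w.e / unit := by
    have hNc : ((unit : ℝ) : ℂ) ≠ 0 := by exact_mod_cast hN.ne'
    have h3 : (⟨z.x, z.y⟩ : ℂ) * ⟨w.x, w.y⟩ / (unit : ℝ) -
        (unit : ℝ) * Complex.exp (Complex.I * ((φ + ψ : ℝ) : ℂ)) =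
        ((⟨z.x, z.y⟩ : ℂ) - (unit : ℝ) * Complex.exp (Complex.I * φ)) * ⟨w.x, w.y⟩ / (unit : ℝ) +
        Complex.exp (Complex.I * φ) *
          ((⟨w.x, w.y⟩ : ℂ) - (unit : ℝ) * Complex.exp (Complex.I * ψ)) := by
      rw [h1]; field_simp; ring
    rw [h3]
    refine (norm_add_le _ _).trans ?_
    rw [norm_div, norm_mul, norm_mul, norm_exp_I_mul, Complex.norm_real, one_mul, norm_eq_abs,
      abs_of_pos hN]
    have h4 : ‖(⟨z.x, z.y⟩ : ℂ) - (unit : ℝ) * Complex.exp (Complex.I * φ)‖ * ‖(⟨w.x, w.y⟩ : ℂ)‖ /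
        unit ≤ z.e * (unit + w.e) / unit := by
      have := hz.nonneg
      gcongr
      exact hz
    have h5 : (z.e : ℝ) * (unit + w.e) / unit = z.e + z.e * w.e / unit := by field_simp
    have h6 : ‖(⟨w.x, w.y⟩ : ℂ) - (unit : ℝ) * Complex.exp (Complex.I * ψ)‖ ≤ w.e := hw
    linarith
  have h7 : ‖(⟨(z.mul w).x, (z.mul w).y⟩ : ℂ) - (⟨z.x, z.y⟩ : ℂ) * ⟨w.x, w.y⟩ / (unit : ℝ)‖ ≤
      2 := by
    refine (Complex.norm_le_abs_re_add_abs_im _).trans ?_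
    have hx := cast_ediv_le (a := z.x * w.x - z.y * w.y) unit_pos
    have hx' := lt_cast_ediv_add_one (a := z.x * w.x - z.y * w.y) unit_pos
    have hy := cast_ediv_le (a := z.x * w.y + z.y * w.x) unit_pos
    have hy' := lt_cast_ediv_add_one (a := z.x * w.y + z.y * w.x) unit_pos
    simp only [Complex.sub_re, Complex.sub_im, Complex.div_ofReal_re, Complex.div_ofReal_im,
      Complex.mul_re, Complex.mul_im, Ang.mul]
    push_cast at *
    have a1 : |(((z.x * w.x - z.y * w.y) / unit : ℤ) : ℝ) - (z.x * w.x - z.y * w.y) / unit| ≤ 1 :=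
      abs_le.2 ⟨by linarith, by linarith⟩
    have a2 : |(((z.x * w.y + z.y * w.x) / unit : ℤ) : ℝ) - (z.x * w.y + z.y * w.x) / unit| ≤ 1 :=
      abs_le.2 ⟨by linarith, by linarith⟩
    linarith
  have h8 := lt_cast_ediv_add_one (a := z.e * w.e) unit_pos
  refine (norm_sub_le_norm_sub_add_norm_sub _ _ _).trans ((add_le_add h7 h2).trans ?_)
  simp only [Ang.mul]
  push_cast at *
  linarith

lemma pow (h : z.Enc φ) (k n : ℕ) : (z.pow k n).Enc (n * φ) := by
  induction k generalizing n with
  | zero =>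
    have h0 : (⟨((0 : ℤ) : ℝ), ((0 : ℤ) : ℝ)⟩ : ℂ) = 0 := by simp [Complex.ext_iff]
    simp only [Ang.Enc, Ang.pow]
    rw [h0, zero_sub, norm_neg, norm_mul, norm_exp_I_mul, Complex.norm_real, mul_one, norm_eq_abs,
      abs_of_pos unit_pos']
  | succ k ih =>
    have h2 := (ih (n / 2)).mul (ih (n / 2))
    rw [Ang.pow]
    split_ifs with h0 h1
    · refine of_abs_add_abs_le ?_
      simp [h0]
    · convert h2.mul h using 1
      have : (n : ℝ) = ((n / 2 * 2 + 1 : ℕ) : ℝ) := by congr 1; lia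
      rw [this]; push_cast; ring
    · convert h2 using 1
      have : (n : ℝ) = ((n / 2 * 2 : ℕ) : ℝ) := by congr 1; lia
      rw [this]; push_cast; ring

lemma neg (h : z.Enc φ) : Ang.Enc ⟨z.x, -z.y, z.e⟩ (-φ) := by
  rw [Ang.Enc, ← Complex.norm_conj] at h
  refine (congrArg norm ?_).trans_le h
  apply Complex.ext <;>
  simp only [map_sub, map_mul, Complex.conj_ofReal, Complex.sub_re, Complex.sub_im,
    Complex.re_ofReal_mul, Complex.im_ofReal_mul, Complex.conj_re, Complex.conj_im, exp_I_mul_re,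
    exp_I_mul_im, cos_neg, sin_neg, Int.cast_neg]

lemma ofInt (t : ℤ) : (Ang.ofInt t).Enc (t / 4096) := by
  have hb : Ang.Enc ⟨1099511595008, 268435453, 2⟩ (1 / 4096) := by
    refine of_abs_add_abs_le ?_
    have hc := abs_le.1 (cos_bound (x := 1 / 4096) (by norm_num [abs_of_pos]))
    have hs := abs_le.1 (sin_bound (x := 1 / 4096) (by norm_num [abs_of_pos]))
    rw [abs_of_pos (by norm_num : (0 : ℝ) < 1 / 4096)] at hc hs
    norm_num at hc hs
    simp only [unit]
    push_cast
    have a1 : |(1099511595008 : ℝ) - 1099511627776 * cos (1 / 4096)| ≤ 1 :=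
      abs_le.2 ⟨by norm_num; linarith, by norm_num; linarith⟩
    have a2 : |(268435453 : ℝ) - 1099511627776 * sin (1 / 4096)| ≤ 1 :=
      abs_le.2 ⟨by norm_num; linarith, by norm_num; linarith⟩
    linarith
  have hp := hb.pow 16 t.natAbs
  rw [Ang.ofInt]
  split_ifs with ht
  · convert hp using 1
    have : (t.natAbs : ℝ) = t := by rw [Nat.cast_natAbs, abs_of_nonneg ht]
    rw [this]; ring
  · convert hp.neg using 1
    have : (t.natAbs : ℝ) = -t := by
      rw [Nat.cast_natAbs, abs_of_neg (not_le.1 ht), Int.cast_neg]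
    rw [this]; ring

end Ang.Enc

@[simp]
lemma forceNat_eq {α : Type} (n : ℕ) (k : ℕ → α) : forceNat n k = k n := by
  cases n <;> rfl

@[simp]
lemma forceInt_eq {α : Type} (n : ℤ) (k : ℤ → α) : forceInt n k = k n := by
  cases n <;> simp [forceInt]

lemma abs_sub_unit_mul_dst_le {z : Ang} {φ : ℝ} (h : z.Enc φ) (r : ℤ) :
    |√(((r : ℝ) - z.x) ^ 2 + (z.y : ℝ) ^ 2) - unit * dst (r / unit) φ| ≤ z.e := by
  have hN := unit_pos'
  have h1 : √(((r : ℝ) - z.x) ^ 2 + (z.y : ℝ) ^ 2) = ‖(r : ℝ) - (⟨z.x, z.y⟩ : ℂ)‖ := by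
    rw [Complex.norm_eq_sqrt_sq_add_sq]; simp
  have h2 : unit * dst (r / unit) φ =
      ‖(r : ℝ) - (unit : ℝ) * Complex.exp (Complex.I * φ)‖ := by
    have h3 : (unit : ℝ) = ‖((unit : ℝ) : ℂ)‖ := by
      rw [Complex.norm_real, norm_eq_abs, abs_of_pos hN]
    rw [dst_eq_norm, h3, ← norm_mul, ← h3, mul_sub]
    congr 2
    push_cast
    have : (unit : ℂ) ≠ 0 := by exact_mod_cast hN.ne'
    field_simp
  rw [h1, h2]
  refine (abs_norm_sub_norm_le _ _).trans ?_
  rw [sub_sub_sub_cancel_left, norm_sub_rev]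
  exact h

lemma exists_withDist {α : Type} (r : ℤ) (z : Ang) (k : Bool → ℤ → ℤ → α) :
    ∃ b lo hi, withDist r z k = k b lo hi ∧ (b = true → ∀ φ, z.Enc φ →
      0 < lo ∧ (lo : ℝ) ≤ unit * dst (r / unit) φ ∧ unit * dst (r / unit) φ ≤ hi) := by
  simp only [withDist, forceNat_eq, forceInt_eq]
  set D := ((r - z.x) * (r - z.x) + z.y * z.y).toNat with hD
  set y := newton D 3 ((r - z.x).natAbs + z.y.natAbs + 1)
  refine ⟨_, _, _, rfl, fun h φ hφ => ?_⟩
  simp only [Bool.and_eq_true, Nat.ble_eq, decide_eq_true_eq] at h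
  obtain ⟨hy, hlo⟩ := h
  have hD' : (D : ℝ) = ((r : ℝ) - z.x) ^ 2 + (z.y : ℝ) ^ 2 := by
    have : (D : ℤ) = (r - z.x) * (r - z.x) + z.y * z.y :=
      Int.toNat_of_nonneg (add_nonneg (mul_self_nonneg _) (mul_self_nonneg _))
    have : ((D : ℤ) : ℝ) = (((r - z.x) * (r - z.x) + z.y * z.y : ℤ) : ℝ) := by rw [this]
    push_cast at this
    rw [this]; ring
  have h1 := abs_le.1 (abs_sub_unit_mul_dst_le hφ r)
  rw [← hD'] at h1
  have h2 : √(D : ℝ) ≤ y := by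
    rw [sqrt_le_left (by positivity), sq]
    exact_mod_cast hy
  have h3 : ((D / y : ℕ) : ℝ) ≤ √(D : ℝ) := by
    refine le_sqrt_of_sq_le ?_
    have h4 : D / y ≤ y := Nat.div_le_of_le_mul hy
    have h5 : (D / y) ^ 2 ≤ D := by
      rw [sq]; exact (Nat.mul_le_mul_left _ h4).trans (Nat.div_mul_le_self _ _)
    exact_mod_cast h5
  refine ⟨hlo, ?_, ?_⟩
  · rw [Int.cast_sub, Int.cast_natCast]; linarith
  · rw [Int.cast_add, Int.cast_natCast]; linarith

lemma le_forceUpper {r t lo hi : ℤ} {S d : ℝ} (hr : 0 ≤ r) (hS : unit * S ≤ t) (hlo : 0 < lo)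
    (h₁ : (lo : ℝ) ≤ unit * d) (h₂ : unit * d ≤ hi) :
    unit * (r / unit * S / d ^ 3) ≤ forceUpper r t lo hi := by
  have hN := unit_pos'
  have hlo' : (0 : ℝ) < lo := by exact_mod_cast hlo
  have hhi' : (0 : ℝ) < hi := by linarith
  have hhi : 0 < hi := by exact_mod_cast hhi'
  have hr' : (0 : ℝ) ≤ r := by exact_mod_cast hr
  have hd : 0 < unit * d := by linarith
  have hd' : 0 < d := (mul_pos_iff_of_pos_left hN).1 hd
  have h3 : unit * (r / unit * S / d ^ 3) ≤ r * t * (unit * unit) / (unit * d) ^ 3 := by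
    have : unit * (r / unit * S / d ^ 3) = r * (unit * S) * (unit * unit) / (unit * d) ^ 3 := by
      field_simp
    rw [this]
    gcongr
  rw [forceUpper]
  split_ifs with ht
  · have ht' : (0 : ℝ) ≤ t := by exact_mod_cast ht
    have h4 := lt_cast_ediv_add_one (a := r * t * (unit * unit)) (b := lo * lo * lo) (by positivity)
    have h5 : (r : ℝ) * t * (unit * unit) / (unit * d) ^ 3 ≤
        r * t * (unit * unit) / (lo * lo * lo) := by
      rw [show (lo : ℝ) * lo * lo = lo ^ 3 by ring]
      gcongr
    push_cast at *
    linarith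
  · have ht' : (t : ℝ) ≤ 0 := by exact_mod_cast (not_le.1 ht).le
    have h4 := lt_cast_ediv_add_one (a := r * t * (unit * unit)) (b := hi * hi * hi) (by positivity)
    have h5 : (r : ℝ) * t * (unit * unit) / (unit * d) ^ 3 ≤
        r * t * (unit * unit) / (hi * hi * hi) := by
      have : (r : ℝ) * -t * (unit * unit) / (hi * hi * hi) ≤
          r * -t * (unit * unit) / (unit * d) ^ 3 := by
        rw [show (hi : ℝ) * hi * hi = hi ^ 3 by ring]
        have : 0 ≤ -(t : ℝ) := by linarith
        gcongr
      rw [mul_neg, neg_mul, neg_div, neg_div] at this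
      linarith
    push_cast at *
    linarith

lemma abs_factor_le {r₀ r₁ x w : ℤ} {r c : ℝ} (hr₀ : 0 ≤ r₀) (h₀ : (r₀ : ℝ) ≤ unit * r)
    (h₁ : unit * r ≤ r₁) (hc : |(unit : ℝ) * c - x| ≤ w) :
    (unit : ℝ) * unit * |1 + r * c - 2 * r ^ 2| ≤ factorUpper r₀ r₁ x w := by
  have hN := unit_pos'
  have hr₀' : (0 : ℝ) ≤ r₀ := by exact_mod_cast hr₀
  have hr : 0 ≤ unit * r := by linarith
  obtain ⟨hc₁, hc₂⟩ := abs_le.1 hc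
  have h2 : (r₀ : ℝ) * r₀ ≤ (unit * r) * (unit * r) := by gcongr
  have h3 : (unit * r) * (unit * r) ≤ (r₁ : ℝ) * r₁ :=
    mul_le_mul h₁ h₁ hr (hr.trans h₁)
  have h4 : (unit * r) * (unit * c) ≤ max (r₀ * (x + w) : ℝ) (r₁ * (x + w)) := by
    refine (mul_le_mul_of_nonneg_left (by linarith : unit * c ≤ x + w) hr).trans ?_
    rcases le_total 0 ((x : ℝ) + w) with h | h
    · exact le_max_of_le_right (mul_le_mul_of_nonneg_right h₁ h)
    · exact le_max_of_le_left (mul_le_mul_of_nonpos_right h₀ h)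
  have h5 : min (r₀ * (x - w) : ℝ) (r₁ * (x - w)) ≤ (unit * r) * (unit * c) := by
    refine le_trans ?_ (mul_le_mul_of_nonneg_left (by linarith : (x : ℝ) - w ≤ unit * c) hr)
    rcases le_total 0 ((x : ℝ) - w) with h | h
    · exact min_le_of_left_le (mul_le_mul_of_nonneg_right h₀ h)
    · exact min_le_of_right_le (mul_le_mul_of_nonpos_right h₁ h)
  rw [← abs_of_pos (mul_pos hN hN), ← abs_mul, factorUpper]
  push_cast
  rw [abs_le', le_max_iff, le_max_iff]
  exact ⟨.inl (by nlinarith), .inr (by nlinarith)⟩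

lemma slopeBound_le_slopeUpper {r h w cb sb q d : ℤ} (hd : 0 < d) :
    unit * (slopeBound (r / unit) (cb / unit) (sb / unit) (q / (unit * unit)) (d / unit) *
      (w / unit) * (h / unit)) ≤ slopeUpper r h w cb sb q d := by
  have hN := unit_pos'
  have hd' : (0 : ℝ) < d := by exact_mod_cast hd
  have h1 := lt_cast_ediv_add_one (a := w * h * (cb * q * (d * d) + r * (sb * sb) *
    (d * d + 5 * q)) * unit) (b := d * d * (d * d) * (d * d) * d) (by positivity)
  rw [slopeUpper, forceInt_eq]
  push_cast at *
  refine (Eq.trans_le ?_ h1.le)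
  rw [slopeBound]
  field_simp

/-- The inverse function of `rad`. -/
noncomputable def radInv (r : ℝ) : ℝ := √(2 / 9 * r ^ 3)

lemma radInv_nonneg (r : ℝ) : 0 ≤ radInv r := sqrt_nonneg _

lemma rad_radInv {r : ℝ} (hr : 0 ≤ r) : rad (radInv r) = r := by
  refine (pow_left_inj₀ (rad_nonneg (radInv_nonneg r)) hr three_ne_zero).1 ?_
  rw [rad_cube (radInv_nonneg r), radInv, sq_sqrt (by positivity)]
  ring

lemma radInv_mono {r r' : ℝ} (hr : 0 ≤ r) (h : r ≤ r') : radInv r ≤ radInv r' := by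
  unfold radInv; gcongr

/-- The contribution of one piece of the range of integration is at most the sum of the bounds
computed by `check`. -/
lemma integral_cell_le {θ ψ : ℝ} {s r r' x y e w lo lo' hi hi' d : ℤ}
    (hs : s = 1 ∨ s = -1) (hr : 0 ≤ r) (hrr : r ≤ r') (hz : Ang.Enc ⟨x, y, e⟩ ψ)
    (hw : ∀ t ∈ Set.Icc (radInv (r / unit)) (radInv (r' / unit)), unit * |θ - t - ψ| ≤ w)
    (h₀ : 0 < lo ∧ (lo : ℝ) ≤ unit * dst (r / unit) ψ ∧ unit * dst (r / unit) ψ ≤ hi)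
    (h₁ : 0 < lo' ∧ (lo' : ℝ) ≤ unit * dst (r' / unit) ψ ∧ unit * dst (r' / unit) ψ ≤ hi')
    (hd : d = (lo + lo' - (r' - r)) / 2 - w) (hd₀ : 0 < d) :
    unit * (s * ∫ t in radInv (r / unit)..radInv (r' / unit), mixed (rad t) (θ - t) * radDeriv t) ≤
      forceUpper r' (s * y + e) lo' hi' + forceUpper r (-(s * y) + e) lo hi +
      slopeUpper r' (r' - r) w (|x| + (w + e)) (|y| + (w + e)) (factorUpper r r' x (w + e)) d := by
  have hN := unit_pos'
  have hr₀ : (0 : ℝ) ≤ r := by exact_mod_cast hr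
  have hrr₀ : (r : ℝ) ≤ r' := by exact_mod_cast hrr
  have hR : (0 : ℝ) ≤ r / unit := by positivity
  have hRR : (r : ℝ) / unit ≤ r' / unit := by gcongr
  have hR' := hR.trans hRR
  have hc := hz.abs_cos_le
  have hs' := hz.abs_sin_le
  simp only at hc hs'
  have key := abs_integral_cell_le (θ := θ) (ψ := ψ) (w := w / unit) (d := d / unit)
    (cb := (|x| + (w + e) : ℤ) / unit) (sb := (|y| + (w + e) : ℤ) / unit)
    (q := (factorUpper r r' x (w + e) : ℤ) / (unit * unit))
    (radInv_nonneg (r / unit)) (radInv_mono hR hRR)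
    (div_pos (by exact_mod_cast hd₀) hN) (fun t ht => ?_) ?_
  · rw [rad_radInv hR, rad_radInv hR'] at key
    have hsl := slopeBound_le_slopeUpper (r := r') (h := r' - r) (w := w) (cb := |x| + (w + e))
      (sb := |y| + (w + e)) (q := factorUpper r r' x (w + e)) hd₀
    rw [show ((r' - r : ℤ) : ℝ) / unit = r' / unit - r / unit by push_cast; ring] at hsl
    have hsin : unit * (s * sin ψ) ≤ (s * y + e : ℤ) ∧
        unit * (-(s * sin ψ)) ≤ (-(s * y) + e : ℤ) := by
      obtain ⟨_, _⟩ := abs_le.1 hs'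
      rcases hs with rfl | rfl <;> push_cast <;> constructor <;> linarith
    have hf := le_forceUpper (hr.trans hrr) hsin.1 h₁.1 h₁.2.1 h₁.2.2
    have hf' := le_forceUpper hr hsin.2 h₀.1 h₀.2.1 h₀.2.2
    have : s * (∫ t in radInv (r / unit)..radInv (r' / unit),
        mixed (rad t) (θ - t) * radDeriv t) ≤
        r' / unit * (s * sin ψ) / dst (r' / unit) ψ ^ 3 +
        r / unit * (-(s * sin ψ)) / dst (r / unit) ψ ^ 3 +
        slopeBound (r' / unit) ((|x| + (w + e) : ℤ) / unit) ((|y| + (w + e) : ℤ) / unit)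
          ((factorUpper r r' x (w + e) : ℤ) / (unit * unit)) (d / unit) * (w / unit) *
          (r' / unit - r / unit) := by
      obtain ⟨_, _⟩ := abs_le.1 key
      simp only [angForce] at *
      rcases hs with rfl | rfl <;> push_cast at * <;> ring_nf at * <;> linarith
    have := mul_le_mul_of_nonneg_left this hN.le
    linarith
  · rw [le_div_iff₀ hN, mul_comm]
    exact hw t ht
  · rw [rad_radInv hR, rad_radInv hR']
    intro ρ hρ t ht
    have ht' : unit * |t - ψ| ≤ w := by rwa [le_div_iff₀ hN, mul_comm] at ht
    have hcos : |unit * cos t - x| ≤ (w + e : ℤ) := by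
      have h1 : |unit * cos t - unit * cos ψ| ≤ w := by
        rw [← mul_sub, abs_mul, abs_of_pos hN]
        exact (mul_le_mul_of_nonneg_left (abs_cos_sub_cos_le t ψ) hN.le).trans ht'
      have := abs_sub_le (unit * cos t) (unit * cos ψ) x
      rw [abs_sub_comm (unit * cos ψ)] at this
      push_cast
      linarith
    have hsin : |unit * sin t - y| ≤ (w + e : ℤ) := by
      have h1 : |unit * sin t - unit * sin ψ| ≤ w := by
        rw [← mul_sub, abs_mul, abs_of_pos hN]
        exact (mul_le_mul_of_nonneg_left (abs_sin_sub_sin_le t ψ) hN.le).trans ht'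
      have := abs_sub_le (unit * sin t) (unit * sin ψ) y
      rw [abs_sub_comm (unit * sin ψ)] at this
      push_cast
      linarith
    refine ⟨?_, ?_, ?_, ?_⟩
    · have h1 := (abs_le.1 (abs_dst_sub_dst_le ρ (r / unit) t ψ)).1
      have h2 := (abs_le.1 (abs_dst_sub_dst_le ρ (r' / unit) t ψ)).1
      rw [abs_of_nonneg (by linarith [hρ.1])] at h1
      rw [abs_of_nonpos (by linarith [hρ.2])] at h2
      have h3 := cast_ediv_le (a := lo + lo' - (r' - r)) (b := 2) (by norm_num)
      have h4 : (d : ℝ) = ((lo + lo' - (r' - r)) / 2 : ℤ) - w := by rw [hd]; push_cast; ring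
      rw [div_le_iff₀ hN, mul_comm]
      have h5 := mul_le_mul_of_nonneg_left (add_le_add h1 h2) hN.le
      have e1 : unit * (r / unit : ℝ) = r := by field_simp
      have e2 : unit * (r' / unit : ℝ) = r' := by field_simp
      push_cast at h3
      nlinarith [h₀.2.1, h₁.2.1]
    · rw [le_div_iff₀ hN, mul_comm, ← abs_of_pos hN, ← abs_mul]
      have := abs_sub_abs_le_abs_sub (unit * cos t) x
      push_cast at *
      linarith
    · rw [le_div_iff₀ hN, mul_comm, ← abs_of_pos hN, ← abs_mul]
      have := abs_sub_abs_le_abs_sub (unit * sin t) y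
      push_cast at *
      linarith
    · rw [le_div_iff₀ (by positivity), mul_comm]
      exact abs_factor_le hr ((div_le_iff₀' hN).1 hρ.1) ((le_div_iff₀' hN).1 hρ.2) hcos

/-- The integrals occurring in `check` are over the ranges prescribed by `schedCheck`. -/
lemma abs_sub_le_of_schedCheck {r r' M w : ℤ} {t : ℝ} (hr : 0 ≤ r) (hM : 0 ≤ M) (hw : 0 ≤ w)
    (h : M ≤ w ∨ 9 * ((M - w) * (M - w)) * unit ≤ 2 * (r * r * r))
    (h' : 2 * (r' * r' * r') ≤ 9 * ((M + w) * (M + w)) * unit) (hr' : 0 ≤ r')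
    (ht : t ∈ Set.Icc (radInv (r / unit)) (radInv (r' / unit))) :
    |unit * t - M| ≤ w := by
  have hN := unit_pos'
  have ht₀ := (radInv_nonneg _).trans ht.1
  have hr₀ : (0 : ℝ) ≤ r := by exact_mod_cast hr
  have hr₀' : (0 : ℝ) ≤ r' := by exact_mod_cast hr'
  have hMw : (0 : ℝ) ≤ M + w := by exact_mod_cast add_nonneg hM hw
  have h1 : (2 * (r * r * r) : ℝ) ≤ 9 * (unit * t) ^ 2 * unit := by
    have := (sqrt_le_left ht₀).1 ht.1
    rw [div_pow, mul_div_assoc', div_le_iff₀ (by positivity)] at this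
    nlinarith
  have h2 : 9 * (unit * t) ^ 2 * unit ≤ (2 * (r' * r' * r') : ℝ) := by
    have := (le_sqrt ht₀ (by positivity)).1 ht.2
    rw [div_pow, mul_div_assoc', le_div_iff₀ (by positivity)] at this
    nlinarith
  have hNt : 0 ≤ unit * t := by positivity
  rw [abs_le]
  constructor
  · rcases h with h | h
    · have : (M : ℝ) ≤ w := by exact_mod_cast h
      linarith
    · have h3 : (9 * ((M - w) * (M - w)) * unit : ℝ) ≤ 2 * (r * r * r) := by exact_mod_cast h
      have h4 : ((M : ℝ) - w) ^ 2 ≤ (unit * t) ^ 2 := by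
        have := h3.trans h1
        have := le_of_mul_le_mul_right this hN
        linarith
      linarith [abs_le_of_sq_le_sq' h4 hNt]
  · have h3 : (2 * (r' * r' * r') : ℝ) ≤ 9 * ((M + w) * (M + w)) * unit := by exact_mod_cast h'
    have h4 : (unit * t) ^ 2 ≤ ((M : ℝ) + w) ^ 2 := by
      have := h2.trans h3
      have := le_of_mul_le_mul_right this hN
      linarith
    linarith [(abs_le_of_sq_le_sq' h4 hMw).2]

lemma neg_of_check {θ θ₀ : ℝ} {s hw : ℤ} (hs : s = 1 ∨ s = -1) (hθ : Regular θ)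
    (hθ₀ : |θ - θ₀| ≤ hw / 4096) {L : List Cell} {m r acc : ℤ} {z : Ang} (hm : 0 ≤ m)
    (hr : 0 ≤ r) (hz : z.Enc (θ₀ - m / 4096)) (hL : schedCheck L m r = true)
    (h : check s hw L z r acc = true) :
    acc + unit * (s * ∫ t in Set.Ioi (radInv (r / unit)),
      mixed (rad t) (θ - t) * radDeriv t) < 0 := by
  have hN := unit_pos'
  induction L generalizing m r acc z with
  | nil =>
    simp only [check, Bool.and_eq_true, decide_eq_true_eq] at h
    obtain ⟨h1, h2⟩ := h
    have h1' : (unit : ℝ) < r := by exact_mod_cast h1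
    have hr' : (0 : ℝ) < r := hN.trans h1'
    have hR : (1 : ℝ) < r / unit := by rwa [one_lt_div hN]
    have htail := abs_le.1 (abs_integral_tail_le (θ := θ) (radInv_nonneg (r / unit))
      (by rwa [rad_radInv (by positivity)]))
    rw [rad_radInv (by positivity)] at htail
    have h3 : s * (∫ t in Set.Ioi (radInv (r / unit)), mixed (rad t) (θ - t) * radDeriv t) ≤
        (2 + 1 / (r / unit : ℝ)) / (2 * (r / unit - 1) ^ 2) := by
      rcases hs with rfl | rfl <;> push_cast <;> linarith
    have h2' : (acc * (2 * r * ((r - unit) * (r - unit))) +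
      (2 * r + unit) * (unit * unit * unit) : ℝ) < 0 := by exact_mod_cast h2
    have h4 : unit * ((2 + 1 / (r / unit : ℝ)) / (2 * (r / unit - 1) ^ 2)) =
        (2 * r + unit) * (unit * unit * unit) / (2 * r * ((r - unit) * (r - unit))) := by
      have : (r : ℝ) - unit ≠ 0 := by linarith
      have : (r : ℝ) / unit - 1 ≠ 0 := by linarith
      field_simp
    have hp : (0 : ℝ) < 2 * r * ((r - unit) * (r - unit)) := by
      have : (0 : ℝ) < r - unit := by linarith
      positivity
    have h5 := mul_le_mul_of_nonneg_left h3 hN.le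
    rw [h4] at h5
    have h6 : acc + (2 * r + unit) * (unit * unit * unit) / (2 * r * ((r - unit) * (r - unit)))
        < (0 : ℝ) := by
      rw [← mul_lt_mul_iff_of_pos_right hp, zero_mul, add_mul, div_mul_cancel₀ _ hp.ne']
      exact h2'
    linarith
  | cons c L ih =>
    simp only [schedCheck, forceInt_eq, Bool.and_eq_true, Bool.or_eq_true, decide_eq_true_eq] at hL
    obtain ⟨⟨⟨⟨⟨⟨⟨hx, hy⟩, he⟩, hrc⟩, hcw⟩, hM⟩, hM'⟩, hL⟩ := hL
    have hu : c.u = Ang.ofInt (-c.n) := by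
      rcases hcu : c.u with ⟨a, b, e⟩
      rw [hcu] at hx hy he
      simp only at hx hy he
      rw [hx, hy, he]
    have hz' : (z.mul c.u).Enc (θ₀ - (m + c.n : ℤ) / 4096) := by
      rw [hu]
      convert hz.mul (Ang.Enc.ofInt (-c.n)) using 1
      push_cast; ring
    simp only [check, forceInt_eq] at h
    obtain ⟨b₀, lo₀, hi₀, e₀, hd₀⟩ := exists_withDist r
      ⟨(z.mul c.u).x, (z.mul c.u).y, (z.mul c.u).e⟩ fun b₀ lo₀ hi₀ => _
    rw [e₀] at h
    obtain ⟨b₁, lo₁, hi₁, e₁, hd₁⟩ := exists_withDist c.r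
      ⟨(z.mul c.u).x, (z.mul c.u).y, (z.mul c.u).e⟩ fun b₁ lo₁ hi₁ => _
    rw [e₁] at h
    simp only [Bool.and_eq_true, decide_eq_true_eq] at h
    obtain ⟨⟨⟨hb₀, hb₁⟩, hd⟩, h⟩ := h
    have hm' : 0 ≤ m + c.n := by positivity
    have h1 := ih hm' (hr.trans hrc) hz' hL h
    have hR : (0 : ℝ) ≤ r / unit := div_nonneg (by exact_mod_cast hr) hN.le
    have hRR : (r : ℝ) / unit ≤ c.r / unit := by
      have : (r : ℝ) ≤ c.r := by exact_mod_cast hrc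
      gcongr
    have h2 := integral_cell_le (θ := θ) (x := (z.mul c.u).x) (y := (z.mul c.u).y)
      (e := (z.mul c.u).e) (w := hw * 268435456 + c.w) hs hr hrc hz'
      (fun t ht => ?_) (hd₀ hb₀ _ hz') (hd₁ hb₁ _ hz') rfl hd
    · obtain ⟨δ, hδ, hδ'⟩ := hθ
      have hi := integrableOn_mixed hδ hδ'
      rw [← integral_interval_add_Ioi
        (hi.mono_set (Set.Ioi_subset_Ioi (radInv_nonneg (r / unit))))
        (hi.mono_set (Set.Ioi_subset_Ioi (radInv_nonneg (c.r / unit))))]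
      push_cast at *
      linarith
    · have h3 := abs_sub_le_of_schedCheck hr (mul_nonneg hm' (by norm_num)) hcw hM hM'
        (hr.trans hrc) ht
      have h4 := mul_le_mul_of_nonneg_left hθ₀ hN.le
      have h5 : unit * |θ - t - (θ₀ - (m + c.n : ℤ) / 4096)| ≤
          unit * |θ - θ₀| + |unit * t - ((m + c.n) * 268435456 : ℤ)| := by
        rw [← abs_of_pos hN, ← abs_mul, ← abs_mul, abs_of_pos hN]
        refine le_of_eq_of_le ?_ (abs_sub _ _)
        congr 1
        simp only [unit]
        push_cast
        ring
      have h6 : (unit : ℝ) * (hw / 4096) = hw * 268435456 := by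
        simp only [unit]
        push_cast
        ring
      push_cast at *
      linarith

lemma deriv_ne_zero_of_boxCheck {s t hw : ℤ} {L : List Cell} {θ : ℝ} (hs : s = 1 ∨ s = -1)
    (hL : schedCheck L 0 0 = true) (h : boxCheck s t hw L = true) (hθ : Regular θ)
    (ht : |θ - t / 4096| ≤ hw / 4096) : deriv Mplus θ ≠ 0 := by
  have hN := unit_pos'
  rw [boxCheck, forceInt_eq] at h
  set v := s * ((Ang.ofInt t).mul ⟨952205001410, 549755813888, 2⟩).x +
    ((Ang.ofInt t).mul ⟨952205001410, 549755813888, 2⟩).e + hw * 268435456 with hv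
  have h1 := neg_of_check hs hθ ht le_rfl le_rfl (by simpa using Ang.Enc.ofInt t) hL h
  have h0 : radInv ((0 : ℤ) / unit) = 0 := by simp [radInv]
  rw [h0] at h1
  have hb : Ang.Enc ⟨952205001410, 549755813888, 2⟩ (π / 6) := by
    refine Ang.Enc.of_abs_add_abs_le ?_
    rw [cos_pi_div_six, sin_pi_div_six]
    have h3 : (1.7320508075688 : ℝ) ≤ √3 := le_sqrt_of_sq_le (by norm_num)
    have h3' : √3 ≤ (1.7320508075689 : ℝ) := by
      rw [sqrt_le_left (by norm_num)]; norm_num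
    have a1 : |((952205001410 : ℤ) : ℝ) - unit * (√3 / 2)| ≤ 1 := by
      simp only [unit]
      push_cast
      exact abs_le.2 ⟨by linarith, by linarith⟩
    have a2 : |((549755813888 : ℤ) : ℝ) - unit * (1 / 2)| ≤ 1 := by
      simp only [unit]
      norm_num
    push_cast at *
    linarith
  have hc := abs_le.1 ((Ang.Enc.ofInt t).mul hb).abs_cos_le
  have hcos := abs_le.1 (abs_cos_sub_cos_le (θ + π / 6) (t / 4096 + π / 6))
  rw [add_sub_add_right_eq_sub] at hcos
  have h2 : s * (unit * cos (θ + π / 6)) ≤ v := by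
    have h6 : (unit : ℝ) * (hw / 4096) = hw * 268435456 := by
      simp only [unit]
      push_cast
      ring
    have h7 := mul_le_mul_of_nonneg_left (hcos.1.trans' (neg_le_neg ht)) hN.le
    have h8 := mul_le_mul_of_nonneg_left (hcos.2.trans ht) hN.le
    rw [hv]
    rcases hs with rfl | rfl <;> push_cast <;> linarith
  have h3 : amplitude * (s * (unit * cos (θ + π / 6))) ≤
      (max (1484 * v / 1000 + 1) (1496 * v / 1000 + 1) : ℤ) := by
    refine (mul_le_mul_of_nonneg_left h2 amplitude_nonneg).trans ?_
    have h4 := lt_cast_ediv_add_one (a := 1484 * v) (b := 1000) (by norm_num)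
    have h5 := lt_cast_ediv_add_one (a := 1496 * v) (b := 1000) (by norm_num)
    push_cast at *
    rcases le_total (v : ℝ) 0 with hv0 | hv0
    · refine le_max_of_le_left ?_
      have := mul_le_mul_of_nonpos_right le_amplitude hv0
      linarith
    · refine le_max_of_le_right ?_
      have := mul_le_mul_of_nonneg_right amplitude_le hv0
      linarith
  have h4 : sin (θ - π / 3) = -cos (θ + π / 6) := by
    rw [← sin_sub_pi_div_two]; ring_nf
  intro hd
  rw [deriv_Mplus hθ, h4, mul_neg, sub_neg_eq_add] at hd
  rw [amplitude] at h3
  have h5 : unit * (s * ((∫ t in Set.Ioi (0 : ℝ), mixed (rad t) (θ - t) * radDeriv t) +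
      √(2 / kap) * Gamma (2 / 3) * cos (θ + π / 6))) = 0 := by
    rw [hd]; ring
  linarith

lemma deriv_ne_zero_of_coverCheck {s last t : ℤ} {L : List Cell} {H : List ℤ} {θ : ℝ}
    (hs : s = 1 ∨ s = -1) (hL : schedCheck L 0 0 = true) (h : coverCheck s L last t H = true)
    (hθ : Regular θ) (h₀ : t / 4096 ≤ θ) (h₁ : θ < last / 4096) : deriv Mplus θ ≠ 0 := by
  induction H generalizing t with
  | nil =>
    simp only [coverCheck, decide_eq_true_eq] at h
    have : (last : ℝ) ≤ t := by exact_mod_cast h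
    linarith
  | cons hw H ih =>
    simp only [coverCheck, Bool.and_eq_true] at h
    rcases le_total θ ((t + 2 * hw) / 4096) with h2 | h2
    · refine deriv_ne_zero_of_boxCheck hs hL h.1 hθ ?_
      push_cast
      exact abs_le.2 ⟨by linarith, by linarith⟩
    · exact ih h.2 (by push_cast; exact h2)

lemma regular_of_abs_sub {θ : ℝ} (h : θ ≠ √2 / 3) (h' : |θ - √2 / 3| < 2 * π) : Regular θ := by
  refine regular_of_ne fun hc => h ?_
  rw [abs_lt] at h'
  exact sub_eq_zero.1 ((cos_eq_one_iff_of_lt_of_lt h'.1 h'.2).1 hc)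

lemma regular_of_mem_Bplus {θ : ℝ} (hθ : θ ∈ Bplus) : Regular θ := by
  have h1 : (1.41 : ℝ) ≤ √2 := le_sqrt_of_sq_le (by norm_num)
  have h2 : √2 ≤ (1.42 : ℝ) := by rw [sqrt_le_left (by norm_num)]; norm_num
  have h3 := pi_gt_three
  rcases hθ with (⟨h4, h5⟩ | ⟨h4, h5⟩) | ⟨h4, h5⟩
  · exact regular_of_abs_sub (by linarith) (abs_lt.2 ⟨by linarith, by linarith⟩)
  · exact regular_of_abs_sub (by linarith) (abs_lt.2 ⟨by linarith, by linarith⟩)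
  · exact regular_of_abs_sub (by linarith) (abs_lt.2 ⟨by linarith, by linarith⟩)

/-- The pieces used in the computation. -/
def schedule : List Cell :=
  cells 16 ⟨1099503239177, -4294956368, 173⟩ 4294967360 [
    71471135943] ++
  cells 32 ⟨1099478073511, -8589847200, 349⟩ 4294967360 [
    113453356382, 148665953691, 180095977270, 208982869269, 235992491281, 261534735860,
    285884543774, 309237645312, 331739626521, 353502488045, 374614728916, 395147816309,
    415160514830, 434701885661, 453813425528, 472530630427, 490884163476, 508900743476,
    526603832119, 544014173228, 561150221396, 578028486686, 594663814765, 611069616725,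
    627258059293, 643240223492, 659026237977, 674625391833, 690046230592, 705296638458,
    720383909081] ++
  cells 48 ⟨1099436131162, -12884606961, 429⟩ 8589934656 [
    750095619828] ++
  cells 64 ⟨1099377412771, -17179170119, 701⟩ 8589934656 [
    779230037497, 807829575541, 835931477076, 863568670869, 890770451756, 917563027834,
    943969965126, 970012552416, 995710103177, 1021080207439, 1046138943440, 1070901056680,
    1095380112348, 1119588625838, 1143538175097, 1167239497828, 1190702575991, 1213936709570,
    1236950581248, 1259752313330, 1282349518025, 1304749342014, 1326958506085, 1348983340490,
    1370829816584, 1392503575199, 1414009952180, 1435354001412, 1456540515631, 1477574045285,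
    1498458915667, 1519199242495, 1539798946128, 1560261764546, 1580591265239, 1600790856100,
    1620863795433, 1640813201165, 1660642059322, 1680353231867, 1699949463928, 1719433390499,
    1738807542647, 1758074353265, 1777236162428, 1796295222369, 1815253702115] ++
  cells 96 ⟨1099209651700, -25767444510, 861⟩ 17179869248 [
    1852877206751] ++
  cells 128 ⟨1098974800538, -34354146189, 1405⟩ 17179869248 [
    1890122521710, 1927004409794, 1963536653905, 1999732147400, 2035602973905, 2071160478068,
    2106415328477, 2141377573782, 2176056692915, 2210461640140, 2244600885585, 2278482451789,
    2312113946747, 2345502593847, 2378655259061, 2411578475687, 2444278466903, 2476761166386,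
    2509032237172, 2541097088954, 2572960893968, 2604628601612, 2636104951911, 2667394487943,
    2698501567332, 2729430372868, 2760184922369, 2790769077811, 2821186553834, 2851440925634,
    2881535636326] ++
  cells 192 ⟨1098303889369, -51520735187, 1725⟩ 34359738432 [
    2941259227165] ++
  cells 256 ⟨1097364843060, -68674746136, 2813⟩ 34359738432 [
    3000382479312, 3058928827255, 3116920149988, 3174376914437, 3231318302166, 3287762321681,
    3343725908307, 3399225013283, 3454274683476, 3508889132894, 3563081807027, 3616865440861,
    3670252111336, 3723253284867, 3775879860504] ++
  cells 384 ⟨1094683327436, -102928286358, 3453⟩ 68719476800 [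
    3880050209665] ++
  cells 512 ⟨1090932872127, -137081318854, 5629⟩ 68719476800 [
    3982840412710, 4084320829758, 4184555773762, 4283604226721, 4381520449395, 4478354503355,
    4574152700388, 4668957991314, 4762810303967, 4855746838281, 4947802324992, 5039009253321,
    5129398072103, 5218997368058, 5307834024340, 5395933361963, 5483319266337, 5570014300796,
    5656039808723, 5741416005651, 5826162062524, 5910296181142, 5993835662670]

theorem schedCheck_schedule : schedCheck schedule 0 0 = true := by
  decide +kernel

theorem coverCheck_left : coverCheck (-1) schedule (-2388) (-7080) [
    350, 443, 424, 352, 269, 196, 138, 95, 64, 42] = true := by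
  decide +kernel

theorem coverCheck_middle : coverCheck (1) schedule (237) (-1668) [
    26, 34, 42, 50, 58, 65, 70, 73, 74, 73, 70, 67, 63, 58, 54, 49, 45] = true := by
  decide +kernel

theorem coverCheck_right : coverCheck (1) schedule (17025) (3775) [
    38, 41, 44, 48, 52, 57, 61, 67, 73, 81, 89, 99, 112, 128, 149, 179, 220, 280, 367, 496, 600,
    600, 600, 600, 600, 600, 402] = true := by
  decide +kernel

end Melnikov

/-- `M₊'(θ) ≠ 0` for every `θ ∈ B₊`. -/
theorem Mplus_deriv_ne_zero_on_Bplus : ∀ θ ∈ Bplus, deriv Mplus θ ≠ 0 := by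
  have hL := Melnikov.schedCheck_schedule
  intro θ hθ
  have hreg := Melnikov.regular_of_mem_Bplus hθ
  rcases hθ with (⟨h₀, h₁⟩ | ⟨h₀, h₁⟩) | ⟨h₀, h₁⟩
  · exact Melnikov.deriv_ne_zero_of_coverCheck (.inr rfl) hL Melnikov.coverCheck_left hreg
      (by push_cast; linarith) (by push_cast; linarith)
  · exact Melnikov.deriv_ne_zero_of_coverCheck (.inl rfl) hL Melnikov.coverCheck_middle hreg
      (by push_cast; linarith) (by push_cast; linarith)
  · exact Melnikov.deriv_ne_zero_of_coverCheck (.inl rfl) hL Melnikov.coverCheck_right hreg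
      (by push_cast; linarith) (by push_cast; linarith)
end
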